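/- arXiv:1801.08195 — 2 statements merged into one kernel-verified Lean document; each statement's English description precedes it below -/
import Mathlib

section
/- If e(R/I) = 1, then pd(R/I) ≤ 3; and if e(R/I) = 2, then pd(R/I) ≤ 4. -/
open MvPolynomial Filter CategoryTheory

noncomputable section

/-- The height of an ideal `J`: the infimum of the heights of the prime ideals containing it. -/
def idealHeight {R : Type} [CommRing R] (J : Ideal R) : ℕ∞ :=
  ⨅ p ∈ {p : {q : Ideal R // q.IsPrime} | J ≤ p.1}, Order.height p

/-- `pdQuotLE J n` holds iff `R ⧸ J` admits a projective resolution of length at most `n`,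
i.e. the projective dimension of `R ⧸ J` as an `R`-module is at most `n`. -/
def pdQuotLE {R : Type} [CommRing R] (J : Ideal R) (n : ℕ) : Prop :=
  ∃ P : ProjectiveResolution (ModuleCat.of R (R ⧸ J)),
    ∀ i, n < i → Limits.IsZero (P.complex.X i)

/-- The `p`-primary component of `J` for `p` a minimal prime of `J`:
the saturation of `J` at `p`. -/
def primaryComponent {R : Type} [CommRing R] (J p : Ideal R) : Ideal R :=
  ⨆ (s : R) (_ : s ∉ p), Submodule.colon J (Ideal.span {s})

/-- The unmixed part `J^un` of `J`: the intersection of the primary components of `J`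
corresponding to the minimal primes of `J` of minimal height. -/
def unmixedPart {R : Type} [CommRing R] (J : Ideal R) : Ideal R :=
  ⨅ p ∈ {p : Ideal R | p.IsPrime ∧ J ≤ p ∧ idealHeight p = idealHeight J},
    primaryComponent J p

/-- A linear prime: a prime ideal generated by forms of degree one. -/
def IsLinearPrime {k : Type} [CommSemiring k] {N : ℕ} (p : Ideal (MvPolynomial (Fin N) k)) : Prop :=
  p.IsPrime ∧ ∃ S : Set (MvPolynomial (Fin N) k), (∀ ℓ ∈ S, ℓ.IsHomogeneous 1) ∧ p = Ideal.span S

/-- A homogeneous ideal: an ideal generated by homogeneous elements. -/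
def IsHomogeneousIdeal {k : Type} [CommSemiring k] {N : ℕ}
    (J : Ideal (MvPolynomial (Fin N) k)) : Prop :=
  ∃ S : Set (MvPolynomial (Fin N) k), (∀ g ∈ S, ∃ d, g.IsHomogeneous d) ∧ J = Ideal.span S

/-- `[B]_n`: the ideal generated by all forms of degree `n` belonging to `B`. -/
def degreePart {k : Type} [CommSemiring k] {N : ℕ} (B : Ideal (MvPolynomial (Fin N) k)) (n : ℕ) :
    Ideal (MvPolynomial (Fin N) k) :=
  Ideal.span {f | f ∈ B ∧ f.IsHomogeneous n}

/-- The Hilbert–Samuel function of `R/J` with respect to the irrelevant maximal ideal: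
`n ↦ length (R / (J + 𝔪^n)) = dim_k (R / (J + 𝔪^n))`. -/
def hilbertSamuelFn {k : Type} [Field k] {N : ℕ} (J : Ideal (MvPolynomial (Fin N) k))
    (n : ℕ) : ℕ :=
  Module.finrank k
    (MvPolynomial (Fin N) k ⧸
      (J ⊔ (Ideal.span (Set.range (MvPolynomial.X : Fin N → MvPolynomial (Fin N) k))) ^ n))

/-- `HasMultiplicity J d e`: the quotient `R/J` has Krull dimension `d` and Hilbert–Samuel
multiplicity `e`, expressed through the asymptotics `d! · HS_J(n) / n^d → e` of the
Hilbert–Samuel function. -/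
def HasMultiplicity {k : Type} [Field k] {N : ℕ} (J : Ideal (MvPolynomial (Fin N) k))
    (d e : ℕ) : Prop :=
  Tendsto (fun n : ℕ => (Nat.factorial d : ℝ) * (hilbertSamuelFn J n : ℝ) / (n : ℝ) ^ d)
    atTop (nhds (e : ℝ))

/-- An ideal of `R` is extended from a subalgebra `A` if it is generated by elements of `A`. -/
def extendedFrom {k R : Type} [CommRing k] [CommRing R] [Algebra k R]
    (K : Ideal R) (A : Subalgebra k R) : Prop :=
  ∃ S : Set R, S ⊆ (A : Set R) ∧ K = Ideal.span S

namespace ThreeCubics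

section Resolution

variable {R : Type} [CommRing R]

theorem exists_resolution_of_complex {Z : ModuleCat.{0} R} (K : ChainComplex (ModuleCat.{0} R) ℕ)
    (hK : ∀ n, Projective (K.X n)) (g : K.X 0 ⟶ Z) (w : K.d 1 0 ≫ g = 0) (hg : Epi g)
    (e0 : (ShortComplex.mk _ g w).Exact) (e1 : ∀ n, K.ExactAt (n + 1)) :
    ∃ P : ProjectiveResolution Z, P.complex = K := by
  refine ⟨{ complex := K
            projective := hK
            π := (ChainComplex.toSingle₀Equiv K Z).symm ⟨g, w⟩
            quasiIso := ?_ }, rfl⟩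
  refine ⟨fun n => ?_⟩
  cases n with
  | zero =>
    rw [ChainComplex.quasiIsoAt₀_iff, ShortComplex.quasiIso_iff_of_zeros']
    · refine (ShortComplex.exact_and_epi_g_iff_of_iso ?_).2
        ⟨e0, hg⟩
      refine ShortComplex.isoMk (Iso.refl _) (Iso.refl _) (Iso.refl _) ?_ ?_
      · exact (Category.id_comp _).trans (Category.comp_id _).symm
      · simp [ChainComplex.toSingle₀Equiv]
        rfl
    all_goals first | rfl | exact K.shape _ _ (by simp)
  | succ n =>
    rw [quasiIsoAt_iff_exactAt']
    · exact e1 n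
    · apply ChainComplex.exactAt_succ_single_obj

/-- splice a projective resolution of the kernel onto a projective cover -/
theorem exists_splice {S : ShortComplex (ModuleCat.{0} R)} (hS : S.ShortExact)
    (hP : Projective S.X₂) (Q : ProjectiveResolution S.X₁) :
    ∃ P : ProjectiveResolution S.X₃, ∀ i, P.complex.X (i + 1) = Q.complex.X i := by
  have := hS.mono_f
  have hepi := hS.epi_g
  obtain ⟨p, w0, hpi, hex0⟩ : ∃ (p : Q.complex.X 0 ⟶ S.X₁) (w : Q.complex.d 1 0 ≫ p = 0),
      Epi p ∧ (ShortComplex.mk (Q.complex.d 1 0) p w).Exact :=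
    ⟨Q.π.f 0, Q.complex_d_comp_π_f_zero, inferInstanceAs (Epi (Q.π.f 0)), Q.exact₀⟩
  have w : Q.complex.d 1 0 ≫ (p ≫ S.f) = 0 := by
    rw [← Category.assoc, w0, Limits.zero_comp]
  have hw2 : (p ≫ S.f) ≫ S.g = 0 := by rw [Category.assoc, S.zero, Limits.comp_zero]
  have e0 : (ShortComplex.mk _ S.g hw2).Exact := by
    have h1 := hS.exact
    rw [ShortComplex.moduleCat_exact_iff] at h1 ⊢
    intro x hx
    obtain ⟨y, hy⟩ := h1 x hx
    obtain ⟨z, hz⟩ := (ModuleCat.epi_iff_surjective _).1 hpi y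
    refine ⟨z, ?_⟩
    rw [← hy, ← hz]
    rfl
  have e1 : (ShortComplex.mk _ _ w).Exact := by
    rw [ShortComplex.moduleCat_exact_iff] at hex0 ⊢
    intro x hx
    refine hex0 x ?_
    apply (ModuleCat.mono_iff_injective S.f).1 inferInstance
    rw [map_zero]
    exact hx
  obtain ⟨P, hP⟩ := exists_resolution_of_complex (Z := S.X₃)
    (ChainComplex.augment Q.complex (p ≫ S.f) w)
    (by
      rintro (_ | n)
      · exact hP
      · exact Q.projective n) S.g hw2 hepi e0 (by
      intro n
      rw [HomologicalComplex.exactAt_iff' _ (n + 1 + 1) (n + 1) n (by simp) (by simp)]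
      cases n with
      | zero => exact e1
      | succ n => 
        have := Q.complex_exactAt_succ n
        rw [HomologicalComplex.exactAt_iff' _ (n + 1 + 1) (n + 1) n (by simp) (by simp)] at this
        exact this)
  exact ⟨P, fun i => by rw [hP]; rfl⟩

theorem exists_resolution (n : ℕ) (M : ModuleCat.{0} R) (h : HasProjectiveDimensionLE M n) :
    ∃ P : ProjectiveResolution M, ∀ i, n < i → Limits.IsZero (P.complex.X i) := by
  induction n generalizing M with
  | zero =>
    have : Projective M := (projective_iff_hasProjectiveDimensionLE_zero M).2 h
    refine ⟨ProjectiveResolution.self M, fun i hi => ?_⟩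
    apply HomologicalComplex.isZero_single_obj_X
    exact hi.ne'
  | succ n ih =>
    rcases ModuleCat.enoughProjectives.1 M with ⟨⟨P, f⟩⟩
    let T := ShortComplex.mk (Limits.kernel.ι f) f (Limits.kernel.condition f)
    have T_exact : T.ShortExact := { exact := ShortComplex.exact_kernel f }
    have := (T_exact.hasProjectiveDimensionLT_X₃_iff n ‹_›).mp h
    obtain ⟨Q, hQ⟩ := ih _ this
    obtain ⟨P', hP'⟩ := exists_splice T_exact ‹_› Q
    refine ⟨P', fun i hi => ?_⟩
    obtain ⟨j, rfl⟩ : ∃ j, i = j + 1 := ⟨i - 1, by omega⟩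
    rw [hP']
    exact hQ j (by omega)

end Resolution

end ThreeCubics

namespace ThreeCubics
section PD

/-- projective dimension at most `n`, unbundled. -/
def PD (R : Type) [CommRing R] (M : Type) [AddCommGroup M] [Module R M] (n : ℕ) : Prop :=
  HasProjectiveDimensionLE (ModuleCat.of R M) n

variable {R : Type} [CommRing R] {K P M : Type} [AddCommGroup K] [Module R K] [AddCommGroup P]
  [Module R P] [AddCommGroup M] [Module R M]

theorem PD_zero_iff : PD R M 0 ↔ Module.Projective R M := by
  unfold PD
  rw [← projective_iff_hasProjectiveDimensionLE_zero]
  exact (IsProjective.iff_projective M).symm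

theorem PD.mono {n m : ℕ} (h : PD R M n) (hnm : n ≤ m) : PD R M m := by
  unfold PD at *
  exact hasProjectiveDimensionLT_of_ge _ (n + 1) (m + 1) (by omega)

theorem ses_shortExact (i : K →ₗ[R] P) (p : P →ₗ[R] M) (hi : Function.Injective i)
    (hp : Function.Surjective p) (h : Function.Exact i p) :
    (ShortComplex.mk (ModuleCat.ofHom i) (ModuleCat.ofHom p)
      (by ext x; exact h.apply_apply_eq_zero x)).ShortExact where
  exact := by
    rw [ShortComplex.moduleCat_exact_iff]
    intro x hx
    exact (h x).1 hx
  mono_f := (ModuleCat.mono_iff_injective _).2 hi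
  epi_g := (ModuleCat.epi_iff_surjective _).2 hp

theorem PD.of_ses (i : K →ₗ[R] P) (p : P →ₗ[R] M) (hi : Function.Injective i)
    (hp : Function.Surjective p) (h : Function.Exact i p) {n : ℕ} (hK : PD R K n)
    (hP : PD R P (n + 1)) : PD R M (n + 1) :=
  (ses_shortExact i p hi hp h).hasProjectiveDimensionLT_X₃ (n + 1) hK hP

theorem PD.ses_left (i : K →ₗ[R] P) (p : P →ₗ[R] M) (hi : Function.Injective i)
    (hp : Function.Surjective p) (h : Function.Exact i p) {n : ℕ} (hP : Module.Projective R P)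
    (hM : PD R M (n + 1)) : PD R K n := by
  have hP' : Projective (ModuleCat.of R P) := (IsProjective.iff_projective P).1 hP
  exact ((ses_shortExact i p hi hp h).hasProjectiveDimensionLT_X₃_iff n hP').1 hM

end PD

section Poly
open TensorProduct

variable {A : Type} [CommRing A] (M : Type) [AddCommGroup M] [Module A M]
  [Module (Polynomial A) M] [IsScalarTower A (Polynomial A) M]

/-- multiplication by the variable -/
def xmul : M →ₗ[A] M := (LinearMap.lsmul (Polynomial A) M Polynomial.X).restrictScalars A

/-- the Koszul map -/
def kosz : (Polynomial A) ⊗[A] M →ₗ[Polynomial A] (Polynomial A) ⊗[A] M :=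
  (LinearMap.lsmul (Polynomial A) _ Polynomial.X) - (xmul (A := A) M).baseChange (Polynomial A)

/-- the multiplication map -/
def koszAug : (Polynomial A) ⊗[A] M →ₗ[Polynomial A] M :=
  TensorProduct.AlgebraTensorModule.lift
    { toFun := fun p => (LinearMap.lsmul (Polynomial A) M p).restrictScalars A
      map_add' := fun p q => by ext m; simp
      map_smul' := fun p q => by ext m; simp [mul_smul] }

theorem koszAug_tmul (p : Polynomial A) (m : M) : koszAug (A := A) M (p ⊗ₜ m) = p • m := rfl

theorem kosz_tmul (p : Polynomial A) (m : M) : kosz (A := A) M (p ⊗ₜ m) =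
   (Polynomial.X * p) ⊗ₜ m - p ⊗ₜ ((Polynomial.X : Polynomial A) • m) := by
  simp [kosz, xmul, TensorProduct.smul_tmul']

/-- partial contraction -/
def contrAux : ℕ → M →ₗ[A] (Polynomial A) ⊗[A] M
  | 0 => 0
  | i + 1 => TensorProduct.mk A (Polynomial A) M (Polynomial.X ^ i) +
      contrAux i ∘ₗ xmul (A := A) M

/-- contraction -/
def contr : (Polynomial A) ⊗[A] M →ₗ[A] (Polynomial A) ⊗[A] M :=
  TensorProduct.lift ((Polynomial.basisMonomials A).constr A (contrAux (A := A) M))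

theorem contr_tmul (i : ℕ) (m : M) :
    contr (A := A) M ((Polynomial.X ^ i) ⊗ₜ m) = contrAux (A := A) M i m := by
  unfold contr
  rw [TensorProduct.lift.tmul]
  have := (Polynomial.basisMonomials A).constr_basis A (contrAux (A := A) M) i
  simp only [Polynomial.coe_basisMonomials, Polynomial.monomial_one_right_eq_X_pow] at this
  rw [this]

theorem tensor_ext {Q : Type} [AddCommGroup Q] [Module A Q]
    (f g : (Polynomial A) ⊗[A] M →ₗ[A] Q)
    (h : ∀ i m, f ((Polynomial.X ^ i) ⊗ₜ m) = g ((Polynomial.X ^ i) ⊗ₜ m)) : f = g := by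
  apply TensorProduct.ext
  refine (Polynomial.basisMonomials A).ext fun i => ?_
  ext m
  simpa [Polynomial.monomial_one_right_eq_X_pow] using h i m

theorem contr_kosz (z) : contr (A := A) M (kosz (A := A) M z) = z := by
  have : contr (A := A) M ∘ₗ ((kosz (A := A) M).restrictScalars A) = LinearMap.id := by
    apply tensor_ext
    intro i m
    simp only [LinearMap.comp_apply, LinearMap.restrictScalars_apply, LinearMap.id_apply]
    rw [kosz_tmul, map_sub, ← pow_succ', contr_tmul, contr_tmul, contrAux]
    simp [xmul]
  exact LinearMap.congr_fun this z

theorem kosz_contrAux (i : ℕ) (m : M) : kosz (A := A) M (contrAux (A := A) M i m) =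
    (Polynomial.X ^ i) ⊗ₜ m - 1 ⊗ₜ ((Polynomial.X ^ i : Polynomial A) • m) := by
  induction i generalizing m with
  | zero => simp [contrAux]
  | succ i ih =>
    rw [contrAux, LinearMap.add_apply, LinearMap.comp_apply, map_add, ih, TensorProduct.mk_apply,
      kosz_tmul, ← pow_succ']
    simp [xmul, smul_smul, pow_succ]

theorem kosz_contr (z) : kosz (A := A) M (contr (A := A) M z) =
    z - 1 ⊗ₜ (koszAug (A := A) M z) := by
  have : ((kosz (A := A) M).restrictScalars A) ∘ₗ contr (A := A) M = LinearMap.id -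
      (TensorProduct.mk A (Polynomial A) M 1) ∘ₗ ((koszAug (A := A) M).restrictScalars A) := by
    apply tensor_ext
    intro i m
    simp only [LinearMap.comp_apply, LinearMap.restrictScalars_apply, LinearMap.id_apply,
      LinearMap.sub_apply]
    rw [contr_tmul, kosz_contrAux, koszAug_tmul, TensorProduct.mk_apply]
  exact LinearMap.congr_fun this z

theorem kosz_exact : Function.Exact (kosz (A := A) M) (koszAug (A := A) M) := by
  intro z
  constructor
  · intro h
    refine ⟨contr (A := A) M z, ?_⟩
    rw [kosz_contr, h]; simp
  · rintro ⟨z, rfl⟩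
    induction z using TensorProduct.induction_on with
    | zero => simp
    | tmul p m => rw [kosz_tmul, map_sub, koszAug_tmul, koszAug_tmul, smul_smul, mul_comm, sub_self]
    | add x y hx hy => rw [map_add, map_add, hx, hy, add_zero]

theorem PD_poly_zero (h : Module.Projective A M) : PD (Polynomial A) M 1 := by
  have h1 : PD (Polynomial A) ((Polynomial A) ⊗[A] M) 0 := by
    rw [PD_zero_iff]; infer_instance
  refine PD.of_ses (kosz (A := A) M) (koszAug (A := A) M)
    (Function.LeftInverse.injective (contr_kosz M)) ?_ (kosz_exact M) h1 (h1.mono (by omega))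
  intro m
  exact ⟨1 ⊗ₜ m, by rw [koszAug_tmul, one_smul]⟩

theorem PD_poly (n : ℕ) (h : PD A M n) : PD (Polynomial A) M (n + 1) := by
  induction n generalizing M with
  | zero => exact PD_poly_zero M (PD_zero_iff.1 h)
  | succ n ih =>
    let f : (M →₀ Polynomial A) →ₗ[Polynomial A] M := Finsupp.linearCombination _ id
    have hf : Function.Surjective f := Finsupp.linearCombination_id_surjective _ _
    have hex : Function.Exact (LinearMap.ker f).subtype f := f.exact_subtype_ker_map
    have hfree : Module.Projective A (M →₀ Polynomial A) := inferInstance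
    have hK : PD A (LinearMap.ker f) n :=
      PD.ses_left ((LinearMap.ker f).subtype.restrictScalars A) (f.restrictScalars A)
        (Subtype.val_injective) hf hex hfree h
    refine PD.of_ses (LinearMap.ker f).subtype f Subtype.val_injective hf hex (ih _ hK) ?_
    exact PD.mono (PD_zero_iff.2 inferInstance) (Nat.zero_le _)

/-- A module over `A[X][Y]` which is projective over `A` has projective dimension at most two. -/
theorem PD_poly_poly (M : Type) [AddCommGroup M] [Module A M]
    [Module (Polynomial (Polynomial A)) M] [IsScalarTower A (Polynomial (Polynomial A)) M]
    (h : Module.Projective A M) : PD (Polynomial (Polynomial A)) M 2 := by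
  let _ : Module (Polynomial A) M :=
    Module.compHom M (Polynomial.C : Polynomial A →+* Polynomial (Polynomial A))
  have h1 : IsScalarTower (Polynomial A) (Polynomial (Polynomial A)) M := by
    refine ⟨fun a b m => ?_⟩
    change _ = (Polynomial.C a) • (b • m)
    rw [smul_smul, Polynomial.smul_eq_C_mul]
  have h2 : IsScalarTower A (Polynomial A) M := by
    refine ⟨fun a b m => ?_⟩
    change (Polynomial.C (a • b)) • m = a • ((Polynomial.C b) • m)
    rw [← Polynomial.smul_C, smul_assoc]
  exact PD_poly M 1 (PD_poly M 0 (PD_zero_iff.2 h))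

end Poly
end ThreeCubics

namespace ThreeCubics
section Monogenic
variable {B : Type} [CommRing B]

theorem monic_dvd_of_dvd_C_mul {f : Polynomial B} (hf : f.Monic) {b : B}
    (hb : ∀ c : B, b * c = 0 → c = 0) {w : Polynomial B} (h : f ∣ Polynomial.C b * w) : f ∣ w := by
  rw [← Polynomial.modByMonic_eq_zero_iff_dvd hf] at h ⊢
  rw [← Polynomial.smul_eq_C_mul, Polynomial.smul_modByMonic] at h
  ext i
  have := congrArg (fun p => Polynomial.coeff p i) h
  simp only [Polynomial.coeff_smul, Polynomial.coeff_zero, smul_eq_mul] at this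
  rw [hb _ this, Polynomial.coeff_zero]

/-- top coefficient of the remainder -/
def lam (f : Polynomial B) : Polynomial B →ₗ[B] B :=
  (Polynomial.lcoeff B (f.natDegree - 1)) ∘ₗ (Polynomial.modByMonicHom f)

theorem lam_apply (f s : Polynomial B) : lam f s = (s %ₘ f).coeff (f.natDegree - 1) := rfl

theorem lam_eq_zero_of_dvd {f : Polynomial B} (hf : f.Monic) {s : Polynomial B} (h : f ∣ s) :
    lam f s = 0 := by
  rw [lam_apply, (Polynomial.modByMonic_eq_zero_iff_dvd hf).2 h, Polynomial.coeff_zero]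

theorem lam_X_pow {f : Polynomial B} (hf : f.Monic) {i : ℕ} (hi : i < f.natDegree) :
    lam f (Polynomial.X ^ i) = if i = f.natDegree - 1 then 1 else 0 := by
  nontriviality B
  rw [lam_apply, (Polynomial.modByMonic_eq_self_iff hf).2, Polynomial.coeff_X_pow]
  · simp [eq_comm]
  · rw [Polynomial.degree_X_pow, Polynomial.degree_eq_natDegree hf.ne_zero]
    exact_mod_cast hi

/-- prescribed values -/
theorem exists_lam_aux {f : Polynomial B} (hf : f.Monic) (c : ℕ → B) (j : ℕ)
    (hj : j ≤ f.natDegree) :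
    ∃ u : Polynomial B, ∀ i < j, lam f (u * Polynomial.X ^ i) = c i := by
  induction j with
  | zero => exact ⟨0, by simp⟩
  | succ j ih =>
    obtain ⟨u, hu⟩ := ih (by omega)
    refine ⟨u + (c j - lam f (u * Polynomial.X ^ j)) • Polynomial.X ^ (f.natDegree - 1 - j), ?_⟩
    intro i hi
    rw [add_mul, map_add, smul_mul_assoc, map_smul, ← pow_add, lam_X_pow hf (by omega)]
    rcases Nat.lt_succ_iff_lt_or_eq.1 hi with h | rfl
    · rw [hu i h, if_neg (by omega)]; simp
    · rw [if_pos (by omega)]; simp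

theorem exists_lam {f : Polynomial B} (hf : f.Monic) (c : ℕ → B) :
    ∃ u : Polynomial B, ∀ i < f.natDegree, lam f (u * Polynomial.X ^ i) = c i :=
  exists_lam_aux hf c _ le_rfl

/-- two additive maps killing multiples of `f` agree if they agree on low monomials -/
theorem addMonoidHom_ext_of_monic {f : Polynomial B} (hf : f.Monic) {Q : Type} [AddCommGroup Q]
    (φ ψ : Polynomial B →+ Q) (h1 : ∀ s, φ (f * s) = 0) (h2 : ∀ s, ψ (f * s) = 0)
    (h : ∀ i < f.natDegree, ∀ b : B, φ (Polynomial.C b * Polynomial.X ^ i) =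
      ψ (Polynomial.C b * Polynomial.X ^ i)) (s : Polynomial B) : φ s = ψ s := by
  rcases subsingleton_or_nontrivial B with _ | _
  · rw [Subsingleton.elim s 0, map_zero, map_zero]
  rw [← Polynomial.modByMonic_add_div s f, map_add, map_add, h1, h2, add_zero, add_zero]
  by_cases hn : f.natDegree = 0
  · rw [hf.natDegree_eq_zero.1 hn]; simp
  have hd : (s %ₘ f).natDegree < f.natDegree := by
    apply Polynomial.natDegree_modByMonic_lt _ hf
    rintro rfl
    simp at hn
  rw [(s %ₘ f).as_sum_range' f.natDegree hd, map_sum, map_sum]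
  refine Finset.sum_congr rfl fun i hi => ?_
  rw [← Polynomial.C_mul_X_pow_eq_monomial]
  exact h i (Finset.mem_range.1 hi) _

theorem exists_lam_functional {f : Polynomial B} (hf : f.Monic) (φ : Polynomial B →ₗ[B] B)
    (h : ∀ s, φ (f * s) = 0) : ∃ u, ∀ s, φ s = lam f (u * s) := by
  obtain ⟨u, hu⟩ := exists_lam hf (fun i => φ (Polynomial.X ^ i))
  refine ⟨u, fun s => ?_⟩
  refine addMonoidHom_ext_of_monic hf φ.toAddMonoidHom
    ((lam f).toAddMonoidHom.comp (AddMonoidHom.mulLeft u)) h ?_ ?_ s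
  · intro s
    exact lam_eq_zero_of_dvd hf ⟨u * s, by change u * (f * s) = _; ring⟩
  · intro i hi b
    change φ _ = lam f (u * _)
    rw [mul_left_comm, ← Polynomial.smul_eq_C_mul, ← Polynomial.smul_eq_C_mul, map_smul, map_smul,
      hu i hi]

/-- nondegeneracy modulo an element -/
theorem lam_nondeg {f : Polynomial B} (hf : f.Monic) (ρ : B) (u : Polynomial B)
    (h : ∀ s, ρ ∣ lam f (u * s)) : ∃ a b, u = f * a + Polynomial.C ρ * b := by
  nontriviality B
  set r := u %ₘ f with hr
  have hdeg : ∀ i, f.natDegree ≤ i → r.coeff i = 0 := by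
    intro i hi
    apply Polynomial.coeff_eq_zero_of_degree_lt
    refine (Polynomial.degree_modByMonic_lt u hf).trans_le ?_
    rw [Polynomial.degree_eq_natDegree hf.ne_zero]
    exact_mod_cast hi
  have hlam : ∀ s, lam f (u * s) = lam f (r * s) := by
    intro s
    have : u * s = r * s + f * (u /ₘ f * s) := by
      conv_lhs => rw [← Polynomial.modByMonic_add_div u f]
      ring
    rw [this, map_add, lam_eq_zero_of_dvd hf (Dvd.intro _ rfl), add_zero]
  have key : ∀ j, ∀ i, i + j + 1 = f.natDegree → ρ ∣ r.coeff i := by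
    intro j
    induction j using Nat.strong_induction_on with
    | _ j ih =>
      intro i hij
      have h1 := h (Polynomial.X ^ j)
      rw [hlam, r.as_sum_range' f.natDegree
        (by
          by_contra hcon
          have hz := hdeg r.natDegree (by omega)
          rw [Polynomial.coeff_natDegree, Polynomial.leadingCoeff_eq_zero] at hz
          rw [hz] at hcon; simp at hcon; omega), Finset.sum_mul, map_sum,
        ← Finset.add_sum_erase _ _ (Finset.mem_range.2 (by omega : i < f.natDegree))] at h1
      have h2 : ρ ∣ ∑ x ∈ (Finset.range f.natDegree).erase i,
          lam f (Polynomial.monomial x (r.coeff x) * Polynomial.X ^ j) := by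
        refine Finset.dvd_sum fun x hx => ?_
        rw [Finset.mem_erase, Finset.mem_range] at hx
        rw [← Polynomial.C_mul_X_pow_eq_monomial, mul_assoc, ← pow_add, ← Polynomial.smul_eq_C_mul,
          map_smul, smul_eq_mul]
        rcases lt_or_gt_of_ne hx.1 with hlt | hgt
        · rw [lam_X_pow hf (by omega), if_neg (by omega)]; simp
        · exact Dvd.dvd.mul_right (ih (f.natDegree - 1 - x) (by omega) x (by omega)) _
      have h3 := (dvd_add_left h2).1 h1
      rwa [← Polynomial.C_mul_X_pow_eq_monomial, mul_assoc, ← pow_add, ← Polynomial.smul_eq_C_mul,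
          map_smul, smul_eq_mul, lam_X_pow hf (by omega), if_pos (by omega), mul_one] at h3
  have : Polynomial.C ρ ∣ r := by
    rw [Polynomial.C_dvd_iff_dvd_coeff]
    intro i
    by_cases hi : i < f.natDegree
    · exact key (f.natDegree - 1 - i) i (by omega)
    · rw [hdeg i (by omega)]; exact dvd_zero _
  obtain ⟨b, hb⟩ := this
  refine ⟨u /ₘ f, b, ?_⟩
  rw [← hb, hr, add_comm, Polynomial.modByMonic_add_div u f]

theorem monic_mul_eq_zero {f : Polynomial B} (hf : f.Monic) (c : Polynomial B) (h : f * c = 0) :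
    c = 0 := by
  rwa [mul_comm, hf.mul_left_eq_zero_iff] at h

end Monogenic
end ThreeCubics

namespace ThreeCubics
section TwoStep
variable {A : Type} [CommRing A]

/-- the hypotheses on `f, g` giving a nice complete intersection, finite over `A` -/
structure NiceCI (f g h : Polynomial (Polynomial A)) (ρ : Polynomial A) : Prop where
  hf : f.Monic
  hρ : ρ.Monic
  hgh : ∃ c, h * g + c * f = Polynomial.C ρ

variable {f g h : Polynomial (Polynomial A)} {ρ : Polynomial A}

/-- iterated residue -/
def Lam (f : Polynomial (Polynomial A)) (ρ : Polynomial A) : Polynomial (Polynomial A) →ₗ[A] A :=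
  (lam ρ) ∘ₗ ((lam f).restrictScalars A)

theorem Lam_apply (s) : Lam f ρ s = lam ρ (lam f s) := rfl

theorem mem_span_pair_iff (u v w : Polynomial (Polynomial A)) :
    w ∈ Ideal.span {u, v} ↔ ∃ a b, w = u * a + v * b := by
  rw [Ideal.mem_span_pair]
  constructor
  · rintro ⟨a, b, h⟩; exact ⟨a, b, by rw [← h]; ring⟩
  · rintro ⟨a, b, h⟩; exact ⟨a, b, by rw [h]; ring⟩

theorem NiceCI.Lam_f (H : NiceCI f g h ρ) (s) : Lam f ρ (f * s) = 0 := by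
  rw [Lam_apply, lam_eq_zero_of_dvd H.hf (Dvd.intro _ rfl), map_zero]

theorem lam_C_mul (p : Polynomial A) (s : Polynomial (Polynomial A)) :
    lam f (Polynomial.C p * s) = p * lam f s := by
  rw [← Polynomial.smul_eq_C_mul, map_smul, smul_eq_mul]

theorem NiceCI.Lam_rho (H : NiceCI f g h ρ) (s) : Lam f ρ (Polynomial.C ρ * s) = 0 := by
  rw [Lam_apply, lam_C_mul, lam_eq_zero_of_dvd H.hρ (Dvd.intro _ rfl)]

theorem NiceCI.Lam_nondeg (H : NiceCI f g h ρ) (u) (hu : ∀ s, Lam f ρ (u * s) = 0) :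
    ∃ a b, u = f * a + Polynomial.C ρ * b := by
  apply lam_nondeg H.hf
  intro s
  have h1 : ∃ a b, lam f (u * s) = ρ * a + Polynomial.C 0 * b := by
    apply lam_nondeg H.hρ
    intro p
    have := hu (s * Polynomial.C p)
    rw [Lam_apply, show u * (s * Polynomial.C p) = Polynomial.C p * (u * s) by ring, lam_C_mul] at this
    rw [mul_comm, this]
  obtain ⟨a, b, hab⟩ := h1
  exact ⟨a, by rw [hab]; simp⟩

theorem NiceCI.dvd_of_rho (H : NiceCI f g h ρ) {w} (hw : f ∣ Polynomial.C ρ * w) : f ∣ w :=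
  monic_dvd_of_dvd_C_mul H.hf (fun c hc => monic_mul_eq_zero H.hρ c hc) hw

/-- the dualizing functional -/
def theta (f h : Polynomial (Polynomial A)) (ρ : Polynomial A) : Polynomial (Polynomial A) →ₗ[A] A :=
  Lam f ρ ∘ₗ ((LinearMap.mulLeft (Polynomial (Polynomial A)) h).restrictScalars A)

theorem theta_apply (s) : theta f h ρ s = Lam f ρ (h * s) := rfl

theorem NiceCI.theta_zero (H : NiceCI f g h ρ) {s} (hs : s ∈ Ideal.span {f, g}) :
    theta f h ρ s = 0 := by
  obtain ⟨a, b, rfl⟩ := (mem_span_pair_iff _ _ _).1 hs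
  obtain ⟨c, hc⟩ := H.hgh
  rw [theta_apply, show h * (f * a + g * b) = f * (h * a - c * b) + (h * g + c * f) * b by ring, hc,
    map_add, H.Lam_f, H.Lam_rho, add_zero]

theorem NiceCI.theta_nondeg (H : NiceCI f g h ρ) (w) (hw : ∀ s, theta f h ρ (w * s) = 0) :
    w ∈ Ideal.span {f, g} := by
  obtain ⟨a, b, hab⟩ := H.Lam_nondeg (h * w) (by
    intro s; rw [mul_assoc]; exact hw s)
  obtain ⟨c, hc⟩ := H.hgh
  have h1 : f ∣ Polynomial.C ρ * (w - g * b) := by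
    rw [← hc]
    refine ⟨g * (a + c * b) + c * (w - g * b), ?_⟩
    have : h * w = f * a + (h * g + c * f) * b := by rw [hc, hab]
    linear_combination g * this
  obtain ⟨v, hv⟩ := H.dvd_of_rho h1
  rw [mem_span_pair_iff]
  exact ⟨v, b, by rw [← hv]; ring⟩

theorem NiceCI.theta_surj (H : NiceCI f g h ρ) (φ : Polynomial (Polynomial A) →ₗ[A] A)
    (hφ : ∀ s ∈ Ideal.span {f, g}, φ s = 0) : ∃ w, ∀ s, φ s = theta f h ρ (w * s) := by
  obtain ⟨c, hc⟩ := H.hgh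
  -- first find `u` for `Lam`
  have h1 : ∀ s, ∃ q, ∀ p, φ (Polynomial.C p * s) = lam ρ (q * p) := by
    intro s
    let φs : Polynomial A →ₗ[A] A :=
      { toFun := fun p => φ (Polynomial.C p * s)
        map_add' := fun p q => by rw [map_add, add_mul, map_add]
        map_smul' := fun a p => by
          rw [← Polynomial.smul_C, smul_mul_assoc, map_smul, RingHom.id_apply] }
    refine exists_lam_functional H.hρ φs ?_
    intro p
    apply hφ
    rw [mem_span_pair_iff]
    exact ⟨c * Polynomial.C p * s, h * Polynomial.C p * s, by rw [map_mul, ← hc]; ring⟩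
  choose q hq using h1
  obtain ⟨u, hu⟩ := exists_lam H.hf (fun i => q (Polynomial.X ^ i))
  have h2 : ∀ s, φ s = Lam f ρ (u * s) := by
    refine addMonoidHom_ext_of_monic H.hf φ.toAddMonoidHom
      ((Lam f ρ).toAddMonoidHom.comp (AddMonoidHom.mulLeft u)) ?_ ?_ ?_
    · intro s
      exact hφ _ ((mem_span_pair_iff _ _ _).2 ⟨s, 0, by ring⟩)
    · intro s
      change Lam f ρ (u * (f * s)) = 0
      rw [mul_left_comm, H.Lam_f]
    · intro i hi p
      change φ _ = Lam f ρ (u * _)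
      rw [hq, ← hu i hi, Lam_apply, mul_left_comm, lam_C_mul, mul_comm]
  -- `u g ∈ (f, ρ)`
  obtain ⟨a, b, hab⟩ := H.Lam_nondeg (u * g) (by
    intro s
    rw [mul_assoc, ← h2]
    exact hφ _ ((mem_span_pair_iff _ _ _).2 ⟨0, s, by ring⟩))
  have h3 : f ∣ Polynomial.C ρ * (u - h * b) := by
    rw [← hc] at hab ⊢
    refine ⟨h * (a + c * b) + c * (u - h * b), ?_⟩
    linear_combination h * hab
  obtain ⟨v, hv⟩ := H.dvd_of_rho h3
  refine ⟨b, fun s => ?_⟩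
  rw [h2, theta_apply, show u * s = f * (v * s) + h * (b * s) by
    linear_combination s * hv, map_add, H.Lam_f, zero_add]

end TwoStep

section Flat
variable {A : Type} [CommRing A] {f g h : Polynomial (Polynomial A)} {ρ : Polynomial A}

theorem mem_map_of_mapmap_eq_zero (J : Ideal A) (v : Polynomial (Polynomial A))
    (hv : Polynomial.map (Polynomial.mapRingHom (Ideal.Quotient.mk J)) v = 0) :
    v ∈ J.map (algebraMap A (Polynomial (Polynomial A))) := by
  have h0 : (algebraMap A (Polynomial (Polynomial A))) =
    (Polynomial.C : Polynomial A →+* _).comp (Polynomial.C : A →+* Polynomial A) := rfl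
  rw [h0, ← Ideal.map_map, Ideal.mem_map_C_iff]
  intro i
  rw [Ideal.mem_map_C_iff]
  intro j
  have := congrArg (fun p => (p.coeff i).coeff j) hv
  simpa [Ideal.Quotient.eq_zero_iff_mem] using this

theorem exists_sum_of_mem {l : ℕ} (a : Fin l → A) (v : Polynomial (Polynomial A))
    (hv : v ∈ (Ideal.span (Set.range a)).map (algebraMap A (Polynomial (Polynomial A)))) :
    ∃ c : Fin l → Polynomial (Polynomial A), v = ∑ i, a i • c i := by
  rw [Ideal.map_span, ← Set.range_comp, Ideal.mem_span_range_iff_exists_fun] at hv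
  obtain ⟨c, hc⟩ := hv
  refine ⟨c, ?_⟩
  rw [← hc]
  refine Finset.sum_congr rfl fun i _ => ?_
  rw [Algebra.smul_def, mul_comm]; rfl

theorem NiceCI.flat (H : NiceCI f g h ρ) :
    Module.Flat A (Polynomial (Polynomial A) ⧸ Ideal.span {f, g}) := by
  obtain ⟨c, hc⟩ := H.hgh
  refine Module.Flat.of_forall_isTrivialRelation fun {l a x} hx => ?_
  choose t ht using fun i => Ideal.Quotient.mk_surjective (x i)
  have h1 : ∑ i, a i • t i ∈ Ideal.span {f, g} := by
    rw [← Ideal.Quotient.eq_zero_iff_mem, map_sum, ← hx]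
    refine Finset.sum_congr rfl fun i _ => ?_
    rw [← ht]; rfl
  obtain ⟨v, w, hvw⟩ := (mem_span_pair_iff _ _ _).1 h1
  set J := Ideal.span (Set.range a)
  let φ := Polynomial.mapRingHom (Polynomial.mapRingHom (Ideal.Quotient.mk J))
  have hφ0 : φ (∑ i, a i • t i) = 0 := by
    rw [map_sum]
    refine Finset.sum_eq_zero fun i _ => ?_
    have : a i • t i = Polynomial.C (Polynomial.C (a i)) * t i := by
      rw [Algebra.smul_def]; rfl
    rw [this, map_mul]
    have h3 : Ideal.Quotient.mk J (a i) = 0 :=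
      Ideal.Quotient.eq_zero_iff_mem.2 (Ideal.subset_span ⟨i, rfl⟩)
    simp [φ, h3]
  have hfm : (φ f).Monic := H.hf.map _
  have hρm : (Polynomial.map (Ideal.Quotient.mk J) ρ).Monic := H.hρ.map _
  have hφρ : φ (Polynomial.C ρ) = Polynomial.C (Polynomial.map (Ideal.Quotient.mk J) ρ) := by
    simp [φ]
  have e1 : φ f * φ v + φ g * φ w = 0 := by rw [← hφ0, hvw]; simp
  have e2 : φ h * φ g + φ c * φ f = φ (Polynomial.C ρ) := by rw [← hc]; simp
  have h2 : φ f ∣ φ w := by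
    refine monic_dvd_of_dvd_C_mul hfm (fun c hc => monic_mul_eq_zero hρm c hc) ?_
    rw [← hφρ]
    refine ⟨φ c * φ w - φ h * φ v, ?_⟩
    linear_combination φ h * e1 - φ w * e2
  obtain ⟨w1, hw1⟩ := h2
  obtain ⟨w', rfl⟩ : ∃ w', φ w' = w1 := Polynomial.map_surjective _
    (Polynomial.map_surjective _ Ideal.Quotient.mk_surjective) w1
  obtain ⟨cw, hcw⟩ := exists_sum_of_mem a (w - f * w') (mem_map_of_mapmap_eq_zero J _ (by
    change φ _ = 0
    rw [map_sub, map_mul, hw1, sub_self]))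
  obtain ⟨cv, hcv⟩ := exists_sum_of_mem a (v + g * w') (mem_map_of_mapmap_eq_zero J _ (by
    change φ _ = 0
    apply monic_mul_eq_zero hfm
    rw [map_add, map_mul]
    linear_combination e1 - φ g * hw1))
  have h4 : ∑ i, a i • (t i - f * cv i - g * cw i) = 0 := by
    simp only [smul_sub, Finset.sum_sub_distrib, ← mul_smul_comm, ← Finset.mul_sum]
    rw [← hcv, ← hcw, hvw]; ring
  have : Module.Free A (Polynomial (Polynomial A)) :=
    Module.Free.trans (R := A) (S := Polynomial A) (M := Polynomial (Polynomial A))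
  obtain ⟨n, M, y, hy1, hy2⟩ := Module.Flat.isTrivialRelation_of_sum_smul_eq_zero h4
  refine ⟨n, M, fun j => Ideal.Quotient.mk _ (y j), fun i => ?_, hy2⟩
  rw [← ht]
  have h5 : Ideal.Quotient.mk (Ideal.span {f, g}) (t i) =
      Ideal.Quotient.mk (Ideal.span {f, g}) (t i - f * cv i - g * cw i) := by
    rw [Ideal.Quotient.eq, mem_span_pair_iff]
    exact ⟨cv i, cw i, by ring⟩
  rw [h5, show t i - f * cv i - g * cw i = _ from hy1 i, map_sum]
  rfl

theorem NiceCI.finite (H : NiceCI f g h ρ) :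
    Module.Finite A (Polynomial (Polynomial A) ⧸ Ideal.span {f, g}) := by
  obtain ⟨c, hc⟩ := H.hgh
  refine ⟨(Submodule.fg_iff_exists_finite_generating_family).2 ⟨Fin f.natDegree × Fin ρ.natDegree,
    inferInstance, fun ij => Ideal.Quotient.mk _
      (Polynomial.C (Polynomial.X ^ (ij.2 : ℕ)) * Polynomial.X ^ (ij.1 : ℕ)), ?_⟩⟩
  set W : Submodule A (Polynomial (Polynomial A) ⧸ Ideal.span {f, g}) :=
    Submodule.span A (Set.range fun ij : Fin f.natDegree × Fin ρ.natDegree => Ideal.Quotient.mk _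
      (Polynomial.C (Polynomial.X ^ (ij.2 : ℕ)) * Polynomial.X ^ (ij.1 : ℕ)))
  let Q := (Polynomial (Polynomial A) ⧸ Ideal.span {f, g}) ⧸ W
  rw [eq_top_iff]
  intro z _
  obtain ⟨s, rfl⟩ := Ideal.Quotient.mk_surjective z
  rw [← Submodule.Quotient.mk_eq_zero]
  let π : Polynomial (Polynomial A) →+ Q :=
    (W.mkQ.toAddMonoidHom).comp (Ideal.Quotient.mk (Ideal.span {f, g})).toAddMonoidHom
  have hπ : ∀ s ∈ Ideal.span {f, g}, π s = 0 := by
    intro s hs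
    change W.mkQ (Ideal.Quotient.mk _ s) = 0
    rw [Ideal.Quotient.eq_zero_iff_mem.2 hs, map_zero]
  refine addMonoidHom_ext_of_monic H.hf π 0 ?_ (fun _ => rfl) ?_ s
  · intro s
    exact hπ _ ((mem_span_pair_iff _ _ _).2 ⟨s, 0, by ring⟩)
  · intro i hi p
    refine addMonoidHom_ext_of_monic H.hρ (π.comp ((AddMonoidHom.mulRight (Polynomial.X ^ i)).comp
      (Polynomial.C : Polynomial A →+* _).toAddMonoidHom)) 0 ?_ (fun _ => rfl) ?_ p
    · intro p
      refine hπ (Polynomial.C (ρ * p) * Polynomial.X ^ i) ?_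
      rw [mem_span_pair_iff]
      exact ⟨c * Polynomial.C p * Polynomial.X ^ i, h * Polynomial.C p * Polynomial.X ^ i,
        by rw [map_mul, ← hc]; ring⟩
    · intro j hj a
      change W.mkQ (Ideal.Quotient.mk _ (Polynomial.C (Polynomial.C a * Polynomial.X ^ j) *
        Polynomial.X ^ i)) = 0
      rw [Submodule.mkQ_apply, Submodule.Quotient.mk_eq_zero]
      have : (Ideal.Quotient.mk (Ideal.span {f, g}) (Polynomial.C (Polynomial.C a * Polynomial.X ^ j) *
        Polynomial.X ^ i)) = a • (Ideal.Quotient.mk (Ideal.span {f, g})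
          (Polynomial.C (Polynomial.X ^ j) * Polynomial.X ^ i)) := by
        have h6 : ∀ z : Polynomial (Polynomial A), Polynomial.C (Polynomial.C a) * z = a • z := by
          intro z; rw [Algebra.smul_def]; rfl
        rw [map_mul Polynomial.C, mul_assoc, h6]
        rfl
      rw [this]
      exact W.smul_mem _ (Submodule.subset_span ⟨(⟨i, hi⟩, ⟨j, hj⟩), rfl⟩)

theorem NiceCI.projective [IsNoetherianRing A] (H : NiceCI f g h ρ) :
    Module.Projective A (Polynomial (Polynomial A) ⧸ Ideal.span {f, g}) := by
  have := H.flat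
  have := H.finite
  have := Module.finitePresentation_of_finite A (Polynomial (Polynomial A) ⧸ Ideal.span {f, g})
  exact Module.Flat.projective_of_finitePresentation

end Flat
end ThreeCubics

namespace ThreeCubics
section CharP
variable {k : Type} [Field k] {d : ℕ}

theorem exists_psi (q : ℕ) (hq : 0 < q) (F : k ≃+* k) (m : Fin d →₀ ℕ) :
    ∃ ψ : MvPolynomial (Fin d) k → MvPolynomial (Fin d) k, ∀ n b,
      coeff n (ψ b) = F (coeff (m + q • n) b) := by
  have hinj : Function.Injective (fun n : Fin d →₀ ℕ => m + q • n) := by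
    intro n n' h
    have h1 := add_left_cancel h
    ext i
    have := DFunLike.congr_fun h1 i
    simpa [hq.ne'] using this
  refine ⟨fun b => AddMonoidAlgebra.ofCoeff (Finsupp.mapRange F (map_zero F)
    (Finsupp.comapDomain (fun n => m + q • n) (AddMonoidAlgebra.coeff b) hinj.injOn)), ?_⟩
  intro n b
  rfl

theorem psi_mul {p e : ℕ} [Fact p.Prime] [CharP k p] (F : k ≃+* k) (hF : ∀ c, F (c ^ p ^ e) = c)
    (m : Fin d →₀ ℕ) (hm : ∀ i, m i < p ^ e) (ψ : MvPolynomial (Fin d) k → MvPolynomial (Fin d) k)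
    (hψ : ∀ n b, coeff n (ψ b) = F (coeff (m + p ^ e • n) b)) (a b : MvPolynomial (Fin d) k) :
    ψ (a ^ p ^ e * b) = a * ψ b := by
  have hadd : ∀ x y, ψ (x + y) = ψ x + ψ y := by
    intro x y
    ext n
    simp [hψ]
  have : ExpChar (MvPolynomial (Fin d) k) p := ExpChar.prime Fact.out
  induction a using MvPolynomial.induction_on' with
  | add x y hx hy => rw [add_pow_expChar_pow, add_mul, hadd, hx, hy, add_mul]
  | monomial n₀ c =>
    ext n
    rw [hψ, monomial_pow, coeff_monomial_mul', coeff_monomial_mul', hψ]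
    by_cases h : n₀ ≤ n
    · have h' : p ^ e • n₀ ≤ m + p ^ e • n := by
        intro i
        simp only [Finsupp.smul_apply, Finsupp.add_apply, smul_eq_mul]
        have := Nat.mul_le_mul_left (p ^ e) (h i)
        omega
      rw [if_pos h, if_pos h', map_mul, hF]
      congr 3
      ext i
      simp only [Finsupp.smul_apply, Finsupp.add_apply, smul_eq_mul, Finsupp.tsub_apply]
      have := Nat.mul_le_mul_left (p ^ e) (h i)
      rw [Nat.mul_sub]
      omega
    · have h' : ¬ p ^ e • n₀ ≤ m + p ^ e • n := by
        intro h'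
        apply h
        intro i
        have h1 := h' i
        simp only [Finsupp.smul_apply, Finsupp.add_apply, smul_eq_mul] at h1
        by_contra hcon
        have h2 := Nat.mul_le_mul_left (p ^ e) (Nat.succ_le_of_lt (not_le.1 hcon))
        have := hm i
        rw [Nat.mul_succ] at h2
        omega
      rw [if_neg h, if_neg h', map_zero]

theorem charP_summand (p : ℕ) [Fact p.Prime] [CharP k p] [PerfectRing k p]
    {S : Type} [CommRing S] [Algebra (MvPolynomial (Fin d) k) S] 
    (τ : S →ₗ[MvPolynomial (Fin d) k] MvPolynomial (Fin d) k) (hτ : τ 1 ≠ 0) :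
    ∃ φ : S →ₗ[MvPolynomial (Fin d) k] MvPolynomial (Fin d) k, φ 1 = 1 := by
  set t := τ 1
  obtain ⟨m, hm⟩ := MvPolynomial.ne_zero_iff.1 hτ
  obtain ⟨e, he⟩ : ∃ e, t.totalDegree < p ^ e :=
    ⟨t.totalDegree, Nat.lt_pow_self (Fact.out : p.Prime).one_lt⟩
  have hq : 0 < p ^ e := by omega
  have hsum : ∀ n : Fin d →₀ ℕ, coeff n t ≠ 0 → ∀ i, n i ≤ t.totalDegree := by
    intro n hn i
    have h1 := le_totalDegree (mem_support_iff.2 hn)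
    refine le_trans ?_ h1
    by_cases h : n i = 0
    · omega
    · exact Finset.single_le_sum (f := fun i => n i) (fun _ _ => Nat.zero_le _)
        (Finsupp.mem_support_iff.2 h)
  let F := (iterateFrobeniusEquiv k p e).symm
  have hF : ∀ c, F (c ^ p ^ e) = c := fun c => (iterateFrobeniusEquiv k p e).symm_apply_apply c
  obtain ⟨ψ, hψ⟩ := exists_psi (p ^ e) hq F m
  have hadd : ∀ x y, ψ (x + y) = ψ x + ψ y := by
    intro x y
    ext n
    simp [hψ]
  have hmul := psi_mul F hF m (fun i => (hsum m hm i).trans_lt he) ψ hψ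
  have ht : ψ t = C (F (coeff m t)) := by
    ext n
    rw [hψ, coeff_C]
    split_ifs with h
    · subst h; simp
    · have : coeff (m + p ^ e • n) t = 0 := by
        by_contra hcon
        obtain ⟨i, hi⟩ : ∃ i, n i ≠ 0 := by
          by_contra hh
          push Not at hh
          exact h (by ext i; simp [hh i])
        have h1 := hsum _ hcon i
        simp only [Finsupp.smul_apply, Finsupp.add_apply, smul_eq_mul] at h1
        have := Nat.le_mul_of_pos_right (p ^ e) (Nat.pos_of_ne_zero hi)
        omega
      rw [this, map_zero]
  have : ExpChar (MvPolynomial (Fin d) k) p := ExpChar.prime Fact.out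
  have hSp : ((p : ℕ) : S) = 0 := by
    have h1 : ((p : ℕ) : MvPolynomial (Fin d) k) = 0 := CharP.cast_eq_zero _ p
    rw [← map_natCast (algebraMap (MvPolynomial (Fin d) k) S), h1, map_zero]
  have hfrob : ∀ x y : S, (x + y) ^ p ^ e = x ^ p ^ e + y ^ p ^ e := by
    rcases subsingleton_or_nontrivial S with _ | _
    · intro x y; exact Subsingleton.elim _ _
    · have : CharP S p := by
        have h2 := CharP.exists S
        obtain ⟨c, hc⟩ := h2
        have h3 := (CharP.cast_eq_zero_iff S c p).1 hSp
        rcases (Nat.dvd_prime (Fact.out : p.Prime)).1 h3 with h4 | h4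
        · exact absurd h4 (CharP.char_ne_one S c)
        · rwa [← h4]
      have : ExpChar S p := ExpChar.prime Fact.out
      intro x y
      exact add_pow_expChar_pow x y p e
  let φ : S →ₗ[MvPolynomial (Fin d) k] MvPolynomial (Fin d) k :=
    { toFun := fun s => ψ (τ (s ^ p ^ e))
      map_add' := fun x y => by rw [hfrob, map_add, hadd]
      map_smul' := fun a x => by
        rw [smul_pow, map_smul, smul_eq_mul, hmul, RingHom.id_apply, smul_eq_mul] }
  refine ⟨(C (F (coeff m t))⁻¹ : MvPolynomial (Fin d) k) • φ, ?_⟩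
  rw [LinearMap.smul_apply]
  change _ * ψ (τ (1 ^ p ^ e)) = 1
  rw [one_pow]
  change _ * ψ t = 1
  rw [ht, ← C_mul, inv_mul_cancel₀, C_1]
  simpa using hm

end CharP
end ThreeCubics

namespace ThreeCubics
section Summand

theorem exists_lift_of_range {A K S : Type} [CommRing A] [CommRing K] [Algebra A K]
    (hinj : Function.Injective (algebraMap A K)) [AddCommGroup S] [Module A S] (l : S →ₗ[A] K)
    (hl : ∀ s, ∃ a, algebraMap A K a = l s) :
    ∃ τ : S →ₗ[A] A, ∀ s, algebraMap A K (τ s) = l s := by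
  choose τ hτ using hl
  refine ⟨{ toFun := τ, map_add' := ?_, map_smul' := ?_ }, hτ⟩
  · intro x y; apply hinj; rw [map_add, hτ, hτ, hτ, map_add]
  · intro a x; apply hinj
    rw [hτ, map_smul, RingHom.id_apply, smul_eq_mul, map_mul, hτ, Algebra.smul_def]

theorem exists_tau {A S : Type} [CommRing A] [IsDomain A] [CommRing S] [IsDomain S] [Algebra A S]
    [Module.Finite A S] (hinj : Function.Injective (algebraMap A S)) :
    ∃ τ : S →ₗ[A] A, τ 1 ≠ 0 := by
  let K := FractionRing A
  let L := FractionRing S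
  have : FaithfulSMul A S := (faithfulSMul_iff_algebraMap_injective A S).2 hinj
  have : FaithfulSMul A L := FaithfulSMul.trans A S L
  let _ : Algebra K L := FractionRing.liftAlgebra A L
  have : IsScalarTower A K L := FractionRing.isScalarTower_liftAlgebra A L
  obtain ⟨l, hl⟩ := Module.Projective.exists_dual_ne_zero K (one_ne_zero : (1 : L) ≠ 0)
  obtain ⟨s, hs⟩ := (Module.Finite.fg_top : (⊤ : Submodule A S).FG)
  let l' : S →ₗ[A] K := (l.restrictScalars A) ∘ₗ (Algebra.linearMap S L).restrictScalars A
  obtain ⟨b, hb⟩ := IsLocalization.exist_integer_multiples (nonZeroDivisors A) s (fun x => l' x)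
  have hb0 : (b : A) ≠ 0 := nonZeroDivisors.ne_zero b.2
  obtain ⟨τ, hτ⟩ := exists_lift_of_range (IsFractionRing.injective A K) ((b : A) • l') (by
    intro x
    have hx : x ∈ Submodule.span A (s : Set S) := by rw [hs]; trivial
    induction hx using Submodule.span_induction with
    | mem x h => exact hb x h
    | zero => exact ⟨0, by simp⟩
    | add x y _ _ hx hy =>
      obtain ⟨a, ha⟩ := hx
      obtain ⟨c, hc⟩ := hy
      exact ⟨a + c, by rw [map_add, map_add, ha, hc]⟩
    | smul r x _ hx =>
      obtain ⟨a, ha⟩ := hx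
      exact ⟨r * a, by rw [map_mul, map_smul, ha, Algebra.smul_def]⟩)
  refine ⟨τ, fun h0 => ?_⟩
  have h1 := hτ 1
  rw [h0, map_zero] at h1
  have h2 : l' 1 = l 1 := by
    change l (algebraMap S L 1) = _
    rw [map_one]
  rw [LinearMap.smul_apply, h2, Algebra.smul_def, eq_comm, mul_eq_zero] at h1
  rcases h1 with h1 | h1
  · exact hb0 (IsFractionRing.injective A K (by rw [h1, map_zero]))
  · exact hl h1

theorem char0_summand {A S : Type} [CommRing A] [IsDomain A] [IsIntegrallyClosed A] [Algebra ℚ A]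
    [CommRing S] [IsDomain S] [Algebra A S]
    [Module.Finite A S] (hinj : Function.Injective (algebraMap A S)) :
    ∃ τ : S →ₗ[A] A, τ 1 = 1 := by
  let K := FractionRing A
  let L := FractionRing S
  have : FaithfulSMul A S := (faithfulSMul_iff_algebraMap_injective A S).2 hinj
  have : FaithfulSMul A L := FaithfulSMul.trans A S L
  let _ : Algebra K L := FractionRing.liftAlgebra A L
  have : IsScalarTower A K L := FractionRing.isScalarTower_liftAlgebra A L
  have : Algebra.IsIntegral A S := inferInstance
  have : FiniteDimensional K L := inferInstance
  let l' : S →ₗ[A] K := ((Algebra.trace K L).restrictScalars A) ∘ₗ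
    (Algebra.linearMap S L).restrictScalars A
  obtain ⟨τ, hτ⟩ := exists_lift_of_range (IsFractionRing.injective A K) l' (by
    intro x
    apply IsIntegrallyClosed.isIntegral_iff.1
    apply Algebra.isIntegral_trace
    exact (Algebra.IsIntegral.isIntegral (R := A) x).algebraMap)
  have h1 : τ 1 = algebraMap ℚ A (Module.finrank K L) := by
    apply IsFractionRing.injective A K
    rw [hτ]
    change Algebra.trace K L (algebraMap S L 1) = _
    rw [map_one, ← map_one (algebraMap K L), Algebra.trace_algebraMap]
    simp
  refine ⟨algebraMap ℚ A ((Module.finrank K L : ℚ)⁻¹) • τ, ?_⟩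
  rw [LinearMap.smul_apply, h1, smul_eq_mul, ← map_mul, inv_mul_cancel₀, map_one]
  have := Module.finrank_pos (R := K) (M := L)
  positivity

theorem direct_summand {k : Type} [Field k] [IsAlgClosed k] {d : ℕ} {G : Type} [CommRing G]
    [Algebra (MvPolynomial (Fin d) k) G] [Module.Finite (MvPolynomial (Fin d) k) G]
    (hinj : Function.Injective (algebraMap (MvPolynomial (Fin d) k) G)) :
    ∃ φ : G →ₗ[MvPolynomial (Fin d) k] MvPolynomial (Fin d) k, φ 1 = 1 := by
  set A := MvPolynomial (Fin d) k with hA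
  obtain ⟨Q, -, hQ, hQc⟩ := Ideal.exists_ideal_over_prime_of_isIntegral (S := G) (⊥ : Ideal A) ⊥
    (by rw [← RingHom.ker_eq_comap_bot, (RingHom.injective_iff_ker_eq_bot _).1 hinj])
  have hinj' : Function.Injective (algebraMap A (G ⧸ Q)) := by
    rw [injective_iff_map_eq_zero]
    intro a ha
    have : algebraMap A G a ∈ Q := Ideal.Quotient.eq_zero_iff_mem.1 ha
    have h2 : a ∈ Q.comap (algebraMap A G) := this
    rwa [hQc] at h2
  obtain ⟨φ, hφ⟩ : ∃ φ : (G ⧸ Q) →ₗ[A] A, φ 1 = 1 := by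
    obtain ⟨p, hp⟩ := CharP.exists k
    rcases CharP.char_is_prime_or_zero k p with h | h
    · have : Fact p.Prime := ⟨h⟩
      obtain ⟨τ, hτ⟩ := exists_tau hinj'
      exact charP_summand p τ hτ
    · subst h
      have : CharZero k := CharP.charP_to_charZero k
      have : Algebra ℚ A := inferInstance
      exact char0_summand hinj'
  exact ⟨φ ∘ₗ (Ideal.Quotient.mkₐ A Q).toLinearMap, hφ⟩

end Summand
end ThreeCubics

namespace ThreeCubics
section Dual
variable {A G : Type} [CommRing A] [IsDomain A] [AddCommGroup G] [Module A G]

theorem dual_rank_one (one : G) (φ₀ : G →ₗ[A] A) (h0 : φ₀ one = 1)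
    (hrk : ∀ x : Fin 2 → G, ¬ LinearIndependent A x) (φ : G →ₗ[A] A) (hφ : φ one = 0) : φ = 0 := by
  ext x
  have := hrk ![one, x]
  rw [LinearIndependent.pair_iff] at this
  push Not at this
  obtain ⟨a, b, hab, hne⟩ := this
  have hb : b ≠ 0 := by
    rintro rfl
    have h1 := congrArg φ₀ hab
    simp [h0] at h1
    exact hne h1 rfl
  have h2 := congrArg φ hab
  simp [hφ] at h2
  rcases h2 with h2 | h2
  · exact absurd h2 hb
  · simpa using h2

theorem dual_rank_two [UniqueFactorizationMonoid A] (one : G) (φ₀ : G →ₗ[A] A) (h0 : φ₀ one = 1)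
    (hrk : ∀ x : Fin 3 → G, ¬ LinearIndependent A x) : Module.Projective A (G →ₗ[A] A) := by
  by_cases hD : ∀ φ : G →ₗ[A] A, φ one = 0 → φ = 0
  · let E : A →ₗ[A] (G →ₗ[A] A) := LinearMap.toSpanSingleton A _ φ₀
    have hE : Function.Bijective E := by
      constructor
      · intro a b hab
        have := LinearMap.congr_fun hab one
        simpa [E, h0] using this
      · intro φ
        refine ⟨φ one, ?_⟩
        rw [← sub_eq_zero]
        apply hD
        simp [E, h0]
    exact Module.Projective.of_equiv (LinearEquiv.ofBijective E hE)
  push Not at hD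
  obtain ⟨φ₁, h1, hne⟩ := hD
  obtain ⟨q, hq⟩ : ∃ q, φ₁ q ≠ 0 := by
    by_contra hcon
    push Not at hcon
    exact hne (LinearMap.ext hcon)
  have hdet : ∀ φ : G →ₗ[A] A, φ one = 0 → φ q = 0 → φ = 0 := by
    intro φ hφ hφq
    ext x
    have := hrk ![one, q, x]
    rw [Fintype.not_linearIndependent_iff] at this
    obtain ⟨c, hc, i, hi⟩ := this
    rw [Fin.sum_univ_three] at hc
    simp only [Matrix.cons_val] at hc
    have hc2 : c 2 ≠ 0 := by
      intro h2
      have e1 := congrArg φ₁ hc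
      simp [h1, h2, hq] at e1
      have e0 := congrArg φ₀ hc
      simp [h0, e1, h2] at e0
      fin_cases i
      · exact hi e0
      · exact hi e1
      · exact hi h2
    have e2 := congrArg φ hc
    simp [hφ, hφq] at e2
    rcases e2 with e2 | e2
    · exact absurd e2 hc2
    · simpa using e2
  -- the set of values
  let V : Set A := {b | b ≠ 0 ∧ ∃ φ : G →ₗ[A] A, φ one = 0 ∧ φ q = b}
  have hV : V.Nonempty := ⟨φ₁ q, hq, φ₁, h1, rfl⟩
  obtain ⟨b, ⟨hb0, φb, hφb1, hφbq⟩, hmin⟩ :=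
    (wellFounded_dvdNotUnit (α := A)).has_min V hV
  have hdvd : ∀ φ : G →ₗ[A] A, φ one = 0 → b ∣ φ q := by
    intro φ hφ
    obtain ⟨a, a', c, hrel, hca, hca'⟩ :=
      UniqueFactorizationMonoid.exists_reduced_factors b hb0 (φ q)
    have ha0 : a ≠ 0 := by rintro rfl; simp at hca; exact hb0 hca.symm
    have hc0 : c ≠ 0 := by rintro rfl; simp at hca; exact hb0 hca.symm
    have hz : a' • φb - a • φ = 0 := by
      apply hdet
      · simp [hφ, hφb1]
      · simp only [LinearMap.sub_apply, LinearMap.smul_apply, smul_eq_mul, hφbq, ← hca, ← hca']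
        ring
    have hdiv : ∀ x, a ∣ φb x := by
      intro x
      have hx := LinearMap.congr_fun hz x
      simp only [LinearMap.sub_apply, LinearMap.smul_apply, smul_eq_mul, LinearMap.zero_apply] at hx
      have : a ∣ a' * φb x := ⟨φ x, by linear_combination hx⟩
      exact hrel.dvd_of_dvd_mul_left this
    choose ψ hψ using hdiv
    have hψlin : ∃ ψ' : G →ₗ[A] A, ∀ x, φb x = a * ψ' x := by
      refine ⟨{ toFun := ψ, map_add' := ?_, map_smul' := ?_ }, hψ⟩
      · intro x y
        apply mul_left_cancel₀ ha0
        rw [← hψ, map_add, mul_add, ← hψ, ← hψ]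
      · intro r x
        apply mul_left_cancel₀ ha0
        rw [← hψ, map_smul, hψ x, RingHom.id_apply, smul_eq_mul, smul_eq_mul]; ring
    obtain ⟨ψ', hψ'⟩ := hψlin
    have hcV : c ∈ V := by
      refine ⟨hc0, ψ', ?_, ?_⟩
      · have := hψ' one
        rw [hφb1, eq_comm, mul_eq_zero] at this
        exact this.resolve_left ha0
      · apply mul_left_cancel₀ ha0
        rw [← hψ', hφbq, ← hca, mul_comm]
    have := hmin c hcV
    have hau : IsUnit a := by
      by_contra hau
      exact this ⟨hc0, a, hau, hca.symm⟩
    rw [← hca, ← hca']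
    exact mul_dvd_mul_left c (hau.dvd)
  let E : (A × A) →ₗ[A] (G →ₗ[A] A) := (LinearMap.toSpanSingleton A _ φ₀).coprod
    (LinearMap.toSpanSingleton A _ φb)
  have hE : Function.Bijective E := by
    constructor
    · rw [← LinearMap.ker_eq_bot, LinearMap.ker_eq_bot']
      rintro ⟨x, y⟩ hxy
      have e1 := LinearMap.congr_fun hxy one
      simp [E, h0, hφb1] at e1
      have e2 := LinearMap.congr_fun hxy q
      simp [E, e1, hφbq, hb0] at e2
      rw [e1, e2]; rfl
    · intro φ
      obtain ⟨y, hy⟩ := hdvd (φ - φ one • φ₀) (by simp [h0])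
      refine ⟨(φ one, y), ?_⟩
      rw [eq_comm, ← sub_eq_zero]
      apply hdet
      · simp [E, h0, hφb1]
      · simp only [LinearMap.sub_apply, LinearMap.smul_apply, smul_eq_mul] at hy
        simp only [E, LinearMap.coprod_apply, LinearMap.toSpanSingleton_apply, LinearMap.sub_apply,
          LinearMap.add_apply, LinearMap.smul_apply, smul_eq_mul, hφbq]
        linear_combination hy
  exact Module.Projective.of_equiv (LinearEquiv.ofBijective E hE)

end Dual
end ThreeCubics

namespace ThreeCubics
section AlgMain
variable {k : Type} [Field k] [IsAlgClosed k] {d : ℕ}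

theorem range_projective {A F : Type} [CommRing A] [AddCommGroup F] [Module A F]
    [Module.Projective A F] {Q : Type} [AddCommGroup Q] [Module A Q] (m : F →ₗ[A] Q)
    (hm : Function.Surjective m) (r : F →ₗ[A] F)
    (h1 : ∀ v, m (r v) = 0) (h2 : ∀ v, m v = 0 → r v = v) : Module.Projective A Q := by
  choose s hs using hm
  let i : Q →ₗ[A] F :=
    { toFun := fun x => s x - r (s x)
      map_add' := fun x y => by
        have := h2 (s (x + y) - s x - s y) (by simp [hs])
        rw [map_sub, map_sub] at this
        rw [← sub_eq_zero] at this ⊢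
        rw [← neg_eq_zero, ← this]
        abel
      map_smul' := fun a x => by
        have := h2 (s (a • x) - a • s x) (by simp [hs])
        rw [map_sub, map_smul] at this
        rw [RingHom.id_apply, smul_sub]
        rw [← sub_eq_zero] at this ⊢
        rw [← neg_eq_zero, ← this]
        abel }
  refine Module.Projective.of_split i m ?_
  ext x
  change m (s x - r (s x)) = x
  rw [map_sub, h1, hs, sub_zero]

set_option maxHeartbeats 2000000 in
theorem main_alg {A : Type} [CommRing A] [IsDomain A] [IsNoetherianRing A]
    [UniqueFactorizationMonoid A]
    {f g h : Polynomial (Polynomial A)} {ρ : Polynomial A} (H : NiceCI f g h ρ)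
    (f₃ : Polynomial (Polynomial A))
    (I : Ideal (Polynomial (Polynomial A))) (hI : I = Ideal.span {f, g, f₃})
    (hds : (∀ a : A, a • (1 : Polynomial (Polynomial A) ⧸ I) = 0 → a = 0) →
      ∃ φ : (Polynomial (Polynomial A) ⧸ I) →ₗ[A] A, φ 1 = 1) :
    ((∀ x : Fin 2 → (Polynomial (Polynomial A) ⧸ I),
      ¬ LinearIndependent A x) →
      PD (Polynomial (Polynomial A)) (Polynomial (Polynomial A) ⧸ I) 3) ∧
    ((∀ x : Fin 3 → (Polynomial (Polynomial A) ⧸ I),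
      ¬ LinearIndependent A x) →
      PD (Polynomial (Polynomial A)) (Polynomial (Polynomial A) ⧸ I) 4) := by
  set J : Ideal (Polynomial (Polynomial A)) := Ideal.span {f, g} with hJ
  have hJI : J ≤ I := hI ▸ Ideal.span_mono (by
    intro x hx
    simp only [Set.mem_insert_iff, Set.mem_singleton_iff] at hx ⊢
    tauto)
  have hproj : Module.Projective A ((Polynomial (Polynomial A)) ⧸ J) := H.projective
  let m : ((Polynomial (Polynomial A)) ⧸ J) →ₗ[(Polynomial (Polynomial A))] ((Polynomial (Polynomial A)) ⧸ J) := LinearMap.lsmul (Polynomial (Polynomial A)) ((Polynomial (Polynomial A)) ⧸ J) f₃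
  let π : ((Polynomial (Polynomial A)) ⧸ J) →ₗ[(Polynomial (Polynomial A))] ((Polynomial (Polynomial A)) ⧸ I) := Submodule.factor hJI
  have hπmk : ∀ s : (Polynomial (Polynomial A)), π (Ideal.Quotient.mk J s) = Ideal.Quotient.mk I s := fun s => rfl
  have hmmk : ∀ s : (Polynomial (Polynomial A)), m (Ideal.Quotient.mk J s) = Ideal.Quotient.mk J (f₃ * s) := fun s => rfl
  have hπs : Function.Surjective π := Submodule.factor_surjective hJI
  have hker : ∀ z, π z = 0 ↔ ∃ y, m y = z := by
    intro z
    obtain ⟨s, rfl⟩ := Ideal.Quotient.mk_surjective z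
    rw [hπmk, Ideal.Quotient.eq_zero_iff_mem]
    constructor
    · intro hs
      rw [hI, Ideal.mem_span_insert] at hs
      obtain ⟨a, y, hy, rfl⟩ := hs
      rw [Ideal.mem_span_pair] at hy
      obtain ⟨b, c, rfl⟩ := hy
      refine ⟨Ideal.Quotient.mk J c, ?_⟩
      rw [hmmk, Ideal.Quotient.eq, hJ, mem_span_pair_iff]
      exact ⟨-a, -b, by ring⟩
    · rintro ⟨y, hy⟩
      obtain ⟨t, rfl⟩ := Ideal.Quotient.mk_surjective y
      rw [hmmk, Ideal.Quotient.eq] at hy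
      have h1 := hJI hy
      have h2 : f₃ * t ∈ I := I.mul_mem_right _ (hI ▸ Ideal.subset_span (by simp))
      have := I.sub_mem h2 h1
      simpa using this
  -- the exact sequences
  have pdF : PD (Polynomial (Polynomial A)) ((Polynomial (Polynomial A)) ⧸ J) 2 := PD_poly_poly _ hproj
  have step1 : ∀ n, PD (Polynomial (Polynomial A)) (LinearMap.ker m) n → 1 ≤ n → PD (Polynomial (Polynomial A)) (LinearMap.range m) (n + 1) := by
    intro n hn h1
    refine PD.of_ses (LinearMap.ker m).subtype m.rangeRestrict Subtype.val_injective
      m.surjective_rangeRestrict ?_ hn (pdF.mono (by omega))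
    intro z
    rw [← LinearMap.mem_ker, LinearMap.ker_rangeRestrict]
    simp
  have step2 : ∀ n, PD (Polynomial (Polynomial A)) (LinearMap.range m) n → 1 ≤ n → PD (Polynomial (Polynomial A)) ((Polynomial (Polynomial A)) ⧸ I) (n + 1) := by
    intro n hn h1
    refine PD.of_ses (LinearMap.range m).subtype π Subtype.val_injective hπs ?_ hn
      (pdF.mono (by omega))
    intro z
    rw [hker]
    simp
  -- duality
  let θ : ((Polynomial (Polynomial A)) ⧸ J) →ₗ[A] A := (J.restrictScalars A).liftQ (theta f h ρ) (by
    intro s hs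
    exact H.theta_zero hs)
  have hθ : ∀ s : (Polynomial (Polynomial A)), θ (Ideal.Quotient.mk J s) = theta f h ρ s := fun s => rfl
  have hinj : ∀ u : (Polynomial (Polynomial A)) ⧸ J, (∀ v, θ (u * v) = 0) → u = 0 := by
    intro u hu
    obtain ⟨w, rfl⟩ := Ideal.Quotient.mk_surjective u
    rw [Ideal.Quotient.eq_zero_iff_mem]
    apply H.theta_nondeg
    intro s
    rw [← hθ, map_mul, hu]
  have hsurj : ∀ φ : ((Polynomial (Polynomial A)) ⧸ J) →ₗ[A] A, ∃ u, ∀ v, φ v = θ (u * v) := by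
    intro φ
    obtain ⟨w, hw⟩ := H.theta_surj (φ ∘ₗ (Ideal.Quotient.mkₐ A J).toLinearMap) (by
      intro s hs
      change φ (Ideal.Quotient.mk J s) = 0
      rw [Ideal.Quotient.eq_zero_iff_mem.2 hs, map_zero])
    refine ⟨Ideal.Quotient.mk J w, fun v => ?_⟩
    obtain ⟨s, rfl⟩ := Ideal.Quotient.mk_surjective v
    rw [← map_mul, hθ, ← hw]
    rfl
  have hm : ∀ u, m u = Ideal.Quotient.mk J f₃ * u := by
    intro u
    obtain ⟨w, rfl⟩ := Ideal.Quotient.mk_surjective u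
    rfl
  have hφm : ∀ (φ : ((Polynomial (Polynomial A)) ⧸ I) →ₗ[A] A) (y : (Polynomial (Polynomial A)) ⧸ J), φ (π (m y)) = 0 := by
    intro φ y
    rw [(hker (m y)).2 ⟨y, rfl⟩, map_zero]
  -- elements of `G^*` give elements of `K₀`
  have hex : ∀ φ : ((Polynomial (Polynomial A)) ⧸ I) →ₗ[A] A, ∃ u : LinearMap.ker m, ∀ v, φ (π v) = θ (u * v) := by
    intro φ
    obtain ⟨u, hu⟩ := hsurj (φ ∘ₗ π.restrictScalars A)
    refine ⟨⟨u, ?_⟩, hu⟩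
    rw [LinearMap.mem_ker]
    apply hinj
    intro v
    rw [hm, show Ideal.Quotient.mk J f₃ * u * v = u * (Ideal.Quotient.mk J f₃ * v) by ring,
      ← hu, ← hm]
    exact hφm φ v
  have hexinv : ∀ u : LinearMap.ker m, ∃ φ : ((Polynomial (Polynomial A)) ⧸ I) →ₗ[A] A, ∀ v, φ (π v) = θ (u * v) := by
    rintro ⟨u, hu⟩
    choose s hs using hπs
    have key : ∀ v v', π v = π v' → θ (u * v) = θ (u * v') := by
      intro v v' hv
      obtain ⟨y, hy⟩ := (hker (v - v')).1 (by rw [map_sub, hv, sub_self])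
      have e : θ (u * (v - v')) = θ (u * v) - θ (u * v') :=
        (congrArg θ (mul_sub u v v')).trans (θ.map_sub _ _)
      have e2 : u * (Ideal.Quotient.mk J f₃ * y) = 0 :=
        ((mul_left_comm u _ y).trans (mul_assoc _ _ _).symm).trans
          ((congrArg (· * y) ((hm u).symm.trans (LinearMap.mem_ker.1 hu))).trans (zero_mul y))
      rw [← sub_eq_zero, ← e, ← hy, hm, e2, map_zero]
    refine ⟨{ toFun := fun x => θ (u * s x), map_add' := ?_, map_smul' := ?_ }, ?_⟩
    · intro x y
      rw [← map_add, ← mul_add]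
      exact key _ _ (by rw [map_add, hs, hs, hs])
    · intro a x
      rw [RingHom.id_apply, ← map_smul, ← mul_smul_comm]
      refine key _ _ ?_
      have : π (a • s x) = a • π (s x) := (π.restrictScalars A).map_smul a (s x)
      rw [this, hs, hs]
    · intro v
      exact key _ _ (hs _)
  have huniq : ∀ u u' : LinearMap.ker m, (∀ v, θ (u * v) = θ (u' * v)) → u = u' := by
    intro u u' huu
    apply Subtype.ext
    rw [← sub_eq_zero]
    apply hinj
    intro v
    have e : θ (((u : (Polynomial (Polynomial A)) ⧸ J) - u') * v) = θ (u * v) - θ (u' * v) :=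
      (congrArg θ (sub_mul (u : (Polynomial (Polynomial A)) ⧸ J) u' v)).trans (θ.map_sub _ _)
    rw [e, huu, sub_self]
  -- torsion case
  have htors : ¬ (∀ a : A, a • (1 : (Polynomial (Polynomial A)) ⧸ I) = 0 → a = 0) → ∀ φ : ((Polynomial (Polynomial A)) ⧸ I) →ₗ[A] A, φ = 0 := by
    intro hni φ
    push Not at hni
    obtain ⟨a, ha, hane⟩ := hni
    ext x
    have : a • x = 0 := by rw [← one_mul x, ← smul_mul_assoc, ha]; exact zero_mul x
    have h1 := congrArg φ this
    rw [map_smul, map_zero, smul_eq_mul] at h1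
    exact (mul_eq_zero.1 h1).resolve_left hane
  constructor
  · intro hrk
    refine step2 2 ?_ (by omega)
    refine PD_poly_poly _ ?_
    by_cases hinjA : (∀ a : A, a • (1 : (Polynomial (Polynomial A)) ⧸ I) = 0 → a = 0)
    · obtain ⟨φ₀, hφ₀⟩ := hds hinjA
      obtain ⟨e₀, he₀⟩ := hex φ₀
      refine range_projective (m.rangeRestrict.restrictScalars A) m.surjective_rangeRestrict
        ((LinearMap.toSpanSingleton A ((Polynomial (Polynomial A)) ⧸ J) (e₀ : (Polynomial (Polynomial A)) ⧸ J)) ∘ₗ θ) ?_ ?_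
      · intro v
        apply Subtype.ext
        change m (θ v • (e₀ : (Polynomial (Polynomial A)) ⧸ J)) = 0
        have : m (θ v • (e₀ : (Polynomial (Polynomial A)) ⧸ J)) = θ v • m e₀ := (m.restrictScalars A).map_smul _ _
        rw [this, LinearMap.mem_ker.1 e₀.2, smul_zero]
      · intro v hv
        have hv' : v ∈ LinearMap.ker m := congrArg Subtype.val hv
        obtain ⟨φ, hφ⟩ := hexinv ⟨v, hv'⟩
        have h1 : φ - φ 1 • φ₀ = 0 := dual_rank_one 1 φ₀ hφ₀ hrk _ (by simp [hφ₀])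
        have h2 : φ 1 = θ v := (hφ 1).trans (congrArg θ (mul_one v))
        have h3 : (⟨v, hv'⟩ : LinearMap.ker m) = θ v • e₀ := by
          apply huniq
          intro w
          rw [← hφ, ← h2]
          change _ = θ ((φ 1 • (e₀ : (Polynomial (Polynomial A)) ⧸ J)) * w)
          rw [smul_mul_assoc, map_smul, ← he₀]
          have := LinearMap.congr_fun h1 (π w)
          simpa [sub_eq_zero] using this
        exact (congrArg Subtype.val h3).symm
    · refine range_projective (m.rangeRestrict.restrictScalars A) m.surjective_rangeRestrict
        0 (fun v => by simp) ?_
      intro v hv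
      have hv' : v ∈ LinearMap.ker m := congrArg Subtype.val hv
      obtain ⟨φ, hφ⟩ := hexinv ⟨v, hv'⟩
      have h1 := htors hinjA φ
      rw [LinearMap.zero_apply, eq_comm]
      apply hinj
      intro w
      rw [← hφ, h1, LinearMap.zero_apply]
  · intro hrk
    refine step2 3 (step1 2 ?_ (by omega)) (by omega)
    refine PD_poly_poly _ ?_
    have hdual : Module.Projective A (((Polynomial (Polynomial A)) ⧸ I) →ₗ[A] A) := by
      by_cases hinjA : (∀ a : A, a • (1 : (Polynomial (Polynomial A)) ⧸ I) = 0 → a = 0)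
      · obtain ⟨φ₀, hφ₀⟩ := hds hinjA
        exact dual_rank_two 1 φ₀ hφ₀ hrk
      · have : Subsingleton (((Polynomial (Polynomial A)) ⧸ I) →ₗ[A] A) :=
          ⟨fun a b => by rw [htors hinjA a, htors hinjA b]⟩
        infer_instance
    choose Φ hΦ using hex
    let E : (((Polynomial (Polynomial A)) ⧸ I) →ₗ[A] A) →ₗ[A] LinearMap.ker m :=
      { toFun := Φ
        map_add' := fun x y => by
          apply huniq
          intro v
          rw [← hΦ]
          change _ = θ (((Φ x : (Polynomial (Polynomial A)) ⧸ J) + (Φ y : (Polynomial (Polynomial A)) ⧸ J)) * v)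
          rw [add_mul, map_add, ← hΦ, ← hΦ, LinearMap.add_apply]
        map_smul' := fun a x => by
          apply huniq
          intro v
          rw [← hΦ]
          change _ = θ ((a • (Φ x : (Polynomial (Polynomial A)) ⧸ J)) * v)
          rw [smul_mul_assoc, map_smul, ← hΦ, LinearMap.smul_apply] }
    refine Module.Projective.of_equiv (LinearEquiv.ofBijective E ⟨?_, ?_⟩)
    · intro x y hxy
      ext z
      obtain ⟨v, rfl⟩ := hπs z
      rw [hΦ, hΦ]
      change Φ x = Φ y at hxy
      rw [hxy]
    · intro u
      obtain ⟨φ, hφ⟩ := hexinv u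
      refine ⟨φ, ?_⟩
      apply huniq
      intro v
      rw [← hφ]; exact (hΦ φ v).symm

end AlgMain
end ThreeCubics

namespace ThreeCubics
section Rank
variable {k : Type} [Field k] {N d : ℕ}

attribute [local instance] MvPolynomial.gradedAlgebra

theorem mem_of_mem_sup_pow {I : Ideal (MvPolynomial (Fin N) k)}
    (hI : I.IsHomogeneous (homogeneousSubmodule (Fin N) k)) {n : ℕ} {w : MvPolynomial (Fin N) k}
    (hw : w ∈ I ⊔ (Ideal.span (Set.range (X : Fin N → MvPolynomial (Fin N) k))) ^ n)
    (hd : w.totalDegree < n) : w ∈ I := by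
  obtain ⟨a, ha, b, hb, rfl⟩ := Submodule.mem_sup.1 hw
  have hb' := (mem_pow_idealOfVars_iff' n b).1 hb
  rw [mem_iff_homogeneousComponent_mem hI]
  intro i
  by_cases hi : i < n
  · have : homogeneousComponent i b = 0 := by
      ext x
      rw [coeff_homogeneousComponent]
      split_ifs with h
      · exact hb' x (h ▸ hi)
      · simp
    rw [map_add, this, add_zero]
    exact homogeneousComponent_mem_of_mem hI ha i
  · rw [homogeneousComponent_eq_zero _ _ (by omega)]
    exact I.zero_mem

theorem finite_quot (I : Ideal (MvPolynomial (Fin N) k)) (n : ℕ) :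
    Module.Finite k (MvPolynomial (Fin N) k ⧸
      (I ⊔ (Ideal.span (Set.range (X : Fin N → MvPolynomial (Fin N) k))) ^ n)) := by
  set Q := (I ⊔ (Ideal.span (Set.range (X : Fin N → MvPolynomial (Fin N) k))) ^ n) with hQ
  refine Module.Finite.of_surjective
    ((Ideal.Quotient.mkₐ k Q).toLinearMap ∘ₗ (restrictTotalDegree (Fin N) k n).subtype) ?_
  intro z
  obtain ⟨p, rfl⟩ := Ideal.Quotient.mk_surjective z
  let q : MvPolynomial (Fin N) k := ∑ i ∈ Finset.range n, homogeneousComponent i p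
  refine ⟨⟨q, ?_⟩, ?_⟩
  · refine Submodule.sum_mem _ fun i hi => ?_
    rw [mem_restrictTotalDegree]
    exact (homogeneousComponent_isHomogeneous i p).totalDegree_le.trans (Finset.mem_range.1 hi).le
  · change Ideal.Quotient.mk Q q = Ideal.Quotient.mk Q p
    rw [Ideal.Quotient.eq, hQ]
    refine Ideal.mem_sup_right ((mem_pow_idealOfVars_iff' n _).2 fun x hx => ?_)
    rw [coeff_sub, coeff_sum, Finset.sum_eq_single x.degree]
    · rw [coeff_homogeneousComponent, if_pos rfl, sub_self]
    · intro b _ hb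
      rw [coeff_homogeneousComponent, if_neg (Ne.symm hb)]
    · intro h
      simp [hx] at h

theorem totalDegree_aeval_le (φ : Fin d → MvPolynomial (Fin N) k)
    (hφ : ∀ i, (φ i).totalDegree ≤ 1) (s : Fin d →₀ ℕ) (c : k) :
    (aeval φ (monomial s c)).totalDegree ≤ s.degree := by
  rw [aeval_monomial]
  refine (totalDegree_mul _ _).trans ?_
  rw [MvPolynomial.algebraMap_eq, totalDegree_C, zero_add]
  refine (totalDegree_finsetProd _ _).trans ?_
  rw [Finsupp.degree]
  refine Finset.sum_le_sum fun i _ => ?_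
  refine (totalDegree_pow _ _).trans ?_
  calc s i * (φ i).totalDegree ≤ s i * 1 := Nat.mul_le_mul_left _ (hφ i)
    _ = s i := mul_one _

/-- exponent vectors of total degree at most `m` in `d` variables -/
abbrev Expo (d m : ℕ) : Type := {P : Fin (d + 1) → ℕ // ∑ i, P i = m}

instance (d m : ℕ) : Fintype (Expo d m) := Fintype.ofEquiv _ (Sym.equivNatSumOfFintype (Fin (d + 1)) m)

theorem card_expo (d m : ℕ) : m ^ d ≤ d.factorial * Fintype.card (Expo d m) := by
  rw [← Fintype.card_congr (Sym.equivNatSumOfFintype (Fin (d + 1)) m), Sym.card_sym_eq_choose,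
    Fintype.card_fin, show d + 1 + m - 1 = m + d by omega, Nat.choose_symm_add,
    ← Nat.ascFactorial_eq_factorial_mul_choose]
  exact (Nat.pow_le_pow_left (Nat.le_succ m) d).trans (Nat.pow_succ_le_ascFactorial _ _)

def Expo.toFinsupp {d m : ℕ} (P : Expo d m) : Fin d →₀ ℕ :=
  Finsupp.equivFunOnFinite.symm fun i => P.1 i.succ

theorem Expo.degree_le {d m : ℕ} (P : Expo d m) : P.toFinsupp.degree ≤ m := by
  rw [Finsupp.degree_eq_sum]
  have := P.2
  rw [Fin.sum_univ_succ] at this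
  simp only [toFinsupp, Finsupp.equivFunOnFinite_symm_apply_apply]
  omega

theorem Expo.inj {d m : ℕ} : Function.Injective (Expo.toFinsupp : Expo d m → _) := by
  intro P Q h
  have h1 : ∀ i : Fin d, P.1 i.succ = Q.1 i.succ := fun i => DFunLike.congr_fun h i
  have hP := P.2
  have hQ := Q.2
  rw [Fin.sum_univ_succ] at hP hQ
  have h2 : ∑ i : Fin d, P.1 i.succ = ∑ i : Fin d, Q.1 i.succ := Finset.sum_congr rfl fun i _ => h1 i
  apply Subtype.ext
  funext i
  refine Fin.cases ?_ h1 i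
  omega

theorem rank_bound_fin {I : Ideal (MvPolynomial (Fin N) k)}
    (hI : I.IsHomogeneous (homogeneousSubmodule (Fin N) k))
    (φ : Fin d → MvPolynomial (Fin N) k) (hφ : ∀ i, (φ i).totalDegree ≤ 1) {r D : ℕ}
    (g : Fin r → MvPolynomial (Fin N) k) (hg : ∀ j, (g j).totalDegree ≤ D)
    (hind : ∀ c : Fin r → MvPolynomial (Fin d) k, ∑ j, aeval φ (c j) * g j ∈ I → ∀ j, c j = 0)
    (m n : ℕ) (hmn : m + D < n) :
    r * m ^ d ≤ d.factorial * hilbertSamuelFn I n := by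
  classical
  have := finite_quot I n
  set Q := (I ⊔ (Ideal.span (Set.range (X : Fin N → MvPolynomial (Fin N) k))) ^ n) with hQ
  let v : Fin r × Expo d m → MvPolynomial (Fin N) k ⧸ Q := fun x =>
    Ideal.Quotient.mkₐ k Q (aeval φ (monomial x.2.toFinsupp (1 : k)) * g x.1)
  have hv : LinearIndependent k v := by
    rw [Fintype.linearIndependent_iff]
    intro c hc
    let C' : Fin r → MvPolynomial (Fin d) k := fun j => ∑ P : Expo d m, c (j, P) • monomial P.toFinsupp 1
    have hw : ∑ x : Fin r × Expo d m, c x • (aeval φ (monomial x.2.toFinsupp (1 : k)) * g x.1)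
        = ∑ j, aeval φ (C' j) * g j := by
      rw [Fintype.sum_prod_type]
      refine Finset.sum_congr rfl fun j _ => ?_
      simp only [C', map_sum, map_smul, Finset.sum_mul, smul_mul_assoc]
    have hmem : ∑ j, aeval φ (C' j) * g j ∈ Q := by
      rw [← hw, ← Ideal.Quotient.eq_zero_iff_mem, ← hc]
      change Ideal.Quotient.mkₐ k Q _ = _
      simp only [v, map_sum, map_smul]
    have hdeg : (∑ j, aeval φ (C' j) * g j).totalDegree ≤ m + D := by
      rw [← hw]
      refine totalDegree_finsetSum_le fun x _ => ?_
      refine (totalDegree_smul_le _ _).trans ((totalDegree_mul _ _).trans (Nat.add_le_add ?_ (hg _)))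
      exact (totalDegree_aeval_le φ hφ _ _).trans x.2.degree_le
    have h0 := hind C' (mem_of_mem_sup_pow hI hmem (by omega))
    rintro ⟨j, P⟩
    have := congrArg (coeff P.toFinsupp) (h0 j)
    rw [coeff_sum, coeff_zero, Finset.sum_eq_single P] at this
    · simpa using this
    · intro P' _ hne
      rw [coeff_smul, coeff_monomial, if_neg (fun h => hne (Expo.inj h)), smul_zero]
    · simp
  have h1 := hv.fintype_card_le_finrank
  rw [Fintype.card_prod, Fintype.card_fin] at h1
  calc r * m ^ d ≤ r * (d.factorial * Fintype.card (Expo d m)) := Nat.mul_le_mul_left _ (card_expo d m)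
    _ = d.factorial * (r * Fintype.card (Expo d m)) := by ring
    _ ≤ _ := Nat.mul_le_mul_left _ h1

theorem rank_bound {I : Ideal (MvPolynomial (Fin N) k)}
    (hI : I.IsHomogeneous (homogeneousSubmodule (Fin N) k))
    (φ : Fin d → MvPolynomial (Fin N) k) (hφ : ∀ i, (φ i).totalDegree ≤ 1) {r : ℕ}
    (g : Fin r → MvPolynomial (Fin N) k)
    (hind : ∀ c : Fin r → MvPolynomial (Fin d) k, ∑ j, aeval φ (c j) * g j ∈ I → ∀ j, c j = 0)
    {e : ℕ} (he : HasMultiplicity I d e) : r ≤ e := by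
  obtain ⟨D, hD⟩ : ∃ D, ∀ j, (g j).totalDegree ≤ D :=
    ⟨Finset.univ.sup fun j => (g j).totalDegree,
      fun j => Finset.le_sup (f := fun j => (g j).totalDegree) (Finset.mem_univ j)⟩
  have h1 : Tendsto (fun n : ℕ => (r : ℝ) * (((n : ℝ) - (D + 1)) / n) ^ d) atTop
      (nhds ((r : ℝ) * 1 ^ d)) := by
    refine Tendsto.const_mul _ (Tendsto.pow ?_ d)
    have h2 : Tendsto (fun n : ℕ => 1 - ((D : ℝ) + 1) / n) atTop (nhds (1 - 0)) :=
      tendsto_const_nhds.sub (tendsto_const_div_atTop_nhds_zero_nat _)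
    rw [sub_zero] at h2
    refine h2.congr' ?_
    filter_upwards [eventually_gt_atTop 0] with n hn
    have : (n : ℝ) ≠ 0 := by positivity
    field_simp
  rw [one_pow, mul_one] at h1
  have h3 := le_of_tendsto_of_tendsto h1 he ?_
  · exact_mod_cast h3
  · filter_upwards [eventually_gt_atTop (D + 1)] with n hn
    have h4 := rank_bound_fin hI φ hφ g hD hind (n - (D + 1)) n (by omega)
    have h5 : (r : ℝ) * ((n : ℝ) - (D + 1)) ^ d ≤ d.factorial * hilbertSamuelFn I n := by
      have h6 : ((n - (D + 1) : ℕ) : ℝ) = (n : ℝ) - (D + 1) := by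
        rw [Nat.cast_sub (by omega)]
        push_cast
        ring
      rw [← h6]
      exact_mod_cast h4
    rw [div_pow, ← mul_div_assoc]
    gcongr

end Rank
end ThreeCubics

namespace ThreeCubics
section Height
variable {R : Type} [CommRing R]

theorem height_subtype (p : {q : Ideal R // q.IsPrime}) : Order.height p = p.1.height := by
  let e : {q : Ideal R // q.IsPrime} ≃o PrimeSpectrum R :=
    { toFun := fun q => ⟨q.1, q.2⟩
      invFun := fun q => ⟨q.asIdeal, q.isPrime⟩
      left_inv := fun _ => rfl
      right_inv := fun _ => rfl
      map_rel_iff' := Iff.rfl }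
  rw [← Order.height_orderIso e p]
  exact (PrimeSpectrum.height_eq_orderHeight (e p)).symm

theorem idealHeight_le {J p : Ideal R} (hp : p.IsPrime) (h : J ≤ p) : idealHeight J ≤ p.height := by
  rw [← height_subtype ⟨p, hp⟩]
  exact iInf₂_le (f := fun (p : {q : Ideal R // q.IsPrime}) _ => Order.height p)
    (⟨p, hp⟩ : {q : Ideal R // q.IsPrime}) h

theorem exists_prime_of_idealHeight {J : Ideal R} (h : idealHeight J = 2) :
    ∃ p : Ideal R, p.IsPrime ∧ J ≤ p ∧ 2 ≤ p.height := by
  by_cases hJ : J = ⊤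
  · exfalso
    have : idealHeight J = ⊤ := by
      unfold idealHeight
      refine iInf₂_eq_top.2 ?_
      intro p hp
      exact absurd (top_le_iff.1 (hJ ▸ hp)) p.2.ne_top
    rw [this] at h
    exact absurd h (by decide)
  · obtain ⟨p, hp, hle⟩ := Ideal.exists_le_maximal J hJ
    exact ⟨p, hp.isPrime, hle, h ▸ idealHeight_le hp.isPrime hle⟩

theorem isRelPrime_of_height [IsNoetherianRing R] {f g : R} (h : idealHeight (Ideal.span {f, g}) = 2) :
    IsRelPrime f g := by
  intro π hf hg
  by_contra hu
  have hne : Ideal.span {π} ≠ ⊤ := by rwa [Ne, Ideal.span_singleton_eq_top]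
  obtain ⟨p, hp⟩ := Ideal.nonempty_minimalPrimes hne
  have h1 := Ideal.height_le_one_of_isPrincipal_of_mem_minimalPrimes _ p hp
  have h2 : Ideal.span {f, g} ≤ p := by
    refine le_trans ?_ hp.1.2
    rw [Ideal.span_le]
    rintro x (rfl | rfl)
    · exact Ideal.mem_span_singleton.2 hf
    · exact Ideal.mem_span_singleton.2 hg
  have h3 := (idealHeight_le hp.1.1 h2).trans h1
  rw [h] at h3
  exact absurd h3 (by decide)

theorem ne_zero_of_height [IsNoetherianRing R] {f g : R} (h : idealHeight (Ideal.span {f, g}) = 2) :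
    f ≠ 0 := by
  rintro rfl
  have hu : IsUnit g := isRelPrime_of_height h (dvd_zero g) dvd_rfl
  obtain ⟨p, hp, hle, -⟩ := exists_prime_of_idealHeight h
  exact hp.ne_top (Ideal.eq_top_of_isUnit_mem _ (hle (Ideal.subset_span (by simp))) hu)

theorem two_le_of_height {k : Type} [Field k] {N : ℕ} {J : Ideal (MvPolynomial (Fin N) k)}
    (h : idealHeight J = 2) : 2 ≤ N := by
  obtain ⟨p, hp, hle, h2⟩ := exists_prime_of_idealHeight h
  have h3 := Ideal.height_le_ringKrullDim_of_isPrime (I := p)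
  rw [MvPolynomial.ringKrullDim_of_isNoetherianRing, ringKrullDim_eq_zero_of_field, zero_add,
    Nat.card_fin] at h3
  have h4 : ((2 : ℕ∞) : WithBot ℕ∞) ≤ (N : WithBot ℕ∞) := (WithBot.coe_le_coe.2 h2).trans h3
  exact_mod_cast h4

end Height
end ThreeCubics

namespace ThreeCubics
section Coord
variable {k : Type} [Field k] {n : ℕ}

theorem totalDegree_aeval_le' {d N : ℕ} (φ : Fin d → MvPolynomial (Fin N) k)
    (hφ : ∀ i, (φ i).totalDegree ≤ 1) (p : MvPolynomial (Fin d) k) :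
    (aeval φ p).totalDegree ≤ p.totalDegree := by
  conv_lhs => rw [p.as_sum]
  rw [map_sum]
  refine totalDegree_finsetSum_le fun s hs => ?_
  refine (totalDegree_aeval_le φ hφ s _).trans ?_
  exact le_totalDegree hs

/-- images of variables under a shear -/
def shearFun (c : Fin n → k) : Fin (n + 1) → MvPolynomial (Fin (n + 1)) k :=
  Fin.cases (X 0) fun i => X i.succ + C (c i) * X 0

theorem shearFun_hom (c : Fin n → k) (i : Fin (n + 1)) : (shearFun c i).IsHomogeneous 1 := by
  refine Fin.cases ?_ (fun i => ?_) i
  · exact isHomogeneous_X _ _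
  · exact (isHomogeneous_X _ _).add (by simpa using (isHomogeneous_C _ (c i)).mul (isHomogeneous_X k 0))

theorem shear_comp (c : Fin n → k) :
    (aeval (shearFun c)).comp (aeval (shearFun (-c))) =
      AlgHom.id k (MvPolynomial (Fin (n + 1)) k) := by
  apply MvPolynomial.algHom_ext
  intro i
  refine Fin.cases ?_ (fun i => ?_) i
  · simp [shearFun]
  · simp [shearFun]

def shear (c : Fin n → k) : MvPolynomial (Fin (n + 1)) k ≃ₐ[k] MvPolynomial (Fin (n + 1)) k :=
  AlgEquiv.ofAlgHom (aeval (shearFun c)) (aeval (shearFun (-c))) (shear_comp c)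
    (by simpa using shear_comp (-c))

theorem hom_degree {N : ℕ} {p : MvPolynomial (Fin N) k} {m : ℕ} (hp : p.IsHomogeneous m)
    {s : Fin N →₀ ℕ} (hs : s ∈ p.support) : s.degree = m := by
  by_contra h
  exact mem_support_iff.1 hs (hp.coeff_eq_zero h)

theorem eval_single_of_homogeneous {p : MvPolynomial (Fin (n + 1)) k} {m : ℕ}
    (hp : p.IsHomogeneous m) :
    eval (Pi.single 0 1 : Fin (n + 1) → k) p = coeff (Finsupp.single 0 m) p := by
  classical
  rw [eval_eq', Finset.sum_eq_single (Finsupp.single 0 m)]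
  · rw [Finset.prod_eq_one, mul_one]
    intro i _
    by_cases hi : i = 0
    · subst hi; simp
    · simp [Ne.symm hi]
  · intro s hs hne
    have hdeg : s.degree = m := hom_degree hp hs
    obtain ⟨i, hi, hi0⟩ : ∃ i, s i ≠ 0 ∧ i ≠ 0 := by
      by_contra hcon
      push Not at hcon
      apply hne
      have hs0 : ∀ i, i ≠ 0 → s i = 0 := fun i hi => by
        by_contra h
        exact hi (hcon i h)
      have h0 : s 0 = m := by
        rw [← hdeg, Finsupp.degree_eq_sum, Finset.sum_eq_single 0]
        · intro b _ hb; exact hs0 b hb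
        · simp
      ext i
      by_cases hi : i = 0
      · subst hi; simp [h0]
      · simp [Ne.symm hi, hs0 i hi]
    rw [Finset.prod_eq_zero (Finset.mem_univ i), mul_zero]
    rw [Pi.single_eq_of_ne hi0, zero_pow hi]
  · intro h
    rw [notMem_support_iff.1 h, zero_mul]

theorem exists_coord [Infinite k] (h : MvPolynomial (Fin (n + 1)) k) (h0 : h ≠ 0) :
    ∃ τ : MvPolynomial (Fin (n + 1)) k ≃ₐ[k] Polynomial (MvPolynomial (Fin n) k),
      (∃ c : k, c ≠ 0 ∧ (Polynomial.C (C c) * τ h).Monic) ∧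
      ∀ i, (τ.symm (Polynomial.C (X i))).totalDegree ≤ 1 := by
  set m := h.totalDegree with hm
  set hm' := homogeneousComponent m h with hhm
  have hhom : hm'.IsHomogeneous m := homogeneousComponent_isHomogeneous m h
  have htop : hm' ≠ 0 := by
    obtain ⟨s, hs, hsd⟩ : ∃ s ∈ h.support, m = s.degree := by
      have := Finset.exists_mem_eq_sup h.support (support_nonempty.2 h0) (fun s => s.degree)
      obtain ⟨s, hs, h1⟩ := this
      exact ⟨s, hs, h1⟩
    intro hz
    have := congrArg (coeff s) hz
    rw [hhm, coeff_homogeneousComponent, if_pos hsd.symm, coeff_zero] at this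
    exact mem_support_iff.1 hs this
  obtain ⟨v, hv⟩ : ∃ v : Fin (n + 1) → k, eval v (X 0 * hm') ≠ 0 := by
    by_contra hcon
    push Not at hcon
    have : X 0 * hm' = 0 := MvPolynomial.funext fun v => by rw [hcon v, map_zero]
    exact (mul_ne_zero (X_ne_zero _) htop) this
  rw [map_mul, eval_X] at hv
  have hv0 := left_ne_zero_of_mul hv
  have hv1 := right_ne_zero_of_mul hv
  let c : Fin n → k := fun i => v i.succ / v 0
  set a := coeff (Finsupp.single 0 m) (shear c h) with ha
  have hhomc : ∀ (i : ℕ), (shear c (homogeneousComponent i h)).IsHomogeneous i := fun i => by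
    have := (homogeneousComponent_isHomogeneous i h).aeval (shearFun c) (shearFun_hom c)
    rwa [one_mul] at this
  have ha' : a = eval (Pi.single 0 1 : Fin (n + 1) → k) (shear c hm') := by
    rw [eval_single_of_homogeneous (hhomc m), ha]
    conv_lhs => rw [← sum_homogeneousComponent h, map_sum, coeff_sum]
    rw [Finset.sum_eq_single m]
    · intro b _ hb
      refine (hhomc b).coeff_eq_zero ?_
      rw [Finsupp.degree_single]
      exact Ne.symm hb
    · intro hnot
      simp [hm] at hnot
  have ha0 : a ≠ 0 := by
    have hfun : ∀ p : MvPolynomial (Fin (n + 1)) k,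
        eval (Pi.single 0 1 : Fin (n + 1) → k) (shear c p) = eval (fun i => (v 0)⁻¹ • v i) p := by
      intro p
      change eval _ (aeval (shearFun c) p) = _
      rw [← coe_aeval_eq_eval, ← coe_aeval_eq_eval]
      change ((aeval (Pi.single 0 1 : Fin (n + 1) → k)).comp (aeval (shearFun c))) p =
        aeval (fun i => (v 0)⁻¹ • v i) p
      refine DFunLike.congr_fun ?_ p
      apply MvPolynomial.algHom_ext
      intro i
      refine Fin.cases ?_ (fun i => ?_) i
      · simp [shearFun, hv0]
      · simp [shearFun, c, div_eq_inv_mul]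
    have hsc : eval (fun i => (v 0)⁻¹ • v i) hm' = (v 0)⁻¹ ^ m * eval v hm' := by
      rw [eval_eq', eval_eq', Finset.mul_sum]
      refine Finset.sum_congr rfl fun s hs => ?_
      have hdeg : s.degree = m := hom_degree hhom hs
      rw [← hdeg, Finsupp.degree_eq_sum, ← Finset.prod_pow_eq_pow_sum]
      simp only [smul_eq_mul, mul_pow, Finset.prod_mul_distrib]
      ring
    rw [ha', hfun, hsc]
    exact mul_ne_zero (pow_ne_zero _ (inv_ne_zero hv0)) hv1
  have hdeg : (shear c h).totalDegree ≤ m :=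
    totalDegree_aeval_le' (shearFun c) (fun i => (shearFun_hom c i).totalDegree_le) h
  refine ⟨(shear c).trans (finSuccEquiv k n), ⟨a⁻¹, inv_ne_zero ha0, ?_⟩, ?_⟩
  · set u := shear c h with hu
    change (Polynomial.C (C a⁻¹) * finSuccEquiv k n u).Monic
    have hcoeff : (finSuccEquiv k n u).coeff m = C a := by
      by_cases hz : (finSuccEquiv k n u).coeff m = 0
      · exfalso
        have := congrArg (coeff 0) hz
        rw [finSuccEquiv_coeff_coeff, coeff_zero] at this
        apply ha0
        rw [ha, ← this]
        congr 1
        ext i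
        refine Fin.cases ?_ (fun i => ?_) i <;> simp
      · have h1 := totalDegree_coeff_finSuccEquiv_add_le u m hz
        have h2 : ((finSuccEquiv k n u).coeff m).totalDegree = 0 := by omega
        rw [totalDegree_eq_zero_iff_eq_C] at h2
        rw [h2, finSuccEquiv_coeff_coeff, ha]
        congr 2
        ext i
        refine Fin.cases ?_ (fun i => ?_) i <;> simp
    refine Polynomial.monic_of_natDegree_le_of_coeff_eq_one m ?_ ?_
    · refine (Polynomial.natDegree_C_mul_le _ _).trans ?_
      rw [natDegree_finSuccEquiv]
      exact (degreeOf_le_totalDegree _ _).trans hdeg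
    · rw [Polynomial.coeff_C_mul, hcoeff, ← C_mul, inv_mul_cancel₀ ha0, C_1]
  · intro i
    change ((shear c).symm ((finSuccEquiv k n).symm (Polynomial.C (X i)))).totalDegree ≤ 1
    have : (finSuccEquiv k n).symm (Polynomial.C (X i)) = X i.succ := by
      rw [AlgEquiv.symm_apply_eq, finSuccEquiv_X_succ]
    rw [this]
    change (aeval (shearFun (-c)) (X i.succ)).totalDegree ≤ 1
    rw [aeval_X]
    exact (shearFun_hom (-c) i.succ).totalDegree_le

theorem exists_rho {B : Type} [CommRing B] [IsDomain B] [UniqueFactorizationMonoid B]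
    {f g : Polynomial B} (hf : f.Monic) (hrel : IsRelPrime f g) :
    ∃ ρ : B, ρ ≠ 0 ∧ ∃ h c : Polynomial B, h * g + c * f = Polynomial.C ρ := by
  have hfin : Module.Finite B (AdjoinRoot f) := hf.finite_adjoinRoot
  have hinteg : IsIntegral B (AdjoinRoot.mk f g) := IsIntegral.of_finite B _
  obtain ⟨p, hp, hp0⟩ := hinteg
  have hnz : ∀ {x : AdjoinRoot f}, x * AdjoinRoot.mk f g = 0 → x = 0 := by
    intro x
    obtain ⟨x, rfl⟩ := AdjoinRoot.mk_surjective x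
    rw [← map_mul, AdjoinRoot.mk_eq_zero, AdjoinRoot.mk_eq_zero, mul_comm]
    exact fun hx => hrel.dvd_of_dvd_mul_left hx
  obtain ⟨i, hi, hmem⟩ := Ideal.exists_coeff_ne_zero_mem_comap_of_non_zero_divisor_root_mem
    (I := Ideal.span {AdjoinRoot.mk f g}) hnz (Ideal.subset_span rfl) hp.ne_zero hp0
  refine ⟨p.coeff i, hi, ?_⟩
  rw [Ideal.mem_comap, Ideal.mem_span_singleton] at hmem
  obtain ⟨y, hy⟩ := hmem
  obtain ⟨y, rfl⟩ := AdjoinRoot.mk_surjective y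
  have h1 : AdjoinRoot.mk f (Polynomial.C (p.coeff i)) = AdjoinRoot.mk f (y * g) := by
    rw [mul_comm, map_mul, ← hy]
    rfl
  rw [← sub_eq_zero, ← map_sub, AdjoinRoot.mk_eq_zero] at h1
  obtain ⟨c, hc⟩ := h1
  exact ⟨y, c, by linear_combination -hc⟩

end Coord
end ThreeCubics

namespace ThreeCubics
section Assembly
variable {k : Type} [Field k] [IsAlgClosed k] {d : ℕ}

attribute [local instance] RingHomInvPair.of_ringEquiv in
theorem PD_transport {R R' : Type} [CommRing R] [CommRing R'] (σ : R ≃+* R') (I : Ideal R)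
    (I' : Ideal R') (hI : ∀ x, σ x ∈ I' ↔ x ∈ I) (n : ℕ) (h : PD R' (R' ⧸ I') n) :
    PD R (R ⧸ I) n := by
  have hmap : I' = I.map (σ : R →+* R') := by
    ext y
    obtain ⟨x, rfl⟩ := σ.surjective y
    rw [hI]
    constructor
    · intro hx
      exact Ideal.mem_map_of_mem _ hx
    · intro hx
      have := (Ideal.mem_map_iff_of_surjective (σ : R →+* R') σ.surjective).1 hx
      obtain ⟨z, hz, hzx⟩ := this
      rwa [← σ.injective hzx]
  let q : R ⧸ I ≃+* R' ⧸ I' := Ideal.quotientEquiv I I' σ hmap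
  let e' : (R' ⧸ I') ≃ₛₗ[RingHomClass.toRingHom σ.symm] (R ⧸ I) :=
    { toFun := q.symm
      invFun := q
      left_inv := q.apply_symm_apply
      right_inv := q.symm_apply_apply
      map_add' := map_add _
      map_smul' := fun r x => by
        obtain ⟨x, rfl⟩ := Ideal.Quotient.mk_surjective x
        rw [← Ideal.Quotient.mk_eq_mk, ← Submodule.Quotient.mk_smul]
        change Ideal.Quotient.mk I (σ.symm (r * x)) = _
        rw [map_mul, map_mul]
        rfl }
  have h' : HasProjectiveDimensionLE (ModuleCat.of R' (R' ⧸ I')) n := h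
  exact ModuleCat.hasProjectiveDimensionLE_of_semiLinearEquiv
    (M := ModuleCat.of R' (R' ⧸ I')) (N := ModuleCat.of R (R ⧸ I)) σ.symm e' n

theorem exists_normal_form {f₁ f₂ : MvPolynomial (Fin (d + 2)) k} (f₃ : MvPolynomial (Fin (d + 2)) k)
    (h0 : f₁ ≠ 0) (hrel : IsRelPrime f₁ f₂) :
    ∃ σ : MvPolynomial (Fin (d + 2)) k ≃+* Polynomial (Polynomial (MvPolynomial (Fin d) k)),
      (∀ a : k, σ (C a) = Polynomial.C (Polynomial.C (C a))) ∧
      (∀ i, (σ.symm (Polynomial.C (Polynomial.C (X i)))).totalDegree ≤ 1) ∧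
      ∃ f g h ρ, NiceCI (A := MvPolynomial (Fin d) k) f g h ρ ∧
        ∀ x, σ x ∈ Ideal.span {f, g, σ f₃} ↔ x ∈ Ideal.span {f₁, f₂, f₃} := by
  have hinf : Infinite k := inferInstance
  obtain ⟨τ₁, ⟨c₁, hc₁, hmon₁⟩, hdeg₁⟩ := exists_coord f₁ h0
  set F := Polynomial.C (C c₁) * τ₁ f₁ with hF
  have hFτ : F = τ₁ (C c₁ * f₁) := by
    rw [map_mul, hF]
    congr 1
    exact (τ₁.commutes c₁).symm
  have hrel' : IsRelPrime F (τ₁ f₂) := by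
    intro x hx hx2
    obtain ⟨x, rfl⟩ := τ₁.surjective x
    rw [hFτ] at hx
    have h1 : x ∣ C c₁ * f₁ := by
      have := map_dvd τ₁.symm hx
      simpa using this
    have h2 : x ∣ f₂ := by
      have := map_dvd τ₁.symm hx2
      simpa using this
    have hu : IsUnit (C c₁ : MvPolynomial (Fin (d + 2)) k) := (IsUnit.mk0 c₁ hc₁).map C
    exact (hrel ((hu.dvd_mul_left).1 h1) h2).map τ₁
  obtain ⟨ρ₀, hρ₀, h₀, e₀, he₀⟩ := exists_rho hmon₁ hrel'
  obtain ⟨τ₂, ⟨c₂, hc₂, hmon₂⟩, hdeg₂⟩ := exists_coord ρ₀ hρ₀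
  let M := Polynomial.mapEquiv τ₂.toRingEquiv
  let σ := τ₁.toRingEquiv.trans M
  have hMC : ∀ b, M (Polynomial.C b) = Polynomial.C (τ₂ b) := fun b => Polynomial.map_C _
  have hσC : ∀ a : k, σ (C a) = Polynomial.C (Polynomial.C (C a)) := by
    intro a
    change M (τ₁ (C a)) = _
    have h1 : τ₁ (C a) = Polynomial.C (C a) := τ₁.commutes a
    have h2 : τ₂ (C a) = Polynomial.C (C a) := τ₂.commutes a
    rw [h1, hMC, h2]
  refine ⟨σ, hσC, ?_, M F, σ f₂, Polynomial.C (Polynomial.C (C c₂)) * M h₀,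
    Polynomial.C (C c₂) * τ₂ ρ₀, ⟨?_, hmon₂, ?_⟩, ?_⟩
  · intro i
    let φ : Fin (d + 1) → MvPolynomial (Fin (d + 2)) k := fun j => τ₁.symm (Polynomial.C (X j))
    have h1 : ∀ p, τ₁.symm (Polynomial.C p) = aeval φ p := by
      intro p
      have : (τ₁.symm.toAlgHom.comp (IsScalarTower.toAlgHom k (MvPolynomial (Fin (d + 1)) k)
          (Polynomial (MvPolynomial (Fin (d + 1)) k)))) = aeval φ := by
        apply MvPolynomial.algHom_ext
        intro j
        rw [aeval_X]
        rfl
      exact DFunLike.congr_fun this p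
    have h2 : σ.symm (Polynomial.C (Polynomial.C (X i))) =
        τ₁.symm (Polynomial.C (τ₂.symm (Polynomial.C (X i)))) := by
      rw [RingEquiv.symm_apply_eq]
      change _ = M (τ₁ _)
      rw [AlgEquiv.apply_symm_apply, hMC, AlgEquiv.apply_symm_apply]
    rw [h2, h1]
    exact (totalDegree_aeval_le' φ hdeg₁ _).trans (hdeg₂ i)
  · exact hmon₁.map _
  · refine ⟨Polynomial.C (Polynomial.C (C c₂)) * M e₀, ?_⟩
    have := congrArg M he₀
    rw [map_add, map_mul, map_mul, hMC] at this
    change _ * M h₀ * M (τ₁ f₂) + _ = _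
    rw [Polynomial.C_mul, ← this]
    ring
  · have hMF : M F = Polynomial.C (Polynomial.C (C c₁)) * σ f₁ := by
      rw [hFτ]
      change σ (C c₁ * f₁) = _
      rw [map_mul, hσC]
    have hspan : Ideal.span {M F, σ f₂, σ f₃} = (Ideal.span {f₁, f₂, f₃}).map (σ : _ →+* _) := by
      rw [Ideal.map_span, Set.image_insert_eq, Set.image_pair]
      apply le_antisymm
      · rw [Ideal.span_le]
        rintro x (rfl | rfl | rfl)
        · rw [hMF]
          exact Ideal.mul_mem_left _ _ (Ideal.subset_span (by simp))
        · exact Ideal.subset_span (by simp)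
        · exact Ideal.subset_span (by simp)
      · rw [Ideal.span_le]
        rintro x (rfl | rfl | rfl)
        · have : (σ : _ →+* Polynomial (Polynomial (MvPolynomial (Fin d) k))) f₁ =
              Polynomial.C (Polynomial.C (C c₁⁻¹)) * M F := by
            rw [hMF, ← mul_assoc, ← Polynomial.C_mul, ← Polynomial.C_mul, ← C_mul,
              inv_mul_cancel₀ hc₁]
            simp
          rw [this]
          exact Ideal.mul_mem_left _ _ (Ideal.subset_span (by simp))
        · exact Ideal.subset_span (by simp)
        · exact Ideal.subset_span (by simp)
    intro x
    rw [hspan]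
    constructor
    · intro hx
      obtain ⟨z, hz, hzx⟩ := (Ideal.mem_map_iff_of_surjective _ σ.surjective).1 hx
      rwa [← σ.injective hzx]
    · intro hx
      exact Ideal.mem_map_of_mem _ hx

end Assembly
end ThreeCubics

namespace ThreeCubics
section Abs
variable {A : Type} [CommRing A] [IsDomain A] [IsNoetherianRing A] [UniqueFactorizationMonoid A]

theorem abs_lin {I' : Ideal (Polynomial (Polynomial A))} {r : ℕ}
    (h : ∀ y : Fin r → Polynomial (Polynomial A), (∀ c : Fin r → A,
      ∑ j, Polynomial.C (Polynomial.C (c j)) * y j ∈ I' → ∀ j, c j = 0) → False)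
    (x : Fin r → Polynomial (Polynomial A) ⧸ I') : ¬ LinearIndependent A x := by
  intro hx
  choose y hy using fun j => Ideal.Quotient.mk_surjective (x j)
  refine h y fun c hc => Fintype.linearIndependent_iff.1 hx c ?_
  rw [← Ideal.Quotient.eq_zero_iff_mem, map_sum] at hc
  rw [← hc]
  refine Finset.sum_congr rfl fun j _ => ?_
  rw [← hy j]
  have h1 : Polynomial.C (Polynomial.C (c j)) * y j = c j • y j := by
    rw [← Polynomial.smul_eq_C_mul]
    ext m
    rw [Polynomial.coeff_smul, Polynomial.coeff_smul, smul_eq_mul, ← Polynomial.smul_eq_C_mul]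
  rw [h1]
  rfl

theorem abs_core {R : Type} [CommRing R] (σ : R ≃+* Polynomial (Polynomial A))
    {f g h : Polynomial (Polynomial A)} {ρ : Polynomial A} (H : NiceCI f g h ρ)
    (f₃ : Polynomial (Polynomial A)) (I : Ideal R)
    (hmem : ∀ x, σ x ∈ Ideal.span {f, g, f₃} ↔ x ∈ I)
    (hA : ∀ (G : Type) [CommRing G] [Algebra A G] [Module.Finite A G],
      Function.Injective (algebraMap A G) → ∃ φ : G →ₗ[A] A, φ 1 = 1) :
    ((∀ y : Fin 2 → Polynomial (Polynomial A), (∀ c : Fin 2 → A,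
      σ.symm (∑ j, Polynomial.C (Polynomial.C (c j)) * y j) ∈ I → ∀ j, c j = 0) → False) →
      PD R (R ⧸ I) 3) ∧
    ((∀ y : Fin 3 → Polynomial (Polynomial A), (∀ c : Fin 3 → A,
      σ.symm (∑ j, Polynomial.C (Polynomial.C (c j)) * y j) ∈ I → ∀ j, c j = 0) → False) →
      PD R (R ⧸ I) 4) := by
  obtain ⟨I', hI'⟩ : ∃ I' : Ideal (Polynomial (Polynomial A)),
    I' = Ideal.span {f, g, f₃} := ⟨_, rfl⟩
  rw [← hI'] at hmem
  have hmem' : ∀ y, σ.symm y ∈ I ↔ y ∈ I' := by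
    intro y
    rw [← hmem, RingEquiv.apply_symm_apply]
  have hfin : Module.Finite A (Polynomial (Polynomial A) ⧸ I') := by
    have h1 := H.finite
    have hle : Ideal.span {f, g} ≤ I' := by
      rw [hI']
      apply Ideal.span_mono
      intro x hx
      simp only [Set.mem_insert_iff, Set.mem_singleton_iff] at hx ⊢
      tauto
    exact Module.Finite.of_surjective
      (Ideal.Quotient.factorₐ A hle).toLinearMap
      (Ideal.Quotient.factor_surjective hle)
  have hmain := main_alg H f₃ I' hI' (by
    intro hinj
    refine hA (Polynomial (Polynomial A) ⧸ I') ?_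
    rw [injective_iff_map_eq_zero]
    intro a ha
    apply hinj
    rw [← ha, Algebra.algebraMap_eq_smul_one])
  simp only [hmem']
  exact ⟨fun h => PD_transport σ I I' hmem 3 (hmain.1 (abs_lin h)),
    fun h => PD_transport σ I I' hmem 4 (hmain.2 (abs_lin h))⟩

end Abs

section Final
variable {k : Type} [Field k] [IsAlgClosed k] {d : ℕ}

attribute [local instance] MvPolynomial.gradedAlgebra

theorem core (f₁ f₂ f₃ : MvPolynomial (Fin (d + 2)) k)
    (hf₁ : f₁.IsHomogeneous 3) (hf₂ : f₂.IsHomogeneous 3) (hf₃ : f₃.IsHomogeneous 3)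
    (h0 : f₁ ≠ 0) (hrel : IsRelPrime f₁ f₂) (I : Ideal (MvPolynomial (Fin (d + 2)) k))
    (hI : I = Ideal.span {f₁, f₂, f₃}) :
    (HasMultiplicity I d 1 → PD (MvPolynomial (Fin (d + 2)) k) (MvPolynomial (Fin (d + 2)) k ⧸ I) 3) ∧
    (HasMultiplicity I d 2 → PD (MvPolynomial (Fin (d + 2)) k) (MvPolynomial (Fin (d + 2)) k ⧸ I) 4) := by
  have hhom : I.IsHomogeneous (homogeneousSubmodule (Fin (d + 2)) k) := by
    rw [hI]
    apply Ideal.homogeneous_span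
    rintro x (rfl | rfl | rfl)
    · exact ⟨3, hf₁⟩
    · exact ⟨3, hf₂⟩
    · exact ⟨3, hf₃⟩
  obtain ⟨σ, hσC, hdeg, f, g, h, ρ, H, hmem⟩ := exists_normal_form f₃ h0 hrel
  rw [← hI] at hmem
  have hrank : ∀ {e r : ℕ}, HasMultiplicity I d e →
      ∀ y : Fin r → Polynomial (Polynomial (MvPolynomial (Fin d) k)),
      (∀ c : Fin r → MvPolynomial (Fin d) k,
        σ.symm (∑ j, Polynomial.C (Polynomial.C (c j)) * y j) ∈ I → ∀ j, c j = 0) → r ≤ e := by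
    intro e r he y hy
    let φ : Fin d → MvPolynomial (Fin (d + 2)) k :=
      fun i => σ.symm (Polynomial.C (Polynomial.C (X i)))
    have hφ : ∀ p, σ (aeval φ p) = Polynomial.C (Polynomial.C p) := by
      intro p
      have : (σ : _ →+* Polynomial (Polynomial (MvPolynomial (Fin d) k))).comp
          (aeval φ : MvPolynomial (Fin d) k →ₐ[k] _).toRingHom =
          Polynomial.C.comp Polynomial.C := by
        apply MvPolynomial.ringHom_ext
        · intro a
          have : aeval φ (C a : MvPolynomial (Fin d) k) = C a := by
            rw [aeval_C]; rfl
          change σ (aeval φ (C a)) = _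
          rw [this, hσC]
          rfl
        · intro i
          change σ (aeval φ (X i)) = _
          rw [aeval_X, RingEquiv.apply_symm_apply]
          rfl
      exact DFunLike.congr_fun this p
    refine rank_bound hhom φ hdeg (fun j => σ.symm (y j)) ?_ he
    intro c hc
    apply hy c
    rw [map_sum]
    convert hc using 2 with j
    rw [map_mul, ← hφ, RingEquiv.symm_apply_apply]
  have hmain := abs_core (A := MvPolynomial (Fin d) k) σ H (σ f₃) I hmem
    (fun G _ _ _ hinj => direct_summand hinj)
  constructor
  · intro he
    refine hmain.1 fun x hx => ?_
    have := hrank he x hx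
    omega
  · intro he
    refine hmain.2 fun x hx => ?_
    have := hrank he x hx
    omega

end Final
end ThreeCubics

theorem statement_7
    {k : Type} [Field k] [IsAlgClosed k] {N : ℕ}
    (f₁ f₂ f₃ : MvPolynomial (Fin N) k)
    (hf₁ : f₁.IsHomogeneous 3) (hf₂ : f₂.IsHomogeneous 3) (hf₃ : f₃.IsHomogeneous 3)
    (hIht : idealHeight (Ideal.span {f₁, f₂, f₃}) = 2)
    (hht₁₂ : idealHeight (Ideal.span {f₁, f₂}) = 2)
    (hht₁₃ : idealHeight (Ideal.span {f₁, f₃}) = 2)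
    (hht₂₃ : idealHeight (Ideal.span {f₂, f₃}) = 2)
    :
    (HasMultiplicity (Ideal.span {f₁, f₂, f₃}) (N - 2) 1 → pdQuotLE (Ideal.span {f₁, f₂, f₃}) 3) ∧
    (HasMultiplicity (Ideal.span {f₁, f₂, f₃}) (N - 2) 2 → pdQuotLE (Ideal.span {f₁, f₂, f₃}) 4) := by
  have hN : 2 ≤ N := ThreeCubics.two_le_of_height hht₁₂
  obtain ⟨d, rfl⟩ : ∃ d, N = d + 2 := ⟨N - 2, by omega⟩
  have hc := ThreeCubics.core f₁ f₂ f₃ hf₁ hf₂ hf₃ (ThreeCubics.ne_zero_of_height hht₁₂)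
    (ThreeCubics.isRelPrime_of_height hht₁₂) _ rfl
  rw [Nat.add_sub_cancel]
  exact ⟨fun he => ThreeCubics.exists_resolution 3 _ (hc.1 he),
    fun he => ThreeCubics.exists_resolution 4 _ (hc.2 he)⟩

end
end

section
/- Let K = p1 ∩ p2 ∩ p3, where p1, p2, p3 are three distinct linear primes of height 2 in R. If either K = I^un or K = L, then pd(R/I) ≤ 4. -/
open MvPolynomial Filter CategoryTheory

noncomputable section

section homological
variable {R : Type} [CommRing R]

theorem res_splice (S : ShortComplex (ModuleCat.{0} R)) (hS : S.ShortExact) (hp : Projective S.X₂)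
    (n : ℕ) (Q : ProjectiveResolution S.X₁) (hQ : ∀ i, n < i → Limits.IsZero (Q.complex.X i)) :
    ∃ P : ProjectiveResolution S.X₃, ∀ i, n + 1 < i → Limits.IsZero (P.complex.X i) := by
  have hmono := hS.mono_f
  have hepig := hS.epi_g
  have hφ : Q.complex.d 1 0 ≫ Q.π.f 0 = 0 := Q.complex_d_comp_π_f_zero
  have hepi : Epi (Q.π.f 0) := inferInstance
  have hex : (ShortComplex.mk _ _ hφ).Exact :=
    ShortComplex.exact_of_g_is_cokernel _ Q.isColimitCokernelCofork
  let φ : Q.complex.X 0 ⟶ S.X₁ := Q.π.f 0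
  have hw : Q.complex.d 1 0 ≫ (φ ≫ S.f) = 0 := by
    rw [← Category.assoc]
    have : Q.complex.d 1 0 ≫ φ = 0 := hφ
    rw [this, Limits.zero_comp]
  have hex2 : (ShortComplex.mk _ _ hw).Exact := by
    let α : ShortComplex.mk (Q.complex.d 1 0) φ hφ ⟶ ShortComplex.mk _ _ hw :=
      { τ₁ := 𝟙 _
        τ₂ := 𝟙 _
        τ₃ := S.f }
    exact (ShortComplex.exact_iff_of_epi_of_isIso_of_mono α).1 hex
  have hw3 : (φ ≫ S.f) ≫ S.g = 0 := by rw [Category.assoc, S.zero, Limits.comp_zero]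
  have hex3 : (ShortComplex.mk _ _ hw3).Exact := by
    have : Epi φ := hepi
    let α : ShortComplex.mk _ _ hw3 ⟶ S :=
      { τ₁ := φ
        τ₂ := 𝟙 _
        τ₃ := 𝟙 _ }
    exact (ShortComplex.exact_iff_of_epi_of_isIso_of_mono α).2 hS.exact
  let D := Q.complex.augment (φ ≫ S.f) hw
  have hDex : ∀ n, D.ExactAt (n + 1) := by
    intro n
    rw [HomologicalComplex.exactAt_iff' _ (n + 1 + 1) (n + 1) n (by simp) (by simp)]
    match n with
    | 0 => exact hex2
    | n + 1 => exact Q.exact_succ n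
  refine ⟨{ complex := D
            projective := ?_
            π := (ChainComplex.toSingle₀Equiv _ _).symm ⟨S.g, hw3⟩
            quasiIso := ⟨fun n => ?_⟩ }, ?_⟩
  · intro n
    match n with
    | 0 => exact hp
    | n + 1 => exact Q.projective n
  · match n with
    | 0 =>
      rw [ChainComplex.quasiIsoAt₀_iff, ShortComplex.quasiIso_iff_of_zeros']
      · refine (ShortComplex.exact_and_epi_g_iff_of_iso ?_).2 ⟨hex3, hepig⟩
        exact ShortComplex.isoMk (Iso.refl _) (Iso.refl _) (Iso.refl _)
          (by simp [D]; rfl) (by simp; rfl)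
      all_goals rfl
    | n + 1 =>
      rw [quasiIsoAt_iff_exactAt']
      · exact hDex n
      · apply ChainComplex.exactAt_succ_single_obj
  · intro i hi
    match i with
    | 0 => omega
    | i + 1 => exact hQ i (by omega)

theorem exists_res_of_pd (n : ℕ) : ∀ (X : ModuleCat.{0} R), HasProjectiveDimensionLE X n →
    ∃ P : ProjectiveResolution X, ∀ i, n < i → Limits.IsZero (P.complex.X i) := by
  induction n with
  | zero =>
    intro X hX
    have : Projective X := (projective_iff_hasProjectiveDimensionLE_zero X).2 hX
    refine ⟨ProjectiveResolution.self X, fun i hi => ?_⟩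
    exact HomologicalComplex.isZero_single_obj_X _ _ _ _ (by omega)
  | succ n ih =>
    intro X hX
    have hS : X.projectiveShortComplex.ShortExact := X.shortExact_projectiveShortComplex
    have hp : Projective X.projectiveShortComplex.X₂ := by
      rw [← IsProjective.iff_projective]
      infer_instance
    have h1 : HasProjectiveDimensionLE X.projectiveShortComplex.X₁ n :=
      (hS.hasProjectiveDimensionLT_X₃_iff n hp).1 hX
    obtain ⟨Q, hQ⟩ := ih _ h1
    exact res_splice _ hS hp n Q hQ

/-- projective dimension of the cyclic module `R ⧸ J` is at most `n`. -/
def PD (J : Ideal R) (n : ℕ) : Prop := HasProjectiveDimensionLE (ModuleCat.of R (R ⧸ J)) n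

theorem PD.mono {J : Ideal R} {m n : ℕ} (h : PD J m) (hmn : m ≤ n) : PD J n := by
  have : HasProjectiveDimensionLT (ModuleCat.of R (R ⧸ J)) (m + 1) := h
  exact hasProjectiveDimensionLT_of_ge _ (m + 1) (n + 1) (by omega)

theorem PD_bot : PD (⊥ : Ideal R) 0 := by
  have : Module.Projective R (R ⧸ (⊥ : Ideal R)) :=
    Module.Projective.of_equiv (Submodule.quotEquivOfEqBot (⊥ : Ideal R) rfl).symm
  exact (projective_iff_hasProjectiveDimensionLE_zero _).1
    ((IsProjective.iff_projective _).1 this)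

/-- Basic step: `0 → R/(J:d) → R/J → R/(J+d) → 0`. -/
theorem PD_step {J J' K : Ideal R} {d : R} {n : ℕ} (hJ : PD J (n + 1))
    (hJ' : ∀ r, r ∈ J' ↔ r * d ∈ J) (hK : K = J ⊔ Ideal.span {d}) (h' : PD J' n) :
    PD K (n + 1) := by
  have hle : J ≤ K := hK ▸ le_sup_left
  let f : (R ⧸ J') →ₗ[R] (R ⧸ J) := Submodule.liftQ J' ((Submodule.mkQ J).comp (LinearMap.mulRight R d))
    (by intro r hr
        exact (Submodule.Quotient.mk_eq_zero J).2 ((hJ' r).1 hr))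
  let g : (R ⧸ J) →ₗ[R] (R ⧸ K) := Submodule.factor hle
  have hf : Function.Injective f := by
    rw [← LinearMap.ker_eq_bot, Submodule.ker_liftQ_eq_bot']
    ext r
    rw [hJ', LinearMap.mem_ker]
    exact (Submodule.Quotient.mk_eq_zero J).symm
  have hg : Function.Surjective g := Submodule.factor_surjective hle
  have hfg : Function.Exact f g := by
    intro y
    obtain ⟨y, rfl⟩ := Submodule.Quotient.mk_surjective _ y
    have : g (Submodule.Quotient.mk y) = Submodule.Quotient.mk y := rfl
    rw [this, Submodule.Quotient.mk_eq_zero, hK, sup_comm, Ideal.mem_span_singleton_sup]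
    constructor
    · rintro ⟨a, b, hb, rfl⟩
      refine ⟨Submodule.Quotient.mk a, ?_⟩
      change Submodule.Quotient.mk (a * d) = _
      rw [Submodule.Quotient.eq]
      simpa using hb
    · rintro ⟨x, hx⟩
      obtain ⟨a, rfl⟩ := Submodule.Quotient.mk_surjective _ x
      change Submodule.Quotient.mk (a * d) = _ at hx
      rw [Submodule.Quotient.eq] at hx
      exact ⟨a, -(a * d - y), neg_mem hx, by ring⟩
  let S : ShortComplex (ModuleCat R) := ShortComplex.mk (ModuleCat.ofHom f) (ModuleCat.ofHom g)
    (ModuleCat.hom_ext (LinearMap.ext fun x => congrFun hfg.comp_eq_zero x))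
  have hS : S.ShortExact :=
    { exact := (ShortComplex.ShortExact.moduleCat_exact_iff_function_exact S).2 hfg
      mono_f := (ModuleCat.mono_iff_injective _).2 hf
      epi_g := (ModuleCat.epi_iff_surjective _).2 hg }
  exact hS.hasProjectiveDimensionLT_X₃ (n + 1) h' hJ

end homological

section commalg
variable {R : Type} [CommRing R] [IsDomain R] [DecompositionMonoid R]

theorem PD_span1 {u : R} (hu : u ≠ 0) : PD (Ideal.span {u}) 1 := by
  refine PD_step (J := ⊥) (J' := ⊥) (d := u) (PD_bot.mono (by omega)) ?_ (by simp) PD_bot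
  intro r
  simp [hu]

theorem PD_span2 {u v : R} (hu : u ≠ 0) (huv : IsRelPrime u v) : PD (Ideal.span {u, v}) 2 := by
  refine PD_step (J := Ideal.span {u}) (J' := Ideal.span {u}) (d := v)
    ((PD_span1 hu).mono (by omega)) ?_ (Ideal.span_insert _ _) (PD_span1 hu)
  intro r
  rw [Ideal.mem_span_singleton, Ideal.mem_span_singleton]
  exact ⟨fun h => h.mul_right _, fun h => huv.dvd_of_dvd_mul_right h⟩


/-- syzygies of a relatively prime pair -/
theorem syz {f₁ f₂ : R} (hf : IsRelPrime f₁ f₂) (h₂ : f₂ ≠ 0) {a b : R} (h : a * f₁ = b * f₂) :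
    ∃ c, a = c * f₂ ∧ b = c * f₁ := by
  have : f₂ ∣ a := hf.symm.dvd_of_dvd_mul_right ⟨b, by rw [h]; ring⟩
  obtain ⟨c, rfl⟩ := this
  exact ⟨c, by ring, mul_right_cancel₀ h₂ (by rw [← h]; ring)⟩

variable {f₁ f₂ : R} (hf : IsRelPrime f₁ f₂) (h₂ : f₂ ≠ 0)
include hf h₂

theorem ci_colon {u v α β γ δ : R} (huv : IsRelPrime u v) (hu : u ≠ 0)
    (e₁ : f₁ = α * u + β * v) (e₂ : f₂ = γ * u + δ * v) {r : R}
    (h1 : r * u ∈ Ideal.span {f₁, f₂}) (h2 : r * v ∈ Ideal.span {f₁, f₂}) :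
    ∃ c, r - c * (α * δ - β * γ) ∈ Ideal.span {f₁, f₂} := by
  rw [Ideal.mem_span_pair] at h1 h2
  obtain ⟨a, b, h1⟩ := h1
  obtain ⟨a', b', h2⟩ := h2
  obtain ⟨c, hc1, hc2⟩ := syz hf h₂ (a := a * v - a' * u) (b := b' * u - b * v)
    (by linear_combination v * h1 - u * h2)
  obtain ⟨e, he1, he2⟩ := syz huv.symm hu (a := a - c * δ) (b := a' + c * γ)
    (by linear_combination hc1 + c * e₂)
  obtain ⟨g, hg1, hg2⟩ := syz huv.symm hu (a := b + c * β) (b := b' - c * α)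
    (by linear_combination -hc2 - c * e₁)
  refine ⟨c, ?_⟩
  rw [Ideal.mem_span_pair]
  refine ⟨e, g, mul_right_cancel₀ hu ?_⟩
  linear_combination h1 - f₁ * he1 - f₂ * hg1 - (c * δ) * e₁ + c * β * e₂

omit [IsDomain R] [DecompositionMonoid R] hf h₂ in
theorem ci_mem {u v α β γ δ : R}
    (e₁ : f₁ = α * u + β * v) (e₂ : f₂ = γ * u + δ * v) {r : R} (hr : r ∈ Ideal.span {u, v}) :
    r * (α * δ - β * γ) ∈ Ideal.span {f₁, f₂} := by
  rw [Ideal.mem_span_pair] at *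
  obtain ⟨a, b, rfl⟩ := hr
  exact ⟨a * δ - b * γ, b * α - a * β, by rw [e₁, e₂]; ring⟩

theorem ci_colon_det {u v α β γ δ : R}
    (e₁ : f₁ = α * u + β * v) (e₂ : f₂ = γ * u + δ * v) {t : R}
    (h : t * (α * δ - β * γ) ∈ Ideal.span {f₁, f₂}) : t ∈ Ideal.span {u, v} := by
  rw [Ideal.mem_span_pair] at *
  obtain ⟨a, b, h⟩ := h
  obtain ⟨p, hp1, hp2⟩ := syz hf h₂ (a := u * a - t * δ) (b := - (t * β + u * b))
    (by linear_combination u * h - t * δ * e₁ + t * β * e₂)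
  obtain ⟨q, hq1, hq2⟩ := syz hf h₂ (a := v * a + t * γ) (b := t * α - v * b)
    (by linear_combination v * h + t * γ * e₁ - t * α * e₂)
  refine ⟨q, -p, mul_right_cancel₀ h₂ ?_⟩
  linear_combination v * hp1 - u * hq1 - t * e₂

theorem colon_CI {u v : R} (huv : IsRelPrime u v) (hu : u ≠ 0) (h₁' : f₁ ≠ 0)
    (m₁ : f₁ ∈ Ideal.span {u, v}) (m₂ : f₂ ∈ Ideal.span {u, v}) :
    PD (Submodule.colon (Ideal.span {f₁, f₂}) (Ideal.span {u, v} : Set R)) 3 := by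
  obtain ⟨α, β, e₁⟩ := Ideal.mem_span_pair.1 m₁
  obtain ⟨γ, δ, e₂⟩ := Ideal.mem_span_pair.1 m₂
  refine PD_step (J := Ideal.span {f₁, f₂}) (J' := Ideal.span {u, v}) (d := α * δ - β * γ)
    ((PD_span2 h₁' hf).mono (by omega)) ?_ ?_ (PD_span2 hu huv)
  · intro r
    exact ⟨ci_mem e₁.symm e₂.symm, ci_colon_det hf h₂ e₁.symm e₂.symm⟩
  · ext r
    rw [Submodule.mem_colon, sup_comm, Ideal.mem_span_singleton_sup]
    constructor
    · intro h
      obtain ⟨c, hc⟩ := ci_colon hf h₂ huv hu e₁.symm e₂.symm (r := r)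
        (h _ (Ideal.subset_span (by simp))) (h _ (Ideal.subset_span (by simp)))
      exact ⟨c, _, hc, by ring⟩
    · rintro ⟨c, b, hb, rfl⟩ s hs
      rw [smul_eq_mul, add_mul]
      refine add_mem ?_ (Ideal.mul_mem_right _ _ hb)
      have := ci_mem e₁.symm e₂.symm (Ideal.mul_mem_left _ c hs)
      convert this using 1
      ring

theorem iso_decomp {x y α β γ δ : R} (hxy : IsRelPrime x y) (hx : x ≠ 0)
    (e₁ : f₁ = α * x + β * y) (e₂ : f₂ = γ * x + δ * y) (hp : (Ideal.span {x, y}).IsPrime)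
    {q : Ideal R} {s t : R} (hs : s ∈ q) (ht : t ∈ q) (hs' : s ∉ Ideal.span {x, y})
    (hreg : ∀ u v, u * t - v * s ∈ Ideal.span {x, y} → ∃ e, u - s * e ∈ Ideal.span {x, y})
    {r : R} (hr : ∀ g ∈ Ideal.span {x, y} ⊓ q, r * g ∈ Ideal.span {f₁, f₂}) :
    ∃ e, ∀ g ∈ q, (r - e * (α * δ - β * γ)) * g ∈ Ideal.span {f₁, f₂} := by
  set Δ := α * δ - β * γ with hΔ
  have hc : ∀ g ∈ q, ∃ c, r * g - c * Δ ∈ Ideal.span {f₁, f₂} := by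
    intro g hg
    apply ci_colon hf h₂ hxy hx e₁ e₂
    · rw [mul_assoc]
      exact hr _ ⟨Ideal.mul_mem_left _ _ (Ideal.subset_span (by simp)), Ideal.mul_mem_right _ _ hg⟩
    · rw [mul_assoc]
      exact hr _ ⟨Ideal.mul_mem_left _ _ (Ideal.subset_span (by simp)), Ideal.mul_mem_right _ _ hg⟩
  have hcomm : ∀ g g' c c', r * g - c * Δ ∈ Ideal.span {f₁, f₂} →
      r * g' - c' * Δ ∈ Ideal.span {f₁, f₂} → c * g' - c' * g ∈ Ideal.span {x, y} := by
    intro g g' c c' h h'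
    apply ci_colon_det hf h₂ e₁ e₂
    have := sub_mem (Ideal.mul_mem_right g _ h') (Ideal.mul_mem_right g' _ h)
    rw [← hΔ]
    convert this using 1
    ring
  obtain ⟨c, hcs⟩ := hc s hs
  obtain ⟨d, hdt⟩ := hc t ht
  obtain ⟨e, he⟩ := hreg c d (hcomm _ _ _ _ hcs hdt)
  refine ⟨e, fun g hg => ?_⟩
  obtain ⟨c', hc'⟩ := hc g hg
  have h1 := hcomm _ _ _ _ hc' hcs
  have h2 : (c' - e * g) * s ∈ Ideal.span {x, y} := by
    have := add_mem h1 (Ideal.mul_mem_right g _ he)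
    convert this using 1
    ring
  have h3 := (hp.mem_or_mem h2).resolve_right hs'
  have h4 := add_mem hc' (ci_mem e₁ e₂ h3)
  rw [← hΔ] at h4
  convert h4 using 1
  ring

theorem colon_iso {x y : R} (hxy : IsRelPrime x y) (hx : x ≠ 0)
    (hp : (Ideal.span {x, y}).IsPrime) (m₁ : f₁ ∈ Ideal.span {x, y}) (m₂ : f₂ ∈ Ideal.span {x, y})
    {q : Ideal R} {s t : R} (hs : s ∈ q) (ht : t ∈ q) (hs' : s ∉ Ideal.span {x, y})
    (hreg : ∀ u v, u * t - v * s ∈ Ideal.span {x, y} → ∃ e, u - s * e ∈ Ideal.span {x, y})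
    (hq : PD (Submodule.colon (Ideal.span {f₁, f₂}) (q : Set R)) 3) :
    PD (Submodule.colon (Ideal.span {f₁, f₂}) ((Ideal.span {x, y} ⊓ q : Ideal R) : Set R)) 3 := by
  obtain ⟨α, β, e₁⟩ := Ideal.mem_span_pair.1 m₁
  obtain ⟨γ, δ, e₂⟩ := Ideal.mem_span_pair.1 m₂
  refine PD_step (J := Submodule.colon (Ideal.span {f₁, f₂}) (q : Set R))
    (J' := Ideal.span {x, y}) (d := α * δ - β * γ) hq ?_ ?_ (PD_span2 hx hxy)
  · intro r
    rw [Submodule.mem_colon]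
    constructor
    · intro hr g hg
      exact Ideal.mul_mem_right _ _ (ci_mem e₁.symm e₂.symm hr)
    · intro h
      have h1 := h s hs
      have h2 : r * s ∈ Ideal.span {x, y} := by
        apply ci_colon_det hf h₂ e₁.symm e₂.symm
        convert h1 using 1
        rw [smul_eq_mul]; ring
      exact (hp.mem_or_mem h2).resolve_right hs'
  · ext r
    rw [Submodule.mem_colon, sup_comm, Ideal.mem_span_singleton_sup]
    constructor
    · intro h
      obtain ⟨e, he⟩ := iso_decomp hf h₂ hxy hx e₁.symm e₂.symm hp hs ht hs' hreg (r := r) h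
      exact ⟨e, _, Submodule.mem_colon.2 he, by ring⟩
    · rintro ⟨c, b, hb, rfl⟩ g hg
      rw [smul_eq_mul, add_mul]
      refine add_mem ?_ (Submodule.mem_colon.1 hb g hg.2)
      have := ci_mem e₁.symm e₂.symm (Ideal.mul_mem_left _ c hg.1)
      convert this using 1
      ring

omit [IsDomain R] [DecompositionMonoid R] hf h₂ in
theorem mem_span_triple {a b c r : R} :
    r ∈ Ideal.span {a, b, c} ↔ ∃ A B E, r = A * a + B * b + E * c := by
  rw [Ideal.mem_span_insert]
  constructor
  · rintro ⟨A, z, hz, rfl⟩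
    obtain ⟨B, E, rfl⟩ := Ideal.mem_span_pair.1 hz
    exact ⟨A, B, E, by ring⟩
  · rintro ⟨A, B, E, rfl⟩
    exact ⟨A, _, Ideal.mem_span_pair.2 ⟨B, E, rfl⟩, by ring⟩

theorem colon_path {x y z w : R} (hxy : IsRelPrime x y) (hx : x ≠ 0)
    (hzx : IsRelPrime z (x * w)) (hz : z ≠ 0) (h₁' : f₁ ≠ 0)
    (m₁ : f₁ ∈ Ideal.span {x * z, x * w, y * z}) (m₂ : f₂ ∈ Ideal.span {x * z, x * w, y * z}) :
    PD (Submodule.colon (Ideal.span {f₁, f₂})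
      (Ideal.span {x * z, x * w, y * z} : Set R)) 3 := by
  obtain ⟨A, B, E, e₁⟩ := mem_span_triple.1 m₁
  obtain ⟨A', B', E', e₂⟩ := mem_span_triple.1 m₂
  have hCq := colon_CI hf h₂ hzx hz h₁'
    (Ideal.mem_span_pair.2 ⟨A * x + E * y, B, by rw [e₁]; ring⟩)
    (Ideal.mem_span_pair.2 ⟨A' * x + E' * y, B', by rw [e₂]; ring⟩)
  set t := (A * z + B * w) * E' - (A' * z + B' * w) * E with ht
  have d₁ : f₁ = (A * z + B * w) * x + (E * z) * y := by rw [e₁]; ring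
  have d₂ : f₂ = (A' * z + B' * w) * x + (E' * z) * y := by rw [e₂]; ring
  have hΔ : (A * z + B * w) * (E' * z) - (E * z) * (A' * z + B' * w) = t * z := by
    rw [ht]; ring
  have htx : t * x ∈ Ideal.span {f₁, f₂} := by
    rw [Ideal.mem_span_pair]
    exact ⟨E', -E, by rw [ht, e₁, e₂]; ring⟩
  have hq : ∀ {r : R}, r * z ∈ Ideal.span {f₁, f₂} → r * (x * w) ∈ Ideal.span {f₁, f₂} →
      r ∈ Submodule.colon (Ideal.span {f₁, f₂}) (Ideal.span {z, x * w} : Set R) := by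
    intro r h1 h2
    rw [Submodule.mem_colon]
    intro s hs
    obtain ⟨a, b, rfl⟩ := Ideal.mem_span_pair.1 hs
    have := add_mem (Ideal.mul_mem_left _ a h1) (Ideal.mul_mem_left _ b h2)
    convert this using 1
    rw [smul_eq_mul]; ring
  refine PD_step (J := Submodule.colon (Ideal.span {f₁, f₂}) (Ideal.span {z, x * w} : Set R))
    (J' := Ideal.span {x, y}) (d := t) hCq ?_ ?_ (PD_span2 hx hxy)
  · intro r
    constructor
    · intro hr
      apply hq
      · have := ci_mem d₁ d₂ hr
        rw [hΔ] at this
        rwa [mul_assoc]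
      · have := Ideal.mul_mem_left _ (r * w) htx
        convert this using 1
        ring
    · intro h
      apply ci_colon_det hf h₂ d₁ d₂
      rw [hΔ]
      have := Submodule.mem_colon.1 h z (Ideal.subset_span (by simp))
      convert this using 1
      rw [smul_eq_mul]; ring
  · ext r
    rw [Submodule.mem_colon, sup_comm, Ideal.mem_span_singleton_sup]
    constructor
    · intro h
      have hxz := h (x * z) (Ideal.subset_span (by simp))
      have hxw := h (x * w) (Ideal.subset_span (by simp))
      have hyz := h (y * z) (Ideal.subset_span (by simp))
      rw [smul_eq_mul] at hxz hxw hyz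
      obtain ⟨c, hc⟩ := ci_colon hf h₂ hxy hx d₁ d₂ (r := r * z)
        (by convert hxz using 1; ring) (by convert hyz using 1; ring)
      rw [hΔ] at hc
      refine ⟨c, r - c * t, hq ?_ ?_, by ring⟩
      · convert hc using 1
        ring
      · have := sub_mem hxw (Ideal.mul_mem_left _ (c * w) htx)
        convert this using 1
        ring
    · rintro ⟨c, b, hb, rfl⟩ g hg
      obtain ⟨a1, a2, a3, rfl⟩ := mem_span_triple.1 hg
      have hbz := Submodule.mem_colon.1 hb z (Ideal.subset_span (by simp))
      have hbx := Submodule.mem_colon.1 hb (x * w) (Ideal.subset_span (by simp))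
      have hty : t * z * y ∈ Ideal.span {f₁, f₂} := by
        have := ci_mem d₁ d₂ (r := y) (Ideal.subset_span (by simp))
        rw [hΔ] at this
        rwa [mul_comm]
      rw [smul_eq_mul] at *
      have := add_mem (add_mem (Ideal.mul_mem_left _ (c * (a1 * z + a2 * w)) htx)
        (Ideal.mul_mem_left _ (c * a3) hty)) (add_mem (Ideal.mul_mem_left _ (a1 * x + a3 * y) hbz)
        (Ideal.mul_mem_left _ a2 hbx))
      convert this using 1
      ring

omit hf h₂ in
theorem PD_path {x y z w : R} (hxy : IsRelPrime x y) (hx : x ≠ 0) (hxz : IsRelPrime x z)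
    (hzw : IsRelPrime z w) (hz : z ≠ 0) :
    PD (Ideal.span {x * z, x * w, y * z}) 2 := by
  have h1 : PD (Ideal.span {x * z, x * w}) 2 := by
    refine PD_step (J := Ideal.span {x * z}) (J' := Ideal.span {z}) (d := x * w)
      ((PD_span1 (mul_ne_zero hx hz)).mono (by omega)) ?_ (Ideal.span_insert _ _) (PD_span1 hz)
    intro r
    rw [Ideal.mem_span_singleton, Ideal.mem_span_singleton]
    constructor
    · rintro ⟨a, rfl⟩
      exact ⟨a * w, by ring⟩
    · rintro ⟨a, ha⟩
      exact hzw.dvd_of_dvd_mul_right ⟨a, mul_left_cancel₀ hx (by linear_combination ha)⟩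
  refine PD_step (J := Ideal.span {x * z, x * w}) (J' := Ideal.span {x}) (d := y * z)
      h1 ?_ ?_ (PD_span1 hx)
  · intro r
    rw [Ideal.mem_span_singleton, Ideal.mem_span_pair]
    constructor
    · rintro ⟨a, rfl⟩
      exact ⟨a * y, 0, by ring⟩
    · rintro ⟨a, b, ha⟩
      exact (hxy.mul_right hxz).dvd_of_dvd_mul_right ⟨a * z + b * w, by rw [← ha]; ring⟩
  · rw [← Ideal.span_union]
    congr 1
    ext; simp; tauto

end commalg

section linear
variable {k : Type} [Field k] {N : ℕ}

def lin : (Fin N → k) →ₗ[k] MvPolynomial (Fin N) k :=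
  Fintype.linearCombination k (X : Fin N → MvPolynomial (Fin N) k)

theorem lin_single (i : Fin N) : lin (Pi.single i (1 : k)) = X i := by
  simp [lin, Fintype.linearCombination_apply_single]

theorem lin_apply (v : Fin N → k) : lin v = ∑ i, v i • (X i : MvPolynomial (Fin N) k) := by
  simp [lin, Fintype.linearCombination_apply]

theorem coeff_lin (v : Fin N → k) (i : Fin N) : coeff (Finsupp.single i 1) (lin v) = v i := by
  classical
  rw [lin_apply, coeff_sum]
  simp [coeff_X]
  simp [Finsupp.single_left_inj]

theorem lin_injective : Function.Injective (lin : (Fin N → k) →ₗ[k] _) := by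
  intro v w h
  ext i
  rw [← coeff_lin v, h, coeff_lin]

theorem lin_homog (v : Fin N → k) : (lin v).IsHomogeneous 1 := by
  rw [lin_apply]
  refine IsHomogeneous.sum _ _ _ fun i _ => ?_
  rw [smul_eq_C_mul]
  simpa using (isHomogeneous_C (Fin N) (v i)).mul (isHomogeneous_X k i)

theorem exists_lin {f : MvPolynomial (Fin N) k} (h : f.IsHomogeneous 1) : ∃ v, f = lin v := by
  have h1 : f ∈ homogeneousSubmodule (Fin N) k 1 := h
  rw [homogeneousSubmodule_one_eq_span_X] at h1
  have : Submodule.span k (Set.range X) ≤ LinearMap.range (lin : (Fin N → k) →ₗ[k] _) := by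
    rw [Submodule.span_le]
    rintro _ ⟨i, rfl⟩
    exact ⟨_, lin_single i⟩
  obtain ⟨v, hv⟩ := this h1
  exact ⟨v, hv.symm⟩

/-- ideal generated by a space of linear forms -/
def LP (V : Submodule k (Fin N → k)) : Ideal (MvPolynomial (Fin N) k) :=
  Ideal.span (lin '' (V : Set (Fin N → k)))

theorem LP_ker (V : Submodule k (Fin N → k)) : ∃ (π : (Fin N → k) →ₗ[k] (Fin N → k))
    (φ : MvPolynomial (Fin N) k →ₐ[k] MvPolynomial (Fin N) k),
    LinearMap.ker π = V ∧ (∀ v, φ (lin v) = lin (π v)) ∧ RingHom.ker φ = LP V := by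
  obtain ⟨W, hW⟩ := V.exists_isCompl
  let π : (Fin N → k) →ₗ[k] (Fin N → k) := W.subtype ∘ₗ W.projectionOnto V hW.symm
  have hker : LinearMap.ker π = V := by
    rw [LinearMap.ker_comp_of_ker_eq_bot _ (Submodule.ker_subtype W)]
    simp
  have hidem : ∀ v, v - π v ∈ V := by
    intro v
    rw [← hker, LinearMap.mem_ker, map_sub, sub_eq_zero]
    have : W.projectionOnto V hW.symm (W.projectionOnto V hW.symm v : Fin N → k)
        = W.projectionOnto V hW.symm v := Submodule.projectionOnto_apply_left _ _
    exact (congrArg W.subtype this).symm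
  let φ : MvPolynomial (Fin N) k →ₐ[k] MvPolynomial (Fin N) k :=
    aeval (fun i => lin (π (Pi.single i 1)))
  have hφ : ∀ v, φ (lin v) = lin (π v) := by
    intro v
    have : φ.toLinearMap ∘ₗ lin = lin ∘ₗ π := by
      apply LinearMap.pi_ext'
      intro i
      ext1
      simp [lin_single, φ]
    exact LinearMap.congr_fun this v
  refine ⟨π, φ, hker, hφ, ?_⟩
  have hmod : ∀ f, f - φ f ∈ LP V := by
    intro f
    have : (Ideal.Quotient.mkₐ k (LP V)).comp φ = Ideal.Quotient.mkₐ k (LP V) := by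
      apply MvPolynomial.algHom_ext
      intro i
      simp only [AlgHom.comp_apply, Ideal.Quotient.mkₐ_eq_mk]
      symm
      rw [Ideal.Quotient.mk_eq_mk_iff_sub_mem, ← lin_single, hφ, ← map_sub]
      exact Ideal.subset_span ⟨_, hidem _, rfl⟩
    rw [← Ideal.Quotient.mk_eq_mk_iff_sub_mem]
    exact (AlgHom.congr_fun this f).symm
  apply le_antisymm
  · intro f hf
    have := hmod f
    rw [RingHom.mem_ker] at hf
    rwa [hf, sub_zero] at this
  · unfold LP
    rw [Ideal.span_le]
    rintro _ ⟨v, hv, rfl⟩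
    have : π v = 0 := by rw [← LinearMap.mem_ker, hker]; exact hv
    simp [RingHom.mem_ker, hφ, this]

theorem LP_prime (V : Submodule k (Fin N → k)) : (LP V).IsPrime := by
  obtain ⟨π, φ, -, -, h⟩ := LP_ker V
  rw [← h]
  exact RingHom.ker_isPrime _

theorem lin_mem {V : Submodule k (Fin N → k)} {v : Fin N → k} : lin v ∈ LP V ↔ v ∈ V := by
  obtain ⟨π, φ, h1, h2, h⟩ := LP_ker V
  rw [← h, RingHom.mem_ker]
  show φ (lin v) = 0 ↔ _
  rw [h2, ← h1, LinearMap.mem_ker]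
  exact ⟨fun h => lin_injective (by rw [h, map_zero]), fun h => by rw [h, map_zero]⟩

theorem LP_mono {V W : Submodule k (Fin N → k)} (h : V ≤ W) : LP V ≤ LP W :=
  Ideal.span_mono (Set.image_mono h)

theorem LP_le_iff {V W : Submodule k (Fin N → k)} : LP V ≤ LP W ↔ V ≤ W :=
  ⟨fun h _ hv => lin_mem.1 (h (lin_mem.2 hv)), LP_mono⟩

theorem LP_span (S : Set (Fin N → k)) : LP (Submodule.span k S) = Ideal.span (lin '' S) := by
  apply le_antisymm
  · unfold LP
    rw [Ideal.span_le]
    rintro _ ⟨v, hv, rfl⟩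
    induction hv using Submodule.span_induction with
    | mem x h => exact Ideal.subset_span ⟨x, h, rfl⟩
    | zero => simp
    | add x y _ _ hx hy => rw [map_add]; exact Ideal.add_mem _ hx hy
    | smul a x _ hx =>
      rw [map_smul, smul_eq_C_mul]
      exact Ideal.mul_mem_left _ _ hx
  · exact Ideal.span_mono (Set.image_mono Submodule.subset_span)

theorem LP_pair (a b : Fin N → k) : LP (Submodule.span k {a, b}) = Ideal.span {lin a, lin b} := by
  rw [LP_span, Set.image_pair]

theorem LP_sup (V : Submodule k (Fin N → k)) (w : Fin N → k) :
    LP (V ⊔ Submodule.span k {w}) = LP V ⊔ Ideal.span {lin w} := by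
  rw [← Submodule.span_eq V, ← Submodule.span_union, LP_span, LP_span, Set.image_union,
    Ideal.span_union, Set.image_singleton]

theorem lin_ne_zero {a : Fin N → k} (h : a ≠ 0) : lin a ≠ 0 := by
  intro h'
  exact h (lin_injective (by rw [h', map_zero]))

theorem lin_prime {a : Fin N → k} (h : a ≠ 0) : Prime (lin a) := by
  rw [← Ideal.span_singleton_prime (lin_ne_zero h)]
  have := LP_prime (Submodule.span k {a})
  rwa [LP_span, Set.image_singleton] at this

theorem lin_dvd {a b : Fin N → k} : lin a ∣ lin b ↔ b ∈ Submodule.span k {a} := by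
  rw [← lin_mem, LP_span, Set.image_singleton, Ideal.mem_span_singleton]

theorem lin_relPrime {a b : Fin N → k} (ha : a ≠ 0) (h : b ∉ Submodule.span k {a}) :
    IsRelPrime (lin a) (lin b) := by
  rw [(lin_prime ha).irreducible.isRelPrime_iff_not_dvd, lin_dvd]
  exact h

end linear

section heights

theorem idealHeight_eq {R : Type} [CommRing R] (J : Ideal R) : idealHeight J = J.height := by
  let e : {q : Ideal R // q.IsPrime} ≃o PrimeSpectrum R :=
    { toFun := fun q => ⟨q.1, q.2⟩
      invFun := fun q => ⟨q.1, q.2⟩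
      left_inv := fun _ => rfl
      right_inv := fun _ => rfl
      map_rel_iff' := Iff.rfl }
  have he : ∀ q : {q : Ideal R // q.IsPrime}, Order.height q = q.1.height := by
    intro q
    rw [← Order.height_orderIso e q, ← PrimeSpectrum.height_eq_orderHeight]
    rfl
  unfold idealHeight
  apply le_antisymm
  · rw [Ideal.height_eq_inf_minimalPrimes]
    refine le_iInf₂ fun p hp => ?_
    refine (iInf₂_le (⟨p, hp.1.1⟩ : {q : Ideal R // q.IsPrime}) hp.1.2).trans ?_
    rw [he]
  · refine le_iInf₂ fun p hp => ?_
    rw [he]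
    exact Ideal.height_mono hp

variable {k : Type} [Field k] {N : ℕ}

theorem le_height_LP (n : ℕ) : ∀ V : Submodule k (Fin N → k), Module.finrank k V = n →
    (n : ℕ∞) ≤ (LP V).height := by
  induction n with
  | zero => simp
  | succ n ih =>
    intro V hV
    obtain ⟨W, hW, hWn⟩ : ∃ W ≤ V, Module.finrank k W = n := by
      let b := Module.finBasisOfFinrankEq k V hV
      refine ⟨Submodule.span k (Set.range fun i : Fin n => (b i.castSucc : Fin N → k)), ?_, ?_⟩
      · rw [Submodule.span_le]
        rintro _ ⟨i, rfl⟩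
        exact (b i.castSucc).2
      · have h1 := (b.linearIndependent.map' V.subtype (Submodule.ker_subtype V)).comp _
          (Fin.castSucc_injective n)
        have := finrank_span_eq_card h1
        rw [Fintype.card_fin] at this
        exact this
    have := ih W hWn
    have := LP_prime W
    have := LP_prime V
    have hlt : LP W < LP V := by
      refine lt_of_le_of_ne (LP_mono hW) fun h => ?_
      have : W = V := le_antisymm hW (LP_le_iff.1 h.ge)
      subst this
      omega
    have := Ideal.height_add_one_le_of_lt_of_isPrime hlt
    push_cast
    refine le_trans ?_ this
    gcongr

theorem height_LP (V : Submodule k (Fin N → k)) : (LP V).height = Module.finrank k V := by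
  apply le_antisymm
  · let b := Module.finBasis k V
    have hb : LP V = Ideal.span (Set.range fun i => lin (b i : Fin N → k)) := by
      have : V = Submodule.span k (Set.range fun i => (b i : Fin N → k)) := by
        have := b.span_eq
        have h2 := congrArg (Submodule.map V.subtype) this
        rw [Submodule.map_span, ← Set.range_comp] at h2
        rw [Submodule.map_top, Submodule.range_subtype] at h2
        exact h2.symm
      conv_lhs => rw [this]
      rw [LP_span, ← Set.range_comp]
      rfl
    have hp := LP_prime V
    have := Ideal.height_le_card_of_mem_minimalPrimes_span (p := LP V)
      (s := Set.range fun i => lin (b i : Fin N → k)) (Set.finite_range _) (by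
        rw [← hb, Ideal.minimalPrimes_eq_subsingleton_self]; rfl)
    refine this.trans ?_
    have h3 := Set.ncard_image_le (f := fun i => lin (b i : Fin N → k)) Set.finite_univ
    rw [Set.image_univ, Set.ncard_univ, Nat.card_fin] at h3
    exact_mod_cast h3
  · exact le_height_LP _ V rfl

theorem linearPrime_eq {p : Ideal (MvPolynomial (Fin N) k)} (hp : IsLinearPrime p)
    (h : idealHeight p = 2) : ∃ V : Submodule k (Fin N → k), Module.finrank k V = 2 ∧ p = LP V := by
  obtain ⟨hp, S, hS, hpS⟩ := hp
  have : p = LP (Submodule.span k (lin ⁻¹' S)) := by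
    rw [LP_span, hpS]
    congr 1
    rw [Set.image_preimage_eq_iff.2]
    intro f hf
    obtain ⟨v, rfl⟩ := exists_lin (hS f hf)
    exact ⟨v, rfl⟩
  refine ⟨_, ?_, this⟩
  rw [idealHeight_eq, this, height_LP] at h
  exact_mod_cast h

theorem relPrime_of_height {R : Type} [CommRing R] [IsDomain R] [UniqueFactorizationMonoid R]
    [IsNoetherianRing R] {f g : R} (h : idealHeight (Ideal.span {f, g}) = 2) :
    f ≠ 0 ∧ g ≠ 0 ∧ IsRelPrime f g := by
  rw [idealHeight_eq] at h
  have key : ∀ d, d ∣ f → d ∣ g → IsUnit d := by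
    intro d hf hg
    by_contra hd
    have h1 := Ideal.height_span_singleton_le_one hd
    have : Ideal.span {f, g} ≤ Ideal.span {d} := by
      rw [Ideal.span_le]
      rintro x (rfl | rfl) <;> simpa [Ideal.mem_span_singleton]
    have := (Ideal.height_mono this).trans h1
    rw [h] at this
    exact absurd this (by decide)
  have htop : Ideal.span {f, g} ≠ ⊤ := by
    intro h'
    rw [h', Ideal.height_top] at h
    exact absurd h (by decide)
  refine ⟨?_, ?_, fun d hf hg => key d hf hg⟩
  · rintro rfl
    have := key g (dvd_zero _) dvd_rfl
    exact htop (Ideal.eq_top_of_isUnit_mem _ (Ideal.subset_span (by simp)) this)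
  · rintro rfl
    have := key f dvd_rfl (dvd_zero _)
    exact htop (Ideal.eq_top_of_isUnit_mem _ (Ideal.subset_span (by simp)) this)

end heights

section unmixed

theorem over_prime {A B S : Type} [CommRing A] [CommRing B] [IsNoetherianRing B] [CommRing S]
    [Algebra A S] [Algebra.IsIntegral A S]
    (π : B →+* S) (hπ : Function.Surjective π) (ι : A →+* B)
    (hι : ∀ a, π (ι a) = algebraMap A S a) {f₁ : B} (hker : RingHom.ker π = Ideal.span {f₁})
    {g : A} [hg : (Ideal.span {g}).IsPrime] (J : Ideal B) (hf₁ : f₁ ∈ J)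
    (hJ : J.comap ι ≤ Ideal.span {g}) : ∃ Q : Ideal B, Q.IsPrime ∧ J ≤ Q ∧ Q.height ≤ 2 := by
  have hkJ : RingHom.ker π ≤ J := by
    rw [hker, Ideal.span_singleton_le_iff_mem]; exact hf₁
  have hcomap : ∀ I : Ideal B, RingHom.ker π ≤ I → (I.map π).comap (algebraMap A S) = I.comap ι := by
    intro I hI
    ext a
    rw [Ideal.mem_comap, Ideal.mem_comap, ← hι, ← Ideal.mem_comap,
      Ideal.comap_map_of_surjective' π hπ, sup_eq_left.2 hI]
  obtain ⟨Q, hQJ, hQ, hQg⟩ := Ideal.exists_ideal_over_prime_of_isIntegral (Ideal.span {g})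
    (J.map π) (by rw [hcomap J hkJ]; exact hJ)
  have hJQ : J ≤ Q.comap π := Ideal.map_le_iff_le_comap.1 hQJ
  refine ⟨Q.comap π, Ideal.comap_isPrime _ _, hJQ, ?_⟩
  have hmin : Q.comap π ∈ (Ideal.span {f₁, ι g}).minimalPrimes := by
    refine ⟨⟨Ideal.comap_isPrime _ _, ?_⟩, ?_⟩
    · rw [Ideal.span_le]
      rintro x (rfl | rfl)
      · exact hJQ hf₁
      · show π (ι g) ∈ Q
        rw [hι, ← Ideal.mem_comap, hQg]
        exact Ideal.mem_span_singleton_self g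
    · rintro P ⟨hP, hPm⟩ hPQ
      have hkP : RingHom.ker π ≤ P := by
        rw [hker, Ideal.span_singleton_le_iff_mem]; exact hPm (Ideal.subset_span (by simp))
      have hP' : (P.map π).IsPrime := Ideal.map_isPrime_of_surjective hπ hkP
      have hle : P.map π ≤ Q := Ideal.map_le_iff_le_comap.2 hPQ
      have heq : P.map π = Q := by
        by_contra hne
        have := Ideal.IsIntegral.comap_lt_comap (R := A) (lt_of_le_of_ne hle hne)
        rw [hQg, hcomap P hkP] at this
        refine this.not_ge ?_
        rw [Ideal.span_singleton_le_iff_mem]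
        exact hPm (Ideal.subset_span (by simp))
      show Q.comap π ≤ P
      rw [← heq, Ideal.comap_map_of_surjective' π hπ, sup_eq_left.2 hkP]
  refine (Ideal.height_le_card_of_mem_minimalPrimes_span (by simp) hmin).trans ?_
  have h2 := Set.ncard_insert_le f₁ {ι g}
  rw [Set.ncard_singleton] at h2
  exact_mod_cast h2

theorem unmixed_core {A B S : Type} [CommRing A] [IsDomain A] [UniqueFactorizationMonoid A]
    [CommRing B] [IsDomain B] [DecompositionMonoid B] [IsNoetherianRing B] [CommRing S]
    [Algebra A S] [Module.Finite A S] [Module.Free A S]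
    (π : B →+* S) (hπ : Function.Surjective π) (ι : A →+* B)
    (hι : ∀ a, π (ι a) = algebraMap A S a) {f₁ f₂ : B} (hker : RingHom.ker π = Ideal.span {f₁})
    (hf : IsRelPrime f₁ f₂) (b : B)
    (hb : ∀ Q : Ideal B, Q.IsPrime → Ideal.span {f₁, f₂} ≤ Q → Q.height ≤ 2 →
      ∃ s, s ∉ Q ∧ s * b ∈ Ideal.span {f₁, f₂}) : b ∈ Ideal.span {f₁, f₂} := by
  have hπ0 : ∀ x, π x = 0 ↔ f₁ ∣ x := by
    intro x
    rw [← RingHom.mem_ker, hker, Ideal.mem_span_singleton]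
  have hmem : ∀ x, x ∈ Ideal.span {f₁, f₂} ↔ ∃ c, π x = π f₂ * c := by
    intro x
    rw [Ideal.mem_span_pair]
    constructor
    · rintro ⟨u, v, rfl⟩
      exact ⟨π v, by rw [map_add, map_mul, map_mul, (hπ0 f₁).2 dvd_rfl]; ring⟩
    · rintro ⟨c, hc⟩
      obtain ⟨c, rfl⟩ := hπ c
      rw [← map_mul, ← sub_eq_zero, ← map_sub, hπ0] at hc
      obtain ⟨u, hu⟩ := hc
      exact ⟨u, c, by linear_combination -hu⟩
  have hnzd : ∀ {y : S}, y * π f₂ = 0 → y = 0 := by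
    intro y hy
    obtain ⟨y, rfl⟩ := hπ y
    rw [← map_mul, hπ0] at hy
    rw [hπ0]
    exact hf.dvd_of_dvd_mul_right hy
  by_cases hS : Subsingleton S
  · exact (hmem b).2 ⟨0, Subsingleton.elim _ _⟩
  rw [not_subsingleton_iff_nontrivial] at hS
  have hIntegral : IsIntegral A (π f₂) := Algebra.IsIntegral.isIntegral _
  obtain ⟨p, hp, hpr⟩ := hIntegral
  obtain ⟨i, hi0, hi⟩ := Ideal.exists_coeff_ne_zero_mem_comap_of_non_zero_divisor_root_mem
    (I := Ideal.span {π f₂}) hnzd (Ideal.mem_span_singleton_self _) hp.ne_zero hpr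
  set r := p.coeff i
  rw [Ideal.mem_comap, Ideal.mem_span_singleton] at hi
  obtain ⟨f', hf'⟩ := hi
  let J : Ideal B := Submodule.colon (Ideal.span {f₁, f₂}) {b}
  have hJ : ∀ s, s ∈ J ↔ s * b ∈ Ideal.span {f₁, f₂} := by
    intro s
    simp [J, Submodule.mem_colon_singleton]
  have hCJ : Ideal.span {f₁, f₂} ≤ J := fun s hs => (hJ s).2 (Ideal.mul_mem_right _ _ hs)
  have h1 : ∃ a, a ∈ J.comap ι ∧ IsRelPrime a r := by
    classical
    by_contra! hcon
    have hsub : ((J.comap ι : Ideal A) : Set A) ⊆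
        ⋃ g ∈ ((UniqueFactorizationMonoid.factors r).toFinset : Set A),
          ((Ideal.span {g} : Ideal A) : Set A) := by
      intro a ha
      have := hcon a ha
      obtain ⟨g, hg, hga, hgr⟩ : ∃ g, Prime g ∧ g ∣ a ∧ g ∣ r := by
        by_contra! h'
        exact this ((UniqueFactorizationMonoid.isRelPrime_iff_no_prime_factors hi0).2
          fun d h1 h2 h3 => h' d h3 h2 h1).symm
      obtain ⟨q, hq, hgq⟩ := UniqueFactorizationMonoid.exists_mem_factors_of_dvd hi0 hg.irreducible hgr
      simp only [Set.mem_iUnion]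
      refine ⟨q, by simpa using hq, ?_⟩
      exact Ideal.mem_span_singleton.2 (hgq.symm.dvd.trans hga)
    have hpr : ∀ g ∈ (UniqueFactorizationMonoid.factors r).toFinset,
        (Ideal.span {g} : Ideal A).IsPrime := by
      intro g hg
      have := UniqueFactorizationMonoid.prime_of_factor g (Multiset.mem_toFinset.1 hg)
      exact (Ideal.span_singleton_prime this.ne_zero).2 this
    rw [Ideal.subset_union_prime 0 0 (fun g hg _ _ => hpr g hg)] at hsub
    obtain ⟨g, hg, hJg⟩ := hsub
    have := hpr g hg
    obtain ⟨Q, hQ, hJQ, hQh⟩ := over_prime π hπ ι hι hker J (hCJ (Ideal.subset_span (by simp))) hJg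
    obtain ⟨s, hs, hsb⟩ := hb Q hQ (hCJ.trans hJQ) hQh
    exact hs (hJQ ((hJ s).2 hsb))
  obtain ⟨a, ha, har⟩ := h1
  rw [Ideal.mem_comap, hJ, hmem] at ha
  obtain ⟨c, hc⟩ := ha
  rw [map_mul, hι] at hc
  have h2 : a • (π b * f') = r • c := by
    rw [Algebra.smul_def, Algebra.smul_def, hf']
    linear_combination f' * hc
  let bas := Module.Free.chooseBasis A S
  have h3 : ∀ j, r ∣ bas.repr (π b * f') j := by
    intro j
    have := congrArg (fun s => bas.repr s j) h2
    simp only [map_smul, Finsupp.smul_apply, smul_eq_mul] at this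
    exact har.symm.dvd_of_dvd_mul_left ⟨_, this⟩
  choose d hd using h3
  have h4 : π b * f' = r • bas.equivFun.symm d := by
    apply bas.equivFun.injective
    rw [map_smul, LinearEquiv.apply_symm_apply]
    ext j
    simp [Module.Basis.equivFun_apply, hd]
  rw [hmem]
  refine ⟨bas.equivFun.symm d, ?_⟩
  rw [← sub_eq_zero]
  have h5 : r • (π b - π f₂ * bas.equivFun.symm d) = 0 := by
    rw [Algebra.smul_def] at *
    rw [hf'] at *
    linear_combination π f₂ * h4
  exact (smul_eq_zero.1 h5).resolve_left hi0

end unmixed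

section normalpos
open Polynomial MvPolynomial Ideal Nat RingHom List

variable {k : Type*} [Field k] {n : ℕ} (f : MvPolynomial (Fin (n + 1)) k)
variable (v w : Fin (n + 1) →₀ ℕ)

namespace NoetherNormalization

theorem lt_up {f : MvPolynomial (Fin (n + 1)) k} {v : Fin (n + 1) →₀ ℕ} (vlt : ∀ i, v i < (2 + f.totalDegree)) : ∀ l ∈ ofFn v, l < (2 + f.totalDegree) := by
  grind

theorem t1_comp_t1_neg (c : k) : (T1 f c).comp (T1 f (-c)) = AlgHom.id _ _ := by
  rw [comp_aeval, ← MvPolynomial.aeval_X_left]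
  ext i v
  cases i using Fin.cases <;> simp

/-- `T1 f 1` leads to an algebra equiv `T f`. -/
noncomputable abbrev T := AlgEquiv.ofAlgHom (T1 f 1) (T1 f (-1))
  (t1_comp_t1_neg f 1) (by simpa using t1_comp_t1_neg f (-1))

theorem sum_r_mul_ne (vlt : ∀ i, v i < (2 + f.totalDegree)) (wlt : ∀ i, w i < (2 + f.totalDegree)) (ne : v ≠ w) :
    ∑ x : Fin (n + 1), (2 + f.totalDegree) ^ x.1 * v x ≠ ∑ x : Fin (n + 1), (2 + f.totalDegree) ^ x.1 * w x := by
  intro h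
  refine ne <| Finsupp.ext <| congrFun <| ofFn_inj.mp ?_
  apply ofDigits_inj_of_len_eq (Nat.lt_add_right f.totalDegree one_lt_two)
    (by simp) (lt_up vlt) (lt_up wlt)
  simpa only [ofDigits_eq_sum_mapIdx, mapIdx_eq_ofFn, get_ofFn, length_ofFn,
    Fin.val_cast, mul_comm, sum_ofFn] using! h

theorem degreeOf_zero_t {a : k} (ha : a ≠ 0) : ((T f) (monomial v a)).degreeOf 0 =
    ∑ i : Fin (n + 1), ((2 + f.totalDegree) ^ i.1) * v i := by
  rw [← natDegree_finSuccEquiv, monomial_eq, Finsupp.prod_pow v fun a ↦ X a]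
  simp only [Fin.prod_univ_succ, Fin.sum_univ_succ, map_mul, map_prod, map_pow,
    AlgEquiv.ofAlgHom_apply, MvPolynomial.aeval_C, MvPolynomial.aeval_X, if_pos, Fin.succ_ne_zero,
    ite_false, one_smul, map_add, finSuccEquiv_X_zero, finSuccEquiv_X_succ, algebraMap_eq]
  have h (i : Fin n) :
      (Polynomial.C (X (R := k) i) + Polynomial.X ^ (2 + f.totalDegree) ^ i.succ.1) ^ v i.succ ≠ 0 :=
    pow_ne_zero (v i.succ) (leadingCoeff_ne_zero.mp <| by simp [add_comm, leadingCoeff_X_pow_add_C])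
  rw [natDegree_mul (by simp [ha]) (mul_ne_zero (by simp) (Finset.prod_ne_zero_iff.mpr
    (fun i _ ↦ h i))), natDegree_mul (by simp) (Finset.prod_ne_zero_iff.mpr (fun i _ ↦ h i)),
    natDegree_prod _ _ (fun i _ ↦ h i), natDegree_finSuccEquiv, degreeOf_C]
  simpa only [natDegree_pow, zero_add, natDegree_X, mul_one, Fin.val_zero, pow_zero, one_mul,
    add_right_inj] using Finset.sum_congr rfl (fun i _ ↦ by
    rw [add_comm (Polynomial.C _), natDegree_X_pow_add_C, mul_comm])

/-- `T` maps different monomials of `f` to polynomials with different degrees in `X_0`. -/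
theorem degreeOf_t_ne_of_ne (hv : v ∈ f.support) (hw : w ∈ f.support) (ne : v ≠ w) :
    (T f <| monomial v <| coeff v f).degreeOf 0 ≠
    (T f <| monomial w <| coeff w f).degreeOf 0 := by
  rw [degreeOf_zero_t _ _ <| mem_support_iff.mp hv, degreeOf_zero_t _ _ <| mem_support_iff.mp hw]
  refine sum_r_mul_ne f v w (fun i ↦ ?_) (fun i ↦ ?_) ne <;>
  exact lt_of_le_of_lt ((monomial_le_degreeOf i ‹_›).trans (degreeOf_le_totalDegree f i))
    (by lia)

theorem leadingCoeff_finSuccEquiv_t :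
    (finSuccEquiv k n ((T f) ((monomial v) (coeff v f)))).leadingCoeff =
    algebraMap k _ (coeff v f) := by
  rw [monomial_eq, Finsupp.prod_fintype]
  · simp only [map_mul, map_prod, leadingCoeff_mul, leadingCoeff_prod]
    rw [AlgEquiv.ofAlgHom_apply, algHom_C, algebraMap_eq, finSuccEquiv_apply,
      eval₂Hom_C, coe_comp]
    simp only [AlgEquiv.ofAlgHom_apply, Function.comp_apply, leadingCoeff_C, map_pow,
      leadingCoeff_pow, algebraMap_eq]
    have : ∀ j, ((finSuccEquiv k n) ((T1 f) 1 (X j))).leadingCoeff = 1 := fun j ↦ by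
      by_cases h : j = 0
      · simp [h, finSuccEquiv_apply]
      · simp only [aeval_eq_bind₁, bind₁_X_right, if_neg h, one_smul, map_add, map_pow]
        obtain ⟨i, rfl⟩ := Fin.exists_succ_eq.mpr h
        simp [finSuccEquiv_X_succ, finSuccEquiv_X_zero, add_comm]
    simp only [this, one_pow, Finset.prod_const_one, mul_one]
  exact fun i ↦ pow_zero _

/-- `T` maps `f` into some polynomial in `X_0` such that the leading coefficient is invertible. -/
theorem T_leadingcoeff_isUnit (fne : f ≠ 0) :
    IsUnit (finSuccEquiv k n (T f f)).leadingCoeff := by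
  obtain ⟨v, vin, vs⟩ := Finset.exists_max_image f.support
    (fun v ↦ (T f ((monomial v) (coeff v f))).degreeOf 0) (support_nonempty.mpr fne)
  set h := fun w ↦ (MvPolynomial.monomial w) (coeff w f)
  simp only [← natDegree_finSuccEquiv] at vs
  replace vs : ∀ x ∈ f.support \ {v}, (finSuccEquiv k n ((T f) (h x))).degree <
      (finSuccEquiv k n ((T f) (h v))).degree := by
    intro x hx
    obtain ⟨h1, h2⟩ := Finset.mem_sdiff.mp hx
    apply degree_lt_degree <| lt_of_le_of_ne (vs x h1) ?_
    simpa only [natDegree_finSuccEquiv]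
      using degreeOf_t_ne_of_ne f _ _ h1 vin <| ne_of_not_mem_cons h2
  have coeff : (finSuccEquiv k n ((T f) (h v + ∑ x ∈ f.support \ {v}, h x))).leadingCoeff =
      (finSuccEquiv k n ((T f) (h v))).leadingCoeff := by
    simp only [map_add, map_sum]
    rw [add_comm]
    apply leadingCoeff_add_of_degree_lt <| (lt_of_le_of_lt <| degree_sum_le _ _) ?_
    have h2 : h v ≠ 0 := by simpa [h] using mem_support_iff.mp vin
    replace h2 : (finSuccEquiv k n ((T f) (h v))) ≠ 0 := fun eq ↦ h2 <|
      by simpa only [map_eq_zero_iff _ (AlgEquiv.injective _)] using eq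
    exact (Finset.sup_lt_iff <| Ne.bot_lt (fun x ↦ h2 <| degree_eq_bot.mp x)).mpr vs
  nth_rw 2 [← f.support_sum_monomial_coeff]
  rw [Finset.sum_eq_add_sum_sdiff_singleton_of_mem vin h]
  rw [leadingCoeff_finSuccEquiv_t] at coeff
  simpa only [coeff, algebraMap_eq] using (mem_support_iff.mp vin).isUnit.map MvPolynomial.C


end NoetherNormalization
end normalpos


section unmixed2
theorem unmixed {k : Type} [Field k] {N : ℕ} {f₁ f₂ : MvPolynomial (Fin N) k} (h₁ : f₁ ≠ 0)
    (hf : IsRelPrime f₁ f₂) (b : MvPolynomial (Fin N) k)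
    (hb : ∀ Q : Ideal (MvPolynomial (Fin N) k), Q.IsPrime → Ideal.span {f₁, f₂} ≤ Q →
      Q.height ≤ 2 → ∃ s, s ∉ Q ∧ s * b ∈ Ideal.span {f₁, f₂}) : b ∈ Ideal.span {f₁, f₂} := by
  rcases N with _ | n
  · have hu : IsUnit f₁ := by
      rw [← MulEquiv.isUnit_map (isEmptyAlgEquiv k (Fin 0))]
      refine IsUnit.mk0 _ ?_
      exact (map_ne_zero_iff _ (isEmptyAlgEquiv k (Fin 0)).injective).2 h₁
    rw [Ideal.eq_top_of_isUnit_mem _ (Ideal.subset_span (by simp)) hu]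
    trivial
  · let e : MvPolynomial (Fin (n + 1)) k ≃+* Polynomial (MvPolynomial (Fin n) k) :=
      ((NoetherNormalization.T f₁).trans (finSuccEquiv k n)).toRingEquiv
    have hu : IsUnit (e f₁).leadingCoeff := NoetherNormalization.T_leadingcoeff_isUnit f₁ h₁
    let g := hu.unit⁻¹.val • e f₁
    have hg : g.Monic := Polynomial.monic_of_isUnit_leadingCoeff_inv_smul hu
    have hassoc : Associated (e f₁) g := by
      refine ⟨(Units.map Polynomial.C.toMonoidHom) hu.unit⁻¹, ?_⟩
      simp only [g, Polynomial.smul_eq_C_mul]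
      rw [mul_comm]
      rfl
    have : Module.Finite (MvPolynomial (Fin n) k) (AdjoinRoot g) := hg.finite_adjoinRoot
    have : Module.Free (MvPolynomial (Fin n) k) (AdjoinRoot g) := hg.free_adjoinRoot
    refine unmixed_core (A := MvPolynomial (Fin n) k) (S := AdjoinRoot g)
      ((AdjoinRoot.mk g).comp e.toRingHom) ?_
      (e.symm.toRingHom.comp Polynomial.C) ?_ ?_ hf b hb
    · exact (AdjoinRoot.mk_surjective).comp e.surjective
    · intro a
      simp
    · ext x
      rw [RingHom.mem_ker, Ideal.mem_span_singleton, RingHom.comp_apply, AdjoinRoot.mk_eq_zero,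
        ← hassoc.dvd_iff_dvd_left]
      exact map_dvd_iff e
end unmixed2

section caseone
variable {R : Type} [CommRing R]

theorem mem_colon_span {J : Ideal R} {s x : R} :
    x ∈ Submodule.colon J (Ideal.span {s} : Set R) ↔ x * s ∈ J := by
  rw [Submodule.mem_colon]
  constructor
  · intro h
    exact h s (Ideal.mem_span_singleton_self s)
  · intro h y hy
    obtain ⟨c, rfl⟩ := Ideal.mem_span_singleton'.1 hy
    rw [smul_eq_mul]
    have := Ideal.mul_mem_left _ c h
    convert this using 1
    ring

theorem mem_primaryComponent {J q : Ideal R} (hq : q.IsPrime) {x : R}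
    (hx : x ∈ primaryComponent J q) : ∃ s, s ∉ q ∧ s * x ∈ J := by
  let M : Ideal R :=
    { carrier := {x | ∃ s, s ∉ q ∧ s * x ∈ J}
      zero_mem' := ⟨1, q.ne_top_iff_one.1 hq.ne_top, by simp⟩
      add_mem' := by
        rintro a b ⟨s, hs, hsa⟩ ⟨t, ht, htb⟩
        refine ⟨s * t, fun h => (hq.mem_or_mem h).elim hs ht, ?_⟩
        have := J.add_mem (J.mul_mem_left t hsa) (J.mul_mem_left s htb)
        convert this using 1
        ring
      smul_mem' := by
        rintro c a ⟨s, hs, hsa⟩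
        refine ⟨s, hs, ?_⟩
        have := J.mul_mem_left c hsa
        convert this using 1
        rw [smul_eq_mul]
        ring }
  have : primaryComponent J q ≤ M := by
    refine iSup₂_le fun s hs y hy => ?_
    rw [mem_colon_span] at hy
    exact ⟨s, hs, by rwa [mul_comm]⟩
  exact this hx

theorem le_unmixedPart (J : Ideal R) : J ≤ unmixedPart J := by
  refine le_iInf₂ fun q hq => ?_
  refine le_trans ?_ (le_iSup₂ (1 : R) (q.ne_top_iff_one.1 hq.1.ne_top))
  intro x hx
  rw [mem_colon_span, mul_one]
  exact hx

theorem span_triple (f₁ f₂ f₃ : R) :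
    Ideal.span {f₁, f₂, f₃} = Ideal.span {f₁, f₂} ⊔ Ideal.span {f₃} := by
  rw [← Ideal.span_union]
  congr 1
  ext x
  simp
  tauto

theorem colon_unmixed {k : Type} [Field k] {N : ℕ} {f₁ f₂ f₃ : MvPolynomial (Fin N) k}
    (h₁ : f₁ ≠ 0) (hf : IsRelPrime f₁ f₂) (hI : idealHeight (Ideal.span {f₁, f₂, f₃}) = 2)
    (r : MvPolynomial (Fin N) k) :
    r ∈ Submodule.colon (Ideal.span {f₁, f₂})
      (unmixedPart (Ideal.span {f₁, f₂, f₃}) : Set (MvPolynomial (Fin N) k)) ↔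
      r * f₃ ∈ Ideal.span {f₁, f₂} := by
  rw [Submodule.mem_colon]
  constructor
  · intro h
    exact h f₃ (le_unmixedPart _ (Ideal.subset_span (by simp)))
  · intro h x hx
    rw [smul_eq_mul]
    have hrI : ∀ s ∈ Ideal.span {f₁, f₂, f₃}, r * s ∈ Ideal.span {f₁, f₂} := by
      intro s hs
      rw [span_triple] at hs
      obtain ⟨y, hy, z, hz, rfl⟩ := Submodule.mem_sup.1 hs
      obtain ⟨c, rfl⟩ := Ideal.mem_span_singleton'.1 hz
      have := Ideal.add_mem _ (Ideal.mul_mem_left _ r hy) (Ideal.mul_mem_left _ c h)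
      convert this using 1
      ring
    refine unmixed h₁ hf _ fun Q hQ hCQ hQ2 => ?_
    by_cases hIQ : Ideal.span {f₁, f₂, f₃} ≤ Q
    · have hQh : idealHeight Q = idealHeight (Ideal.span {f₁, f₂, f₃}) := by
        rw [hI, idealHeight_eq]
        refine le_antisymm hQ2 ?_
        rw [← hI, idealHeight_eq]
        exact Ideal.height_mono hIQ
      have hx' : x ∈ primaryComponent (Ideal.span {f₁, f₂, f₃}) Q :=
        (iInf₂_le Q ⟨hQ, hIQ, hQh⟩ : unmixedPart _ ≤ _) hx
      obtain ⟨s, hs, hsx⟩ := mem_primaryComponent hQ hx'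
      refine ⟨s, hs, ?_⟩
      have := hrI _ hsx
      convert this using 1
      ring
    · obtain ⟨s, hs, hsQ⟩ := SetLike.not_le_iff_exists.1 hIQ
      refine ⟨s, hsQ, ?_⟩
      have := Ideal.mul_mem_right x _ (hrI s hs)
      convert this using 1
      ring

end caseone

section config

theorem hc_mul_aux {σ k : Type} [CommRing k] {d : ℕ} {g : MvPolynomial σ k}
    (hg : g.IsHomogeneous d) (a : MvPolynomial σ k) (n : ℕ) :
    homogeneousComponent n (a * g) =
      ∑ i ∈ Finset.range (a.totalDegree + 1),
        if n = i + d then homogeneousComponent i a * g else 0 := by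
  conv_lhs => rw [← sum_homogeneousComponent a]
  rw [Finset.sum_mul, map_sum]
  refine Finset.sum_congr rfl fun i _ => ?_
  have h : homogeneousComponent i a * g ∈ homogeneousSubmodule σ k (i + d) :=
    (homogeneousComponent_isHomogeneous i a).mul hg
  rw [homogeneousComponent_of_mem h]

theorem hc_mul_lt {σ k : Type} [CommRing k] {d n : ℕ} {g : MvPolynomial σ k}
    (hg : g.IsHomogeneous d) (a : MvPolynomial σ k) (h : n < d) :
    homogeneousComponent n (a * g) = 0 := by
  rw [hc_mul_aux hg]
  refine Finset.sum_eq_zero fun i _ => ?_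
  rw [if_neg (by omega)]

theorem hc_mul {σ k : Type} [CommRing k] {d : ℕ} {g : MvPolynomial σ k}
    (hg : g.IsHomogeneous d) (a : MvPolynomial σ k) (n : ℕ) :
    homogeneousComponent (n + d) (a * g) = homogeneousComponent n a * g := by
  rw [hc_mul_aux hg]
  simp only [Nat.add_right_cancel_iff]
  rw [Finset.sum_ite_eq]
  split_ifs with h
  · rfl
  · rw [homogeneousComponent_eq_zero, zero_mul]
    rw [Finset.mem_range] at h
    omega

theorem hc_decomp {σ k : Type} [CommRing k] {f x y : MvPolynomial σ k} (hf : f.IsHomogeneous 3)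
    (hx : x.IsHomogeneous 1) (hy : y.IsHomogeneous 1) (h : f ∈ Ideal.span {x, y}) :
    ∃ α β, α.IsHomogeneous 2 ∧ β.IsHomogeneous 2 ∧ f = α * x + β * y := by
  obtain ⟨a, b, hab⟩ := Ideal.mem_span_pair.1 h
  refine ⟨homogeneousComponent 2 a, homogeneousComponent 2 b,
    homogeneousComponent_isHomogeneous _ _, homogeneousComponent_isHomogeneous _ _, ?_⟩
  rw [← hc_mul hx, ← hc_mul hy, ← map_add, hab, homogeneousComponent_eq_self hf]

theorem hc_mem {σ k : Type} [CommRing k] {f₁ f₂ r : MvPolynomial σ k} (hf₁ : f₁.IsHomogeneous 3)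
    (hf₂ : f₂.IsHomogeneous 3) (h : r ∈ Ideal.span {f₁, f₂}) :
    homogeneousComponent 5 r ∈ Ideal.span {f₁, f₂} := by
  obtain ⟨a, b, rfl⟩ := Ideal.mem_span_pair.1 h
  rw [map_add, hc_mul hf₁ a 2, hc_mul hf₂ b 2]
  exact Ideal.mem_span_pair.2 ⟨_, _, rfl⟩

section ringlemmas
variable {R : Type} [CommRing R]

theorem inf_pair {x y z : R} (hp : (Ideal.span {x, z}).IsPrime) (hy : y ∉ Ideal.span {x, z}) :
    Ideal.span {x, y} ⊓ Ideal.span {x, z} = Ideal.span {x, y * z} := by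
  apply le_antisymm
  · rintro r ⟨h1, h2⟩
    obtain ⟨a, b, rfl⟩ := Ideal.mem_span_pair.1 h1
    have hx : x ∈ Ideal.span {x, z} := Ideal.subset_span (by simp)
    have : b * y ∈ Ideal.span {x, z} :=
      ((Ideal.span {x, z}).add_mem_iff_right (Ideal.mul_mem_left _ a hx)).1 h2
    have := (hp.mem_or_mem this).resolve_right hy
    obtain ⟨c, d, rfl⟩ := Ideal.mem_span_pair.1 this
    exact Ideal.mem_span_pair.2 ⟨a + c * y, d, by ring⟩
  · intro r hr
    obtain ⟨a, b, rfl⟩ := Ideal.mem_span_pair.1 hr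
    exact ⟨Ideal.mem_span_pair.2 ⟨a, b * z, by ring⟩, Ideal.mem_span_pair.2 ⟨a, b * y, by ring⟩⟩

theorem inf_path {x y z w : R} (hp : (Ideal.span {x, z}).IsPrime) (hy : y ∉ Ideal.span {x, z})
    (hq : (Ideal.span {z, w}).IsPrime) (hx : x ∉ Ideal.span {z, w}) :
    Ideal.span {x, y} ⊓ Ideal.span {x, z} ⊓ Ideal.span {z, w} =
      Ideal.span {x * z, x * w, y * z} := by
  rw [inf_pair hp hy]
  apply le_antisymm
  · rintro r ⟨h1, h2⟩
    obtain ⟨a, b, rfl⟩ := Ideal.mem_span_pair.1 h1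
    have hz : z ∈ Ideal.span {z, w} := Ideal.subset_span (by simp)
    have : a * x ∈ Ideal.span {z, w} :=
      ((Ideal.span {z, w}).add_mem_iff_left (Ideal.mul_mem_left _ b (Ideal.mul_mem_left _ y hz))).1 h2
    have := (hq.mem_or_mem this).resolve_right hx
    obtain ⟨c, d, rfl⟩ := Ideal.mem_span_pair.1 this
    exact mem_span_triple.2 ⟨c, d, b, by ring⟩
  · intro r hr
    obtain ⟨a, b, c, rfl⟩ := mem_span_triple.1 hr
    exact ⟨Ideal.mem_span_pair.2 ⟨a * z + b * w, c, by ring⟩,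
      Ideal.mem_span_pair.2 ⟨a * x + c * y, b * x, by ring⟩⟩

theorem reg_one {p : Ideal R} {n t : R} (hn : (p ⊔ Ideal.span {n}).IsPrime)
    (ht : t ∉ p ⊔ Ideal.span {n}) {u v : R} (h : u * t - v * n ∈ p) : ∃ e, u - n * e ∈ p := by
  have h1 : u * t ∈ p ⊔ Ideal.span {n} := by
    have : u * t = (u * t - v * n) + v * n := by ring
    rw [this]
    exact Submodule.add_mem_sup h (Ideal.mem_span_singleton'.2 ⟨v, rfl⟩)
  have h2 := (hn.mem_or_mem h1).resolve_right ht
  obtain ⟨y, hy, z, hz, rfl⟩ := Submodule.mem_sup.1 h2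
  obtain ⟨c, rfl⟩ := Ideal.mem_span_singleton'.1 hz
  exact ⟨c, by convert hy using 1; ring⟩

theorem reg_two {p : Ideal R} (hp : p.IsPrime) {m n t : R} (hm : (p ⊔ Ideal.span {m}).IsPrime)
    (hn : (p ⊔ Ideal.span {n}).IsPrime) (hmp : m ∉ p)
    (htm : t ∉ p ⊔ Ideal.span {m}) (htn : t ∉ p ⊔ Ideal.span {n}) {u v : R}
    (h : u * t - v * (m * n) ∈ p) : ∃ e, u - m * n * e ∈ p := by
  obtain ⟨c, hc⟩ := reg_one hm htm (u := u) (v := v * n) (by convert h using 1; ring)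
  have h1 : m * (c * t - v * n) ∈ p := by
    have := p.sub_mem h (p.mul_mem_right t hc)
    convert this using 1
    ring
  have h2 := (hp.mem_or_mem h1).resolve_left hmp
  obtain ⟨e, he⟩ := reg_one hn htn h2
  refine ⟨e, ?_⟩
  have := p.add_mem hc (p.mul_mem_left m he)
  convert this using 1
  ring

end ringlemmas

section spaces
variable {k : Type} [Field k] {N : ℕ}

theorem exists_pair {V : Submodule k (Fin N → k)} (hV : Module.finrank k V = 2) {x : Fin N → k}
    (hx : x ∈ V) (hx0 : x ≠ 0) :
    ∃ y, y ∈ V ∧ y ∉ Submodule.span k {x} ∧ V = Submodule.span k {x, y} := by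
  have hle : Submodule.span k {x} ≤ V := by simpa using hx
  have hlt : Submodule.span k {x} < V := by
    refine lt_of_le_of_ne hle fun h => ?_
    rw [← h, finrank_span_singleton hx0] at hV
    omega
  obtain ⟨y, hy, hyx⟩ := SetLike.exists_of_lt hlt
  refine ⟨y, hy, hyx, ?_⟩
  have hle2 : Submodule.span k {x, y} ≤ V := by
    rw [Submodule.span_le]
    rintro z (rfl | rfl) <;> assumption
  symm
  apply Submodule.eq_of_le_of_finrank_le hle2
  rw [hV]
  have h3 : Submodule.span k {x} < Submodule.span k {x, y} := by
    refine lt_of_le_of_ne (Submodule.span_mono (by simp)) fun h => ?_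
    rw [h] at hyx
    exact hyx (Submodule.subset_span (by simp))
  have := Submodule.finrank_lt_finrank_of_lt h3
  rw [finrank_span_singleton hx0] at this
  omega

theorem exists_ne_of_rank {V : Submodule k (Fin N → k)} (hV : Module.finrank k V = 2) :
    ∃ x ∈ V, x ≠ 0 := by
  apply Submodule.exists_mem_ne_zero_of_ne_bot
  rintro rfl
  simp at hV

theorem not_le_sup {V W : Submodule k (Fin N → k)} (hV : Module.finrank k V = 2)
    (hW : Module.finrank k W = 2) (h : V ⊓ W = ⊥) (m : Fin N → k) :
    ¬ W ≤ V ⊔ Submodule.span k {m} := by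
  intro hle
  have h1 := Submodule.finrank_sup_add_finrank_inf_eq V W
  rw [h, finrank_bot] at h1
  have h2 : V ⊔ W ≤ V ⊔ Submodule.span k {m} := sup_le le_sup_left hle
  have h3 := Submodule.finrank_mono h2
  have h4 := Submodule.finrank_add_le_finrank_add_finrank V (Submodule.span k {m})
  have h5 := finrank_span_le_card (R := k) ({m} : Set (Fin N → k))
  simp at h5
  omega

theorem not_cover {V A B : Submodule k (Fin N → k)} (hA : ¬ V ≤ A) (hB : ¬ V ≤ B) :
    ∃ v ∈ V, v ∉ A ∧ v ∉ B := by
  obtain ⟨a, ha, haA⟩ := SetLike.not_le_iff_exists.1 hA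
  obtain ⟨b, hb, hbB⟩ := SetLike.not_le_iff_exists.1 hB
  by_cases h1 : a ∈ B
  · by_cases h2 : b ∈ A
    · exact ⟨a + b, V.add_mem ha hb, fun h => haA ((A.add_mem_iff_left h2).1 h),
        fun h => hbB ((B.add_mem_iff_right h1).1 h)⟩
    · exact ⟨b, hb, h2, hbB⟩
  · exact ⟨a, ha, haA, h1⟩

end spaces
end config

section good
variable {k : Type} [Field k] {N : ℕ}

/-- The outcome of the analysis of the configuration of three linear primes. -/
def Good (f₁ f₂ : MvPolynomial (Fin N) k) (K : Ideal (MvPolynomial (Fin N) k)) : Prop :=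
  f₁ ∈ K → f₂ ∈ K →
  PD (Submodule.colon (Ideal.span {f₁, f₂}) (K : Set (MvPolynomial (Fin N) k))) 3 ∧
  (PD K 3 ∨ ∀ f₃ : MvPolynomial (Fin N) k, f₃.IsHomogeneous 3 →
    ¬ ∀ r, r ∈ K ↔ r * f₃ ∈ Ideal.span {f₁, f₂})

variable {f₁ f₂ : MvPolynomial (Fin N) k} (hf : IsRelPrime f₁ f₂) (h₁ : f₁ ≠ 0) (h₂ : f₂ ≠ 0)
variable {V₁ V₂ V₃ : Submodule k (Fin N → k)} (d₁ : Module.finrank k V₁ = 2)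
  (d₂ : Module.finrank k V₂ = 2) (d₃ : Module.finrank k V₃ = 2)
  (n₁₂ : V₁ ≠ V₂) (n₁₃ : V₁ ≠ V₃) (n₂₃ : V₂ ≠ V₃)

theorem pair_not_mem {x y : Fin N → k} {V W : Submodule k (Fin N → k)}
    (hV : Module.finrank k V = 2) (hW : Module.finrank k W = 2) (hne : V ≠ W) (hx : x ∈ W)
    (h : V = Submodule.span k {x, y}) : y ∉ W := by
  intro hy
  apply hne
  apply Submodule.eq_of_le_of_finrank_eq
  · rw [h, Submodule.span_le]
    rintro z (rfl | rfl) <;> assumption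
  · rw [hV, hW]

include hf h₁ h₂ d₁ d₂ d₃ n₁₂ n₁₃ n₂₃ in
theorem good_common {x : Fin N → k} (hx : x ≠ 0) (x₁ : x ∈ V₁) (x₂ : x ∈ V₂) (x₃ : x ∈ V₃) :
    Good f₁ f₂ (LP V₁ ⊓ LP V₂ ⊓ LP V₃) := by
  obtain ⟨y₁, hy₁, hy₁', e₁⟩ := exists_pair d₁ x₁ hx
  obtain ⟨y₂, hy₂, hy₂', e₂⟩ := exists_pair d₂ x₂ hx
  obtain ⟨y₃, hy₃, hy₃', e₃⟩ := exists_pair d₃ x₃ hx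
  have p₂ := LP_prime V₂
  have p₃ := LP_prime V₃
  have a : lin y₁ ∉ LP V₂ := fun h => pair_not_mem d₁ d₂ n₁₂ x₂ e₁ (lin_mem.1 h)
  have b : lin y₁ ∉ LP V₃ := fun h => pair_not_mem d₁ d₃ n₁₃ x₃ e₁ (lin_mem.1 h)
  have c : lin y₂ ∉ LP V₃ := fun h => pair_not_mem d₂ d₃ n₂₃ x₃ e₂ (lin_mem.1 h)
  have d : lin y₁ * lin y₂ ∉ LP V₃ := fun h => (p₃.mem_or_mem h).elim b c
  have E₁ : LP V₁ = Ideal.span {lin x, lin y₁} := by rw [e₁, LP_pair]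
  have E₂ : LP V₂ = Ideal.span {lin x, lin y₂} := by rw [e₂, LP_pair]
  have E₃ : LP V₃ = Ideal.span {lin x, lin y₃} := by rw [e₃, LP_pair]
  rw [E₂] at p₂ a
  rw [E₃] at p₃ d
  have hK : LP V₁ ⊓ LP V₂ ⊓ LP V₃ = Ideal.span {lin x, lin y₁ * lin y₂ * lin y₃} := by
    rw [E₁, E₂, E₃, inf_pair p₂ a, inf_pair p₃ d]
  have hrel : IsRelPrime (lin x) (lin y₁ * lin y₂ * lin y₃) :=
    ((lin_relPrime hx hy₁').mul_right (lin_relPrime hx hy₂')).mul_right (lin_relPrime hx hy₃')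
  rw [hK]
  intro m₁ m₂
  exact ⟨colon_CI hf h₂ hrel (lin_ne_zero hx) h₁ m₁ m₂,
    Or.inl ((PD_span2 (lin_ne_zero hx) hrel).mono (by omega))⟩

include hf h₁ h₂ d₁ d₂ d₃ n₁₂ in
theorem good_path {x z : Fin N → k} (hx : x ≠ 0) (hz : z ≠ 0) (x₁ : x ∈ V₁) (x₂ : x ∈ V₂)
    (z₂ : z ∈ V₂) (z₃ : z ∈ V₃) (x₃ : x ∉ V₃) (z₁ : z ∉ V₁) :
    Good f₁ f₂ (LP V₁ ⊓ LP V₂ ⊓ LP V₃) := by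
  obtain ⟨y, hy, hy', e₁⟩ := exists_pair d₁ x₁ hx
  obtain ⟨w, hw, hw', e₃⟩ := exists_pair d₃ z₃ hz
  have hzx : z ∉ Submodule.span k {x} := fun h =>
    z₁ ((Submodule.span_singleton_le_iff_mem x V₁).2 x₁ h)
  have hxz : x ∉ Submodule.span k {z} := fun h =>
    x₃ ((Submodule.span_singleton_le_iff_mem z V₃).2 z₃ h)
  have e₂ : V₂ = Submodule.span k {x, z} := by
    obtain ⟨y', hy', hy'', e⟩ := exists_pair d₂ x₂ hx
    symm
    have hle : Submodule.span k {x, z} ≤ V₂ := by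
      rw [Submodule.span_le]
      rintro u (rfl | rfl) <;> assumption
    apply Submodule.eq_of_le_of_finrank_le hle
    rw [d₂]
    have h3 : Submodule.span k {x} < Submodule.span k {x, z} := by
      refine lt_of_le_of_ne (Submodule.span_mono (by simp)) fun h => ?_
      rw [h] at hzx
      exact hzx (Submodule.subset_span (by simp))
    have := Submodule.finrank_lt_finrank_of_lt h3
    rw [finrank_span_singleton hx] at this
    omega
  have p₂ := LP_prime V₂
  have p₃ := LP_prime V₃
  have a : lin y ∉ LP V₂ := fun h => pair_not_mem d₁ d₂ n₁₂ x₂ e₁ (lin_mem.1 h)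
  have b : lin x ∉ LP V₃ := fun h => x₃ (lin_mem.1 h)
  have E₁ : LP V₁ = Ideal.span {lin x, lin y} := by rw [e₁, LP_pair]
  have E₂ : LP V₂ = Ideal.span {lin x, lin z} := by rw [e₂, LP_pair]
  have E₃ : LP V₃ = Ideal.span {lin z, lin w} := by rw [e₃, LP_pair]
  rw [E₂] at p₂ a
  rw [E₃] at p₃ b
  rw [E₁, E₂, E₃, inf_path p₂ a p₃ b]
  intro m₁ m₂
  exact ⟨colon_path hf h₂ (lin_relPrime hx hy') (lin_ne_zero hx)
      ((lin_relPrime hz hxz).mul_right (lin_relPrime hz hw')) (lin_ne_zero hz) h₁ m₁ m₂,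
    Or.inl ((PD_path (lin_relPrime hx hy') (lin_ne_zero hx) (lin_relPrime hx hzx)
      (lin_relPrime hz hw') (lin_ne_zero hz)).mono (by omega))⟩

theorem disj_not_mem {V W : Submodule k (Fin N → k)} (h : V ⊓ W = ⊥) {m : Fin N → k}
    (hm : m ∈ W) (h0 : m ≠ 0) : m ∉ V := by
  intro hV
  apply h0
  have : m ∈ V ⊓ W := ⟨hV, hm⟩
  rw [h] at this
  simpa using this

include hf h₁ h₂ d₂ d₃ n₂₃ in
theorem colon_two (m₁ : f₁ ∈ LP V₂ ⊓ LP V₃) (m₂ : f₂ ∈ LP V₂ ⊓ LP V₃) :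
    PD (Submodule.colon (Ideal.span {f₁, f₂})
      ((LP V₂ ⊓ LP V₃ : Ideal _) : Set (MvPolynomial (Fin N) k))) 3 := by
  by_cases hdis : V₂ ⊓ V₃ = ⊥
  · obtain ⟨x, hx, hx0⟩ := exists_ne_of_rank d₂
    obtain ⟨n, hn, hn0⟩ := exists_ne_of_rank d₃
    obtain ⟨y, hy, hy', e₂⟩ := exists_pair d₂ hx hx0
    obtain ⟨n', hn', hn'', e₃⟩ := exists_pair d₃ hn hn0
    have E₂ : LP V₂ = Ideal.span {lin x, lin y} := by rw [e₂, LP_pair]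
    have E₃ : LP V₃ = Ideal.span {lin n, lin n'} := by rw [e₃, LP_pair]
    have p₂ := LP_prime V₂
    have hnn : n' ∉ V₂ ⊔ Submodule.span k {n} := by
      intro h
      apply not_le_sup d₂ d₃ hdis n
      rw [e₃, Submodule.span_le]
      rintro z (rfl | rfl)
      · exact Submodule.mem_sup_right (Submodule.mem_span_singleton_self _)
      · exact h
    have hq := colon_CI hf h₂ (lin_relPrime hn0 hn'') (lin_ne_zero hn0) h₁
      (by rw [← E₃]; exact m₁.2) (by rw [← E₃]; exact m₂.2)
    rw [← E₃] at hq
    have hreg : ∀ u v, u * lin n' - v * lin n ∈ LP V₂ → ∃ e, u - lin n * e ∈ LP V₂ := by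
      intro u v h
      have hp := LP_prime (V₂ ⊔ Submodule.span k {n})
      rw [← lin_mem] at hnn
      rw [LP_sup] at hp hnn
      exact reg_one hp hnn h
    have hs' : lin n ∉ LP V₂ := fun h => disj_not_mem hdis hn hn0 (lin_mem.1 h)
    have hn1 : lin n ∈ LP V₃ := lin_mem.2 hn
    have hn2 : lin n' ∈ LP V₃ := lin_mem.2 hn'
    obtain ⟨m₁, -⟩ := m₁
    obtain ⟨m₂, -⟩ := m₂
    rw [E₂] at *
    exact colon_iso hf h₂ (lin_relPrime hx0 hy') (lin_ne_zero hx0) p₂ m₁ m₂ hn1 hn2 hs' hreg hq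
  · obtain ⟨x, hx, hx0⟩ := Submodule.exists_mem_ne_zero_of_ne_bot hdis
    obtain ⟨y, hy, hy', e₂⟩ := exists_pair d₂ hx.1 hx0
    obtain ⟨z, hz, hz', e₃⟩ := exists_pair d₃ hx.2 hx0
    have E₂ : LP V₂ = Ideal.span {lin x, lin y} := by rw [e₂, LP_pair]
    have E₃ : LP V₃ = Ideal.span {lin x, lin z} := by rw [e₃, LP_pair]
    have p₃ := LP_prime V₃
    have c : lin y ∉ LP V₃ := fun h => pair_not_mem d₂ d₃ n₂₃ hx.2 e₂ (lin_mem.1 h)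
    rw [E₃] at p₃ c
    rw [E₂, E₃, inf_pair p₃ c] at m₁ m₂ ⊢
    exact colon_CI hf h₂ ((lin_relPrime hx0 hy').mul_right (lin_relPrime hx0 hz'))
      (lin_ne_zero hx0) h₁ m₁ m₂

include hf h₁ h₂ d₁ d₂ d₃ n₂₃ in
theorem good_iso (hf₁ : f₁.IsHomogeneous 3) (hf₂ : f₂.IsHomogeneous 3)
    (h12 : V₁ ⊓ V₂ = ⊥) (h13 : V₁ ⊓ V₃ = ⊥) :
    Good f₁ f₂ (LP V₁ ⊓ (LP V₂ ⊓ LP V₃)) := by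
  intro m₁ m₂
  have hq := colon_two hf h₁ h₂ d₂ d₃ n₂₃ m₁.2 m₂.2
  obtain ⟨x, hx, hx0⟩ := exists_ne_of_rank d₁
  obtain ⟨y, hy, hy', e₁⟩ := exists_pair d₁ hx hx0
  have E₁ : LP V₁ = Ideal.span {lin x, lin y} := by rw [e₁, LP_pair]
  obtain ⟨m, hm, hm0⟩ := exists_ne_of_rank d₂
  obtain ⟨n, hn, hn0⟩ := exists_ne_of_rank d₃
  obtain ⟨m', hm', hmm, hmn⟩ := not_cover (not_le_sup d₁ d₂ h12 m) (not_le_sup d₁ d₂ h12 n)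
  obtain ⟨n', hn', hnm, hnn⟩ := not_cover (not_le_sup d₁ d₃ h13 m) (not_le_sup d₁ d₃ h13 n)
  have p₁ := LP_prime V₁
  have pm := LP_prime (V₁ ⊔ Submodule.span k {m})
  have pn := LP_prime (V₁ ⊔ Submodule.span k {n})
  have hmV : lin m ∉ LP V₁ := fun h => disj_not_mem h12 hm hm0 (lin_mem.1 h)
  have hnV : lin n ∉ LP V₁ := fun h => disj_not_mem h13 hn hn0 (lin_mem.1 h)
  have htm : lin m' * lin n' ∉ LP (V₁ ⊔ Submodule.span k {m}) := fun h =>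
    (pm.mem_or_mem h).elim (fun h => hmm (lin_mem.1 h)) (fun h => hnm (lin_mem.1 h))
  have htn : lin m' * lin n' ∉ LP (V₁ ⊔ Submodule.span k {n}) := fun h =>
    (pn.mem_or_mem h).elim (fun h => hmn (lin_mem.1 h)) (fun h => hnn (lin_mem.1 h))
  rw [LP_sup] at pm pn htm htn
  have hreg : ∀ u v, u * (lin m' * lin n') - v * (lin m * lin n) ∈ LP V₁ →
      ∃ e, u - lin m * lin n * e ∈ LP V₁ := fun u v h => reg_two p₁ pm pn hmV htm htn h
  have hs : lin m * lin n ∈ LP V₂ ⊓ LP V₃ :=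
    ⟨Ideal.mul_mem_right _ _ (lin_mem.2 hm), Ideal.mul_mem_left _ _ (lin_mem.2 hn)⟩
  have ht : lin m' * lin n' ∈ LP V₂ ⊓ LP V₃ :=
    ⟨Ideal.mul_mem_right _ _ (lin_mem.2 hm'), Ideal.mul_mem_left _ _ (lin_mem.2 hn')⟩
  have hs' : lin m * lin n ∉ LP V₁ := fun h => (p₁.mem_or_mem h).elim hmV hnV
  obtain ⟨m₁, -⟩ := m₁
  obtain ⟨m₂, -⟩ := m₂
  rw [E₁] at m₁ m₂ hreg hs' p₁ ⊢
  refine ⟨colon_iso hf h₂ (lin_relPrime hx0 hy') (lin_ne_zero hx0) p₁ m₁ m₂ hs ht hs' hreg hq,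
    Or.inr ?_⟩
  intro f₃ hf₃ hK
  obtain ⟨α, β, hα, hβ, ef₁⟩ := hc_decomp hf₁ (lin_homog x) (lin_homog y) m₁
  obtain ⟨γ, δ, hγ, hδ, ef₂⟩ := hc_decomp hf₂ (lin_homog x) (lin_homog y) m₂
  obtain ⟨e, he⟩ := iso_decomp hf h₂ (lin_relPrime hx0 hy') (lin_ne_zero hx0) ef₁ ef₂ p₁ hs ht hs'
    hreg (r := f₃) (fun g hg => by rw [mul_comm]; exact (hK g).1 hg)
  have h5 := hc_mem hf₁ hf₂ (he _ hs)
  have hs2 : (lin m * lin n).IsHomogeneous 2 := (lin_homog m).mul (lin_homog n)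
  have hΔ : (α * δ - β * γ).IsHomogeneous 4 := (hα.mul hδ).sub (hβ.mul hγ)
  rw [sub_mul, map_sub, mul_assoc e, hc_mul_lt (hΔ.mul hs2) e (by omega), sub_zero,
    homogeneousComponent_eq_self (hf₃.mul hs2), mul_comm] at h5
  exact hs' ((hK _).2 h5).1

include hf h₁ h₂ d₁ d₂ d₃ n₁₂ n₁₃ n₂₃ in
theorem good_center (h12 : V₁ ⊓ V₂ ≠ ⊥) (h23 : V₂ ⊓ V₃ ≠ ⊥) :
    Good f₁ f₂ (LP V₁ ⊓ LP V₂ ⊓ LP V₃) := by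
  obtain ⟨x, hx, hx0⟩ := Submodule.exists_mem_ne_zero_of_ne_bot h12
  obtain ⟨z, hz, hz0⟩ := Submodule.exists_mem_ne_zero_of_ne_bot h23
  by_cases h1 : x ∈ V₃
  · exact good_common hf h₁ h₂ d₁ d₂ d₃ n₁₂ n₁₃ n₂₃ hx0 hx.1 hx.2 h1
  by_cases h2 : z ∈ V₁
  · exact good_common hf h₁ h₂ d₁ d₂ d₃ n₁₂ n₁₃ n₂₃ hz0 h2 hz.1 hz.2
  exact good_path hf h₁ h₂ d₁ d₂ d₃ n₁₂ hx0 hz0 hx.1 hx.2 hz.1 hz.2 h1 h2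

include hf h₁ h₂ d₁ d₂ d₃ n₁₂ n₁₃ n₂₃ in
theorem good_all (hf₁ : f₁.IsHomogeneous 3) (hf₂ : f₂.IsHomogeneous 3) :
    Good f₁ f₂ (LP V₁ ⊓ LP V₂ ⊓ LP V₃) := by
  by_cases h12 : V₁ ⊓ V₂ = ⊥
  · by_cases h13 : V₁ ⊓ V₃ = ⊥
    · rw [inf_assoc]
      exact good_iso hf h₁ h₂ d₁ d₂ d₃ n₂₃ hf₁ hf₂ h12 h13
    by_cases h23 : V₂ ⊓ V₃ = ⊥
    · rw [inf_comm (LP V₁), inf_assoc]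
      exact good_iso hf h₁ h₂ d₂ d₁ d₃ n₁₃ hf₁ hf₂ (by rwa [inf_comm]) h23
    · rw [inf_assoc, inf_comm (LP V₂), ← inf_assoc]
      exact good_center hf h₁ h₂ d₁ d₃ d₂ n₁₃ n₁₂ n₂₃.symm h13 (by rwa [inf_comm])
  · by_cases h23 : V₂ ⊓ V₃ = ⊥
    · by_cases h13 : V₁ ⊓ V₃ = ⊥
      · rw [inf_comm]
        exact good_iso hf h₁ h₂ d₃ d₁ d₂ n₁₂ hf₁ hf₂ (by rwa [inf_comm]) (by rwa [inf_comm])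
      · rw [inf_comm (LP V₁)]
        exact good_center hf h₁ h₂ d₂ d₁ d₃ n₁₂.symm n₂₃ n₁₃ (by rwa [inf_comm]) h13
    · exact good_center hf h₁ h₂ d₁ d₂ d₃ n₁₂ n₁₃ n₂₃ h12 h23

end good

theorem statement_9
    {k : Type} [Field k] [IsAlgClosed k] {N : ℕ}
    (f₁ f₂ f₃ : MvPolynomial (Fin N) k)
    (hf₁ : f₁.IsHomogeneous 3) (hf₂ : f₂.IsHomogeneous 3) (hf₃ : f₃.IsHomogeneous 3)
    (hIht : idealHeight (Ideal.span {f₁, f₂, f₃}) = 2)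
    (hht₁₂ : idealHeight (Ideal.span {f₁, f₂}) = 2)
    (hht₁₃ : idealHeight (Ideal.span {f₁, f₃}) = 2)
    (hht₂₃ : idealHeight (Ideal.span {f₂, f₃}) = 2)
    (p₁ p₂ p₃ : Ideal (MvPolynomial (Fin N) k))
    (hp₁ : IsLinearPrime p₁) (hp₂ : IsLinearPrime p₂) (hp₃ : IsLinearPrime p₃)
    (hpht₁ : idealHeight p₁ = 2) (hpht₂ : idealHeight p₂ = 2) (hpht₃ : idealHeight p₃ = 2)
    (hne₁₂ : p₁ ≠ p₂) (hne₁₃ : p₁ ≠ p₃) (hne₂₃ : p₂ ≠ p₃)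
    (hK : p₁ ⊓ p₂ ⊓ p₃ = unmixedPart (Ideal.span {f₁, f₂, f₃}) ∨
          p₁ ⊓ p₂ ⊓ p₃ = Submodule.colon (Ideal.span {f₁, f₂}) (Ideal.span {f₃})) :
    pdQuotLE (Ideal.span {f₁, f₂, f₃}) 4 := by
  obtain ⟨h₁, h₂, hf⟩ := relPrime_of_height hht₁₂
  obtain ⟨V₁, d₁, rfl⟩ := linearPrime_eq hp₁ hpht₁
  obtain ⟨V₂, d₂, rfl⟩ := linearPrime_eq hp₂ hpht₂
  obtain ⟨V₃, d₃, rfl⟩ := linearPrime_eq hp₃ hpht₃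
  have good := good_all hf h₁ h₂ d₁ d₂ d₃ (fun h => hne₁₂ (by rw [h]))
    (fun h => hne₁₃ (by rw [h])) (fun h => hne₂₃ (by rw [h])) hf₁ hf₂
  set K := LP V₁ ⊓ LP V₂ ⊓ LP V₃ with hKdef
  have hC : PD (Ideal.span {f₁, f₂}) 4 := (PD_span2 h₁ hf).mono (by omega)
  have hfin : PD (Ideal.span {f₁, f₂, f₃}) 4 := by
    rcases hK with hK | hK
    · have hIK : Ideal.span {f₁, f₂, f₃} ≤ K := by
        rw [hK]
        exact le_unmixedPart _
      obtain ⟨g, -⟩ := good (hIK (Ideal.subset_span (by simp)))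
        (hIK (Ideal.subset_span (by simp)))
      refine PD_step (d := f₃) hC ?_ (span_triple f₁ f₂ f₃) g
      intro r
      rw [hK]
      exact colon_unmixed h₁ hf hIht r
    · have hr : ∀ r, r ∈ K ↔ r * f₃ ∈ Ideal.span {f₁, f₂} := by
        intro r
        rw [hK]
        exact mem_colon_span
      have hCK : Ideal.span {f₁, f₂} ≤ K := fun r hrC => (hr r).2 (Ideal.mul_mem_right _ _ hrC)
      obtain ⟨-, g | g⟩ := good (hCK (Ideal.subset_span (by simp)))
        (hCK (Ideal.subset_span (by simp)))
      · exact PD_step (d := f₃) hC hr (span_triple f₁ f₂ f₃) g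
      · exact absurd hr (g f₃ hf₃)
  exact exists_res_of_pd 4 _ hfin

end
end
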